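/- Let n ≥ 1, let U ⊆ ℂⁿ be open, let φ : U → ℝ be a smooth strictly plurisubharmonic function, and assume that K = {z ∈ U : φ(z) ≤ 0} is compact. Then K is convex with respect to principal hypersurfaces if and only if there exist a smooth strictly plurisubharmonic function ψ : ℂⁿ → ℝ and an open set V with K ⊆ V ⊆ U such that ψ − φ is pluriharmonic on V. -/

import Mathlib

open Complex MeasureTheory

/-- The Levi quadratic form of a real-valued function on ℂⁿ:
`H_φ(x)(w) = D²φ(x)(w,w) + D²φ(x)(iw,iw)`. -/
noncomputable def leviForm {n : ℕ} (φ : EuclideanSpace ℂ (Fin n) → ℝ)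
    (x w : EuclideanSpace ℂ (Fin n)) : ℝ :=
  iteratedFDeriv ℝ 2 φ x ![w, w] +
    iteratedFDeriv ℝ 2 φ x ![Complex.I • w, Complex.I • w]

/-- A compact set `K ⊆ ℂⁿ` is convex with respect to principal hypersurfaces if every point
outside `K` is separated from `K` by the zero set of an entire function. -/
def PrincipalConvex {n : ℕ} (K : Set (EuclideanSpace ℂ (Fin n))) : Prop :=
  ∀ a ∉ K, ∃ f : EuclideanSpace ℂ (Fin n) → ℂ,
    Differentiable ℂ f ∧ f a = 0 ∧ ∀ z ∈ K, f z ≠ 0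

section

open scoped ContDiff ComplexConjugate InnerProductSpace ENNReal Convolution

/-- Complex Euclidean space. -/
abbrev Cn (n : ℕ) := EuclideanSpace ℂ (Fin n)

namespace Cn

variable {n : ℕ}

/-- The standard basis vectors of `ℂⁿ`. -/
noncomputable abbrev e (j : Fin n) : Cn n := EuclideanSpace.single j (1 : ℂ)

/-- The first-order operator `½ (∂_{x_j} + σ ∂_{y_j})`; it is `∂/∂z̄_j` for `σ = I` and
`∂/∂z_j` for `σ = -I`. -/
noncomputable def wd (σ : ℂ) (j : Fin n) (u : Cn n → ℂ) (x : Cn n) : ℂ :=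
  (1 / 2) * (fderiv ℝ u x (e j) + σ * fderiv ℝ u x (I • e j))

section Calculus

variable {σ τ : ℂ} {j k : Fin n} {u v : Cn n → ℂ} {x : Cn n}

theorem contDiff_wd (hu : ContDiff ℝ ∞ u) : ContDiff ℝ ∞ (wd σ j u) := by
  have h : ContDiff ℝ ∞ (fderiv ℝ u) := hu.fderiv_right (by simp)
  unfold wd
  fun_prop

theorem tsupport_wd_subset : tsupport (wd σ j u) ⊆ tsupport u := by
  refine closure_minimal (fun x hx => ?_) (isClosed_tsupport u)
  by_contra hxu
  have h0 : fderiv ℝ u x = 0 := by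
    by_contra h
    exact hxu (support_fderiv_subset ℝ h)
  exact hx (by simp [wd, h0])

theorem hasCompactSupport_wd (hu : HasCompactSupport u) : HasCompactSupport (wd σ j u) :=
  hu.of_isClosed_subset (isClosed_tsupport _) tsupport_wd_subset

theorem wd_congr (h : u =ᶠ[nhds x] v) : wd σ j u x = wd σ j v x := by
  simp [wd, h.fderiv_eq]

theorem wd_add (hu : DifferentiableAt ℝ u x) (hv : DifferentiableAt ℝ v x) :
    wd σ j (fun y => u y + v y) x = wd σ j u x + wd σ j v x := by
  simp only [wd]
  rw [fderiv_fun_add hu hv]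
  simp only [add_apply]
  ring

theorem wd_sum {ι : Type*} {s : Finset ι} {u : ι → Cn n → ℂ}
    (hu : ∀ i ∈ s, DifferentiableAt ℝ (u i) x) :
    wd σ j (fun y => ∑ i ∈ s, u i y) x = ∑ i ∈ s, wd σ j (u i) x := by
  simp only [wd]
  rw [fderiv_fun_sum hu]
  simp only [sum_apply, Finset.mul_sum, ← Finset.sum_add_distrib, mul_add]

theorem wd_neg : wd σ j (fun y => - u y) x = - wd σ j u x := by
  simp only [wd]
  rw [fderiv_fun_neg]
  simp only [neg_apply]
  ring

theorem wd_sub (hu : DifferentiableAt ℝ u x) (hv : DifferentiableAt ℝ v x) :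
    wd σ j (fun y => u y - v y) x = wd σ j u x - wd σ j v x := by
  simp only [wd]
  rw [fderiv_fun_sub hu hv]
  simp only [sub_apply]
  ring

theorem wd_const (c : ℂ) : wd σ j (fun _ => c) x = 0 := by
  simp [wd]

theorem wd_mul (hu : DifferentiableAt ℝ u x) (hv : DifferentiableAt ℝ v x) :
    wd σ j (fun y => u y * v y) x = wd σ j u x * v x + u x * wd σ j v x := by
  simp only [wd]
  rw [fderiv_fun_mul hu hv]
  simp only [add_apply, smul_apply, smul_eq_mul]
  ring

theorem conj_wd (hu : DifferentiableAt ℝ u x) :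
    conj (wd σ j u x) = wd (conj σ) j (fun y => conj (u y)) x := by
  have h : HasFDerivAt (fun y => conj (u y)) (conjCLE.toContinuousLinearMap ∘L fderiv ℝ u x) x :=
    (conjCLE.toContinuousLinearMap.hasFDerivAt (x := u x)).comp x hu.hasFDerivAt
  simp only [wd]
  rw [h.fderiv]
  simp [Complex.conj_ofNat]

theorem wd_cexp (hu : DifferentiableAt ℝ u x) :
    wd σ j (fun y => cexp (u y)) x = cexp (u x) * wd σ j u x := by
  simp only [wd]
  rw [hu.hasFDerivAt.cexp.fderiv]
  simp only [smul_apply, smul_eq_mul]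
  ring

theorem wd_wd_eq (hu : ContDiff ℝ ∞ u) : wd σ j (wd τ k u) x =
    (1 / 4) * (fderiv ℝ (fderiv ℝ u) x (e j) (e k)
      + τ * fderiv ℝ (fderiv ℝ u) x (e j) (I • e k)
      + σ * fderiv ℝ (fderiv ℝ u) x (I • e j) (e k)
      + σ * τ * fderiv ℝ (fderiv ℝ u) x (I • e j) (I • e k)) := by
  have h : ContDiff ℝ ∞ (fderiv ℝ u) := hu.fderiv_right (by simp)
  have hd : DifferentiableAt ℝ (fderiv ℝ u) x := h.differentiable (by simp) x
  have key : ∀ (τ : ℂ) (k : Fin n) (a : Cn n), fderiv ℝ (wd τ k u) x a =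
      (1 / 2) * (fderiv ℝ (fderiv ℝ u) x a (e k) + τ * fderiv ℝ (fderiv ℝ u) x a (I • e k)) := by
    intro τ k a
    have h1 : ∀ b : Cn n, HasFDerivAt (fun y => fderiv ℝ u y b)
        ((fderiv ℝ (fderiv ℝ u) x).flip b) x := fun b => by
      have := hd.hasFDerivAt.clm_apply (hasFDerivAt_const b x)
      simpa using this
    have h2 := ((h1 (e k)).add ((h1 (I • e k)).const_mul τ)).const_mul (1 / 2)
    have h3 : HasFDerivAt (wd τ k u) _ x := h2
    rw [h3.fderiv]
    simp
    ring
  simp only [wd.eq_def σ, key]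
  ring

theorem wd_comm (hu : ContDiff ℝ ∞ u) : wd σ j (wd τ k u) x = wd τ k (wd σ j u) x := by
  have hs : ∀ a b, fderiv ℝ (fderiv ℝ u) x a b = fderiv ℝ (fderiv ℝ u) x b a := fun a b =>
    (hu.contDiffAt (x := x)).isSymmSndFDerivAt
      (by simpa using WithTop.coe_le_coe.2 (le_top : (2 : ℕ∞) ≤ ⊤)) a b
  rw [wd_wd_eq hu, wd_wd_eq hu, hs (e k) (e j), hs (e k) (I • e j), hs (I • e k) (e j),
    hs (I • e k) (I • e j)]
  ring

/-- Integration by parts for `wd`. -/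
theorem integral_wd_mul (hu : ContDiff ℝ ∞ u) (hv : ContDiff ℝ ∞ v)
    (hc : HasCompactSupport u ∨ HasCompactSupport v) :
    ∫ x, wd σ j u x * v x = - ∫ x, u x * wd σ j v x := by
  have hu' : ContDiff ℝ ∞ (fderiv ℝ u) := hu.fderiv_right (by simp)
  have hv' : ContDiff ℝ ∞ (fderiv ℝ v) := hv.fderiv_right (by simp)
  have hud : Differentiable ℝ u := hu.differentiable (by simp)
  have hvd : Differentiable ℝ v := hv.differentiable (by simp)
  have i1 : ∀ a : Cn n, Integrable (fun x => fderiv ℝ u x a * v x) := fun a =>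
    Continuous.integrable_of_hasCompactSupport
      ((hu'.continuous.clm_apply continuous_const).mul hv.continuous)
      (hc.elim (fun h => (h.fderiv_apply (𝕜 := ℝ) a).mul_right) (fun h => h.mul_left))
  have i2 : ∀ a : Cn n, Integrable (fun x => u x * fderiv ℝ v x a) := fun a =>
    Continuous.integrable_of_hasCompactSupport
      (hu.continuous.mul (hv'.continuous.clm_apply continuous_const))
      (hc.elim (fun h => h.mul_right) (fun h => (h.fderiv_apply (𝕜 := ℝ) a).mul_left))
  have i3 : Integrable (fun x => u x * v x) :=
    Continuous.integrable_of_hasCompactSupport (hu.continuous.mul hv.continuous)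
      (hc.elim (fun h => h.mul_right) (fun h => h.mul_left))
  have hp : ∀ a : Cn n, ∫ x, u x * fderiv ℝ v x a = - ∫ x, fderiv ℝ u x a * v x := fun a =>
    integral_mul_fderiv_eq_neg_fderiv_mul_of_integrable (i1 a) (i2 a) i3
      (fun x _ => hud x) (fun x _ => hvd x)
  have l : ∀ x, wd σ j u x * v x =
      (1 / 2) * (fderiv ℝ u x (e j) * v x) + (σ / 2) * (fderiv ℝ u x (I • e j) * v x) := by
    intro x; simp only [wd]; ring
  have r : ∀ x, u x * wd σ j v x =
      (1 / 2) * (u x * fderiv ℝ v x (e j)) + (σ / 2) * (u x * fderiv ℝ v x (I • e j)) := by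
    intro x; simp only [wd]; ring
  simp_rw [l, r]
  rw [integral_add ((i1 _).const_mul _) ((i1 _).const_mul _),
    integral_add ((i2 _).const_mul _) ((i2 _).const_mul _)]
  simp only [integral_const_mul, hp]
  ring

end Calculus

section Bochner

/-- The weight `e^{-Φ}` as a complex-valued function. -/
noncomputable def wt (Φ : Cn n → ℝ) (x : Cn n) : ℂ := cexp (-(Φ x : ℂ))

/-- Minus the formal adjoint of `∂/∂z̄_j` with respect to the weight `e^{-Φ}`. -/
noncomputable def dl (Φ : Cn n → ℝ) (j : Fin n) (u : Cn n → ℂ) (x : Cn n) : ℂ :=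
  wd (-I) j u x - wd (-I) j (fun y => (Φ y : ℂ)) x * u x

/-- The weighted complex Laplacian `∂̄^* ∂̄` on functions. -/
noncomputable def box (Φ : Cn n → ℝ) (u : Cn n → ℂ) (x : Cn n) : ℂ :=
  - ∑ j, dl Φ j (wd I j u) x

variable {Φ : Cn n → ℝ} {j k : Fin n} {u v : Cn n → ℂ} {x : Cn n}

theorem contDiff_ofReal (hΦ : ContDiff ℝ ∞ Φ) : ContDiff ℝ ∞ (fun y => (Φ y : ℂ)) :=
  ofRealCLM.contDiff.comp hΦ

theorem contDiff_conj (hu : ContDiff ℝ ∞ u) : ContDiff ℝ ∞ (fun y => conj (u y)) :=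
  conjCLE.contDiff.comp hu

theorem contDiff_wt (hΦ : ContDiff ℝ ∞ Φ) : ContDiff ℝ ∞ (wt Φ) :=
  (contDiff_ofReal hΦ).neg.cexp

theorem conj_wt : conj (wt Φ x) = wt Φ x := by
  simp [wt, ← exp_conj]

theorem wt_eq_ofReal : wt Φ x = (Real.exp (-Φ x) : ℂ) := by
  simp [wt]

theorem contDiff_dl (hΦ : ContDiff ℝ ∞ Φ) (hu : ContDiff ℝ ∞ u) : ContDiff ℝ ∞ (dl Φ j u) :=
  (contDiff_wd hu).sub ((contDiff_wd (contDiff_ofReal hΦ)).mul hu)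

theorem tsupport_dl_subset : tsupport (dl Φ j u) ⊆ tsupport u := by
  refine closure_minimal (fun x hx => ?_) (isClosed_tsupport u)
  by_contra hxu
  have h0 : u x = 0 := image_eq_zero_of_notMem_tsupport hxu
  have h1 : wd (-I) j u x = 0 :=
    image_eq_zero_of_notMem_tsupport fun h => hxu (tsupport_wd_subset h)
  exact hx (by simp [dl, h0, h1])

theorem hasCompactSupport_dl (hu : HasCompactSupport u) : HasCompactSupport (dl Φ j u) :=
  hu.of_isClosed_subset (isClosed_tsupport _) tsupport_dl_subset

theorem hasCompactSupport_conj (hu : HasCompactSupport u) :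
    HasCompactSupport (fun y => conj (u y)) :=
  hu.comp_left (g := fun z : ℂ => conj z) (by simp)

theorem contDiff_box (hΦ : ContDiff ℝ ∞ Φ) (hu : ContDiff ℝ ∞ u) : ContDiff ℝ ∞ (box Φ u) := by
  have : ∀ j, ContDiff ℝ ∞ (dl Φ j (wd I j u)) := fun j => contDiff_dl hΦ (contDiff_wd hu)
  exact (ContDiff.sum fun j _ => this j).neg

theorem hasCompactSupport_box (hu : HasCompactSupport u) : HasCompactSupport (box Φ u) := by
  refine hu.of_isClosed_subset (isClosed_tsupport _)
    (closure_minimal (fun x hx => ?_) (isClosed_tsupport u))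
  by_contra hxu
  refine hx ?_
  have : ∀ j, dl Φ j (wd I j u) x = 0 := fun j =>
    image_eq_zero_of_notMem_tsupport fun h => hxu (tsupport_wd_subset (tsupport_dl_subset h))
  simp [box, this]

/-- `-dl Φ j` is the weighted adjoint of `∂/∂z̄_j`. -/
theorem integral_dbar_mul_conj (hΦ : ContDiff ℝ ∞ Φ) (hu : ContDiff ℝ ∞ u) (hv : ContDiff ℝ ∞ v)
    (hc : HasCompactSupport u ∨ HasCompactSupport v) :
    ∫ x, wd I j u x * conj (v x) * wt Φ x = - ∫ x, u x * conj (dl Φ j v x) * wt Φ x := by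
  have hvc := contDiff_conj hv
  have hΦc := contDiff_ofReal hΦ
  have hw := contDiff_wt hΦ
  have key := integral_wd_mul (σ := I) (j := j) hu (hvc.mul hw)
    (hc.imp id fun h => (hasCompactSupport_conj h).mul_right)
  simp only [← mul_assoc] at key
  rw [key]
  congr 1
  refine integral_congr_ae (.of_forall fun x => ?_)
  have hd : ∀ {f : Cn n → ℂ}, ContDiff ℝ ∞ f → DifferentiableAt ℝ f x := fun hf =>
    hf.differentiable (by simp) x
  have e1 : wd I j (fun y => conj (v y) * wt Φ y) x =
      wd I j (fun y => conj (v y)) x * wt Φ x + conj (v x) * wd I j (wt Φ) x :=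
    wd_mul (hd hvc) (hd hw)
  have e2 : wd I j (wt Φ) x = - (wt Φ x * wd I j (fun y => (Φ y : ℂ)) x) := by
    have := wd_cexp (σ := I) (j := j) (hd hΦc.neg)
    rw [wd_neg] at this
    rw [mul_neg] at this
    exact this
  have e3 : conj (dl Φ j v x) = wd I j (fun y => conj (v y)) x
      - wd I j (fun y => (Φ y : ℂ)) x * conj (v x) := by
    simp only [dl, map_sub, map_mul]
    rw [conj_wd (hd hv), conj_wd (hd hΦc)]
    simp
  simp only [e1, e2, e3]
  ring

theorem integral_dl_mul_conj (hΦ : ContDiff ℝ ∞ Φ) (hu : ContDiff ℝ ∞ u) (hv : ContDiff ℝ ∞ v)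
    (hc : HasCompactSupport u ∨ HasCompactSupport v) :
    ∫ x, dl Φ j u x * conj (v x) * wt Φ x = - ∫ x, u x * conj (wd I j v x) * wt Φ x := by
  have h := congrArg conj (integral_dbar_mul_conj (j := j) hΦ hv hu hc.symm)
  rw [map_neg, ← integral_conj, ← integral_conj] at h
  simp only [map_mul, conj_conj, conj_wt] at h
  have e1 : ∀ x, dl Φ j u x * conj (v x) * wt Φ x = conj (v x) * dl Φ j u x * wt Φ x := by
    intro x; ring
  have e2 : ∀ x, u x * conj (wd I j v x) * wt Φ x = conj (wd I j v x) * u x * wt Φ x := by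
    intro x; ring
  simp_rw [e1, e2, h, neg_neg]

/-- Commutator of `∂/∂z̄_k` and the weighted adjoint of `∂/∂z̄_j`. -/
theorem dbar_dl (hΦ : ContDiff ℝ ∞ Φ) (hu : ContDiff ℝ ∞ u) :
    wd I k (dl Φ j u) x =
      dl Φ j (wd I k u) x - wd I k (wd (-I) j (fun y => (Φ y : ℂ))) x * u x := by
  have hΦc := contDiff_ofReal hΦ
  have hd : ∀ {f : Cn n → ℂ}, ContDiff ℝ ∞ f → DifferentiableAt ℝ f x := fun hf =>
    hf.differentiable (by simp) x
  have e1 : wd I k (dl Φ j u) x = wd I k (wd (-I) j u) x -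
      wd I k (fun y => wd (-I) j (fun y => (Φ y : ℂ)) y * u y) x :=
    wd_sub (hd (contDiff_wd hu)) (hd ((contDiff_wd hΦc).mul hu))
  rw [e1, wd_mul (hd (contDiff_wd hΦc)) (hd hu), wd_comm hu]
  simp only [dl]
  ring

/-- The Bochner–Kodaira identity for test forms. -/
theorem bochner_kodaira (hΦ : ContDiff ℝ ∞ Φ) {f : Fin n → Cn n → ℂ}
    (hf : ∀ j, ContDiff ℝ ∞ (f j)) (hc : ∀ j, HasCompactSupport (f j)) :
    ∫ x, (∑ j, dl Φ j (f j) x) * conj (∑ j, dl Φ j (f j) x) * wt Φ x =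
      ∑ j, ∑ k, ((∫ x, wd I k (f j) x * conj (wd I j (f k) x) * wt Φ x) +
        ∫ x, wd I k (wd (-I) j (fun y => (Φ y : ℂ))) x * f j x * conj (f k x) * wt Φ x) := by
  have hΦc := contDiff_ofReal hΦ
  have hw := contDiff_wt hΦ
  have h_int : ∀ {a b : Cn n → ℂ}, ContDiff ℝ ∞ a → ContDiff ℝ ∞ b → HasCompactSupport a →
      Integrable (fun x => a x * conj (b x) * wt Φ x) := fun ha hb hac =>
    Continuous.integrable_of_hasCompactSupport
      ((ha.continuous.mul (contDiff_conj hb).continuous).mul hw.continuous)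
      (hac.mul_right.mul_right)
  have e0 : ∀ x, (∑ j, dl Φ j (f j) x) * conj (∑ j, dl Φ j (f j) x) * wt Φ x =
      ∑ j, ∑ k, dl Φ j (f j) x * conj (dl Φ k (f k) x) * wt Φ x := by
    intro x
    rw [map_sum, Finset.sum_mul_sum, Finset.sum_mul]
    simp_rw [Finset.sum_mul]
  have hi : ∀ j k, Integrable (fun x => dl Φ j (f j) x * conj (dl Φ k (f k) x) * wt Φ x) :=
    fun j k => h_int (contDiff_dl hΦ (hf j)) (contDiff_dl hΦ (hf k)) (hasCompactSupport_dl (hc j))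
  simp_rw [e0]
  rw [integral_finsetSum _ fun j _ => integrable_finsetSum _ fun k _ => hi j k]
  refine Finset.sum_congr rfl fun j _ => ?_
  rw [integral_finsetSum _ fun k _ => hi j k]
  refine Finset.sum_congr rfl fun k _ => ?_
  have e1 := integral_dbar_mul_conj (j := k) hΦ (contDiff_dl (j := j) hΦ (hf j)) (hf k)
    (Or.inr (hc k))
  have e2 := integral_dl_mul_conj (j := j) hΦ (contDiff_wd (σ := I) (j := k) (hf j)) (hf k)
    (Or.inr (hc k))
  have e3 : ∀ x, wd I k (dl Φ j (f j)) x * conj (f k x) * wt Φ x =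
      dl Φ j (wd I k (f j)) x * conj (f k x) * wt Φ x -
      wd I k (wd (-I) j (fun y => (Φ y : ℂ))) x * f j x * conj (f k x) * wt Φ x := by
    intro x
    rw [dbar_dl hΦ (hf j)]
    ring
  simp_rw [e3] at e1
  rw [integral_sub (h_int (contDiff_dl hΦ (contDiff_wd (hf j))) (hf k)
      (hasCompactSupport_dl (hasCompactSupport_wd (hc j))))
      (h_int ((contDiff_wd (contDiff_wd hΦc)).mul (hf j)) (hf k) ((hc j).mul_left)), e2] at e1
  linear_combination e1

end Bochner

section Levi

variable {Φ : Cn n → ℝ} {x : Cn n}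

theorem leviForm_eq (Φ : Cn n → ℝ) (x w : Cn n) : leviForm Φ x w =
    fderiv ℝ (fderiv ℝ Φ) x w w + fderiv ℝ (fderiv ℝ Φ) x (I • w) (I • w) := by
  simp [leviForm, iteratedFDeriv_two_apply]

theorem sum_smul_e (w : Cn n) : ∑ j, w j • (e j : Cn n) = w := by
  ext i
  simp [e, Finset.sum_apply, Pi.single_apply]

/-- A real bilinear form satisfies the polarisation-type expansion of its `(1,1)`-part in the
standard complex basis. -/
theorem sum_sesq_eq (L : Cn n →L[ℝ] Cn n →L[ℝ] ℝ) (hL : ∀ a b, L a b = L b a) (w : Cn n) :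
    ∑ j, ∑ k, ((L (e k) (e j) - I * L (e k) (I • e j) + I * L (I • e k) (e j)
      + L (I • e k) (I • e j) : ℂ)) * w j * conj (w k) = (L w w + L (I • w) (I • w) : ℝ) := by
  set h : Cn n → Cn n → ℂ := fun v w => (L v w : ℂ) - I * L v (I • w) + I * L (I • v) w
      + L (I • v) (I • w) with hh
  have real : ∀ a : ℝ, ∀ v : Cn n, (a : ℂ) • v = a • v := fun a v => by
    ext i; simp
  have split : ∀ (c : ℂ) (v : Cn n), c • v = c.re • v + c.im • (I • v) := fun c v => by
    conv_lhs => rw [← re_add_im c, add_smul, mul_smul, real, real]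
  have hI2 : ∀ v : Cn n, I • I • v = -v := fun v => by rw [smul_smul, I_mul_I, neg_one_smul]
  have hIr : ∀ (a : ℝ) (v : Cn n), I • (a • v) = a • (I • v) := fun a v => smul_comm _ _ _
  have add_r : ∀ v a b, h v (a + b) = h v a + h v b := fun v a b => by
    simp [hh, smul_add]; ring
  have add_l : ∀ a b v, h (a + b) v = h a v + h b v := fun a b v => by
    simp [hh, smul_add]; ring
  have smul_r : ∀ (c : ℂ) v w, h v (c • w) = c * h v w := fun c v w => by
    apply Complex.ext <;> simp [hh, split c, hI2, hIr] <;> ring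
  have smul_l : ∀ (c : ℂ) v w, h (c • v) w = conj c * h v w := fun c v w => by
    apply Complex.ext <;> simp [hh, split c, hI2, hIr] <;> ring
  have sum_r : ∀ v (s : Finset (Fin n)) (g : Fin n → Cn n), h v (∑ j ∈ s, g j) = ∑ j ∈ s, h v (g j) :=
    fun v s g => by
      classical
      induction s using Finset.induction_on with
      | empty => simp [hh]
      | insert a s ha ih => rw [Finset.sum_insert ha, Finset.sum_insert ha, add_r, ih]
  have sum_l : ∀ v (s : Finset (Fin n)) (g : Fin n → Cn n), h (∑ j ∈ s, g j) v = ∑ j ∈ s, h (g j) v :=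
    fun v s g => by
      classical
      induction s using Finset.induction_on with
      | empty => simp [hh]
      | insert a s ha ih => rw [Finset.sum_insert ha, Finset.sum_insert ha, add_l, ih]
  have e1 : h w w = ∑ j, ∑ k, h (e k) (e j) * w j * conj (w k) := by
    conv_lhs => rw [← sum_smul_e w]
    rw [sum_r]
    refine Finset.sum_congr rfl fun j _ => ?_
    rw [sum_l]
    refine Finset.sum_congr rfl fun k _ => ?_
    rw [smul_r, smul_l]
    ring
  rw [← e1]
  simp only [hh]
  rw [hL (I • w) w]
  push_cast
  ring

theorem fderiv_fderiv_ofReal (hΦ : ContDiff ℝ ∞ Φ) (a b : Cn n) :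
    fderiv ℝ (fderiv ℝ (fun y => (Φ y : ℂ))) x a b = (fderiv ℝ (fderiv ℝ Φ) x a b : ℂ) := by
  have hd : Differentiable ℝ Φ := hΦ.differentiable (by simp)
  have h2 : Differentiable ℝ (fderiv ℝ Φ) := (hΦ.fderiv_right (m := ∞) (by simp)).differentiable (by simp)
  have e1 : fderiv ℝ (fun y => (Φ y : ℂ)) = fun y => ofRealCLM ∘L fderiv ℝ Φ y := by
    funext y
    exact (ofRealCLM.hasFDerivAt.comp y (hd y).hasFDerivAt).fderiv
  have e2 : HasFDerivAt (fun y => ofRealCLM ∘L fderiv ℝ Φ y)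
      ((ContinuousLinearMap.compL ℝ (Cn n) ℝ ℂ ofRealCLM) ∘L fderiv ℝ (fderiv ℝ Φ) x) x :=
    ((ContinuousLinearMap.compL ℝ (Cn n) ℝ ℂ ofRealCLM).hasFDerivAt
      (x := fderiv ℝ Φ x)).comp x (h2 x).hasFDerivAt
  rw [e1, e2.fderiv]
  simp

theorem sum_dbar_d_eq_leviForm (hΦ : ContDiff ℝ ∞ Φ) (w : Cn n) :
    ∑ j, ∑ k, wd I k (wd (-I) j (fun y => (Φ y : ℂ))) x * w j * conj (w k) =
      ((leviForm Φ x w / 4 : ℝ) : ℂ) := by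
  have hs : ∀ a b, fderiv ℝ (fderiv ℝ Φ) x a b = fderiv ℝ (fderiv ℝ Φ) x b a := fun a b =>
    (hΦ.contDiffAt (x := x)).isSymmSndFDerivAt
      (by simpa using WithTop.coe_le_coe.2 (le_top : (2 : ℕ∞) ≤ ⊤)) a b
  rw [leviForm_eq, ofReal_div, ← sum_sesq_eq _ hs, Finset.sum_div]
  refine Finset.sum_congr rfl fun j _ => ?_
  rw [Finset.sum_div]
  refine Finset.sum_congr rfl fun k _ => ?_
  rw [wd_wd_eq (contDiff_ofReal hΦ)]
  simp only [fderiv_fderiv_ofReal hΦ]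
  push_cast
  linear_combination (-1 / 4 : ℂ) * (fderiv ℝ (fderiv ℝ Φ) x (I • e k) (I • e j) : ℂ) * w j
    * conj (w k) * I_sq

end Levi

section Estimate

variable {Φ : Cn n → ℝ} {u v η : Cn n → ℂ} {c : ℝ}

theorem integral_mul_conj_wt (u : Cn n → ℂ) :
    ∫ x, u x * conj (u x) * wt Φ x = ((∫ x, ‖u x‖ ^ 2 * Real.exp (-Φ x) : ℝ) : ℂ) := by
  rw [← integral_complex_ofReal]
  refine integral_congr_ae (.of_forall fun x => ?_)
  simp only
  rw [mul_conj, wt_eq_ofReal, normSq_eq_norm_sq]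
  push_cast
  rfl

/-- `∂̄^*∂̄` is the operator of the weighted Dirichlet form. -/
theorem integral_mul_conj_box (hΦ : ContDiff ℝ ∞ Φ) (hu : ContDiff ℝ ∞ u) (hη : ContDiff ℝ ∞ η)
    (hc : HasCompactSupport u ∨ HasCompactSupport η) :
    ∫ x, u x * conj (box Φ η x) * wt Φ x =
      ∑ j, ∫ x, wd I j u x * conj (wd I j η x) * wt Φ x := by
  have h_int : ∀ j, Integrable (fun x => u x * conj (dl Φ j (wd I j η) x) * wt Φ x) := fun j =>
    Continuous.integrable_of_hasCompactSupport
      ((hu.continuous.mul (contDiff_conj (contDiff_dl hΦ (contDiff_wd hη))).continuous).mul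
        (contDiff_wt hΦ).continuous)
      (hc.elim (fun h => h.mul_right.mul_right)
        fun h => (HasCompactSupport.mul_left
          (hasCompactSupport_conj (hasCompactSupport_dl (hasCompactSupport_wd h)))).mul_right)
  have e0 : ∀ x, u x * conj (box Φ η x) * wt Φ x =
      - ∑ j, u x * conj (dl Φ j (wd I j η) x) * wt Φ x := by
    intro x
    simp only [box, map_neg, map_sum, Finset.mul_sum, Finset.sum_mul, mul_neg, neg_mul]
  simp_rw [e0]
  rw [integral_neg, integral_finsetSum _ fun j _ => h_int j, ← Finset.sum_neg_distrib]
  refine Finset.sum_congr rfl fun j _ => ?_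
  rw [integral_dbar_mul_conj hΦ hu (contDiff_wd hη) (hc.imp id hasCompactSupport_wd)]

/-- The basic `L²` estimate for test functions. -/
theorem dbar_le_box (hΦ : ContDiff ℝ ∞ Φ) (hη : ContDiff ℝ ∞ η) (hηc : HasCompactSupport η)
    (hlev : ∀ x w, 4 * c * ‖w‖ ^ 2 ≤ leviForm Φ x w) :
    c * ∫ x, (∑ j, ‖wd I j η x‖ ^ 2) * Real.exp (-Φ x) ≤
      ∫ x, ‖box Φ η x‖ ^ 2 * Real.exp (-Φ x) := by
  have hf : ∀ j, ContDiff ℝ ∞ (wd I j η) := fun j => contDiff_wd hη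
  have hfc : ∀ j : Fin n, HasCompactSupport (wd I j η) := fun j => hasCompactSupport_wd hηc
  have hΦc := contDiff_ofReal hΦ
  have hw := contDiff_wt hΦ
  have key := bochner_kodaira hΦ hf hfc
  have e0 : ∀ x, (∑ j, dl Φ j (wd I j η) x) * conj (∑ j, dl Φ j (wd I j η) x) * wt Φ x =
      box Φ η x * conj (box Φ η x) * wt Φ x := fun x => by simp [box]
  simp_rw [e0] at key
  rw [integral_mul_conj_wt] at key
  simp_rw [Finset.sum_add_distrib] at key
  have e1 : ∀ j k, ∫ x, wd I k (wd I j η) x * conj (wd I j (wd I k η) x) * wt Φ x =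
      ((∫ x, ‖wd I k (wd I j η) x‖ ^ 2 * Real.exp (-Φ x) : ℝ) : ℂ) := fun j k => by
    rw [← integral_mul_conj_wt]
    simp_rw [wd_comm (σ := I) (τ := I) (j := j) (k := k) hη]
  have h_int : ∀ j k, Integrable (fun x => wd I k (wd (-I) j (fun y => (Φ y : ℂ))) x *
      wd I j η x * conj (wd I k η x) * wt Φ x) := fun j k =>
    Continuous.integrable_of_hasCompactSupport
      ((((contDiff_wd (contDiff_wd hΦc)).continuous.mul (hf j).continuous).mul
        (contDiff_conj (hf k)).continuous).mul hw.continuous)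
      ((hfc j).mul_left.mul_right.mul_right)
  have e2 : ∑ j, ∑ k, ∫ x, wd I k (wd (-I) j (fun y => (Φ y : ℂ))) x *
      wd I j η x * conj (wd I k η x) * wt Φ x =
      ((∫ x, leviForm Φ x (WithLp.toLp 2 fun j => wd I j η x) / 4 * Real.exp (-Φ x) : ℝ) : ℂ) := by
    simp_rw [← integral_finsetSum _ fun k _ => h_int _ k]
    rw [← integral_finsetSum _ fun j _ => integrable_finsetSum _ fun k _ => h_int j k,
      ← integral_complex_ofReal]
    refine integral_congr_ae (.of_forall fun x => ?_)
    simp only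
    rw [ofReal_mul, ← sum_dbar_d_eq_leviForm hΦ, Finset.sum_mul, ← wt_eq_ofReal]
    simp_rw [Finset.sum_mul]
  simp_rw [e1] at key
  rw [e2] at key
  norm_cast at key
  rw [key]
  have h0 : (0 : ℝ) ≤ ∑ j, ∑ k, ∫ x, ‖wd I k (wd I j η) x‖ ^ 2 * Real.exp (-Φ x) :=
    Finset.sum_nonneg fun j _ => Finset.sum_nonneg fun k _ => integral_nonneg fun x => by positivity
  refine le_trans ?_ (le_add_of_nonneg_left h0)
  rw [← integral_const_mul]
  have hE : Continuous fun x => Real.exp (-Φ x) := Real.continuous_exp.comp hΦ.continuous.neg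
  have h_int2 := fun j => integrable_finsetSum Finset.univ fun k _ => h_int j k
  have hint3 := (integrable_finsetSum Finset.univ fun j _ => h_int2 j).re
  refine integral_mono (Continuous.integrable_of_hasCompactSupport ?_ ?_) (hint3.congr ?_) ?_
  · have : ∀ j, Continuous (wd I j η) := fun j => (hf j).continuous
    fun_prop
  · have : ∀ x, x ∉ tsupport η → c * ((∑ j, ‖wd I j η x‖ ^ 2) * Real.exp (-Φ x)) = 0 := by
      intro x hx
      have : ∀ j, wd I j η x = 0 := fun j =>
        image_eq_zero_of_notMem_tsupport fun h => hx (tsupport_wd_subset h)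
      simp [this]
    exact HasCompactSupport.intro hηc this
  · refine .of_forall fun x => ?_
    have : ∑ j, ∑ k, wd I k (wd (-I) j (fun y => (Φ y : ℂ))) x *
      wd I j η x * conj (wd I k η x) * wt Φ x =
       ((leviForm Φ x (WithLp.toLp 2 fun j => wd I j η x) / 4 * Real.exp (-Φ x) : ℝ) : ℂ) := by
      rw [ofReal_mul, ← sum_dbar_d_eq_leviForm hΦ, Finset.sum_mul, ← wt_eq_ofReal]
      simp_rw [Finset.sum_mul]
    simp only
    rw [this]
    exact ofReal_re _
  · intro x
    have := hlev x (WithLp.toLp 2 fun j => wd I j η x)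
    rw [EuclideanSpace.norm_sq_eq] at this
    simp only at this ⊢
    rw [← mul_assoc]
    gcongr
    linarith

end Estimate

section Mollifier

theorem wd_comp_smul {σ : ℂ} {j : Fin n} {u : Cn n → ℂ} (hu : Differentiable ℝ u) (r : ℝ)
    (x : Cn n) : wd σ j (fun y => u (r • y)) x = r * wd σ j u (r • x) := by
  have h : HasFDerivAt (fun y => u (r • y))
      ((fderiv ℝ u (r • x)) ∘L (r • ContinuousLinearMap.id ℝ (Cn n))) x :=
    (hu (r • x)).hasFDerivAt.comp x ((hasFDerivAt_id x).const_smul r)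
  simp only [wd, h.fderiv]
  simp
  ring

/-- Smooth compactly supported approximate identities, invariant under multiplication by unimodular
scalars. -/
theorem exists_mollifier (n : ℕ) : ∃ (g : ℝ → Cn n → ℂ) (C : ℝ), 0 ≤ C ∧ ∀ ε, 0 < ε →
    ContDiff ℝ ∞ (g ε) ∧ (∀ x, ε ≤ ‖x‖ → g ε x = 0) ∧ ∫ x, g ε x = 1 ∧
    (∀ c : ℂ, ‖c‖ = 1 → ∀ x, g ε (c • x) = g ε x) ∧
    (∀ x, ‖g ε x‖ ≤ C / volume.real (Metric.closedBall (0 : Cn n) ε)) ∧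
    ∀ j x, ‖wd I j (g ε) x‖ ≤ C / (ε * volume.real (Metric.closedBall (0 : Cn n) ε)) := by
  set r : Cn n → ℝ := fun x => Real.smoothTransition (1 - ‖x‖ ^ 2) with hr
  have hrs : ContDiff ℝ ∞ r :=
    Real.smoothTransition.contDiff.comp (contDiff_const.sub (contDiff_norm_sq ℂ))
  set ρ : Cn n → ℂ := fun x => (r x : ℂ) with hρ
  have hρs : ContDiff ℝ ∞ ρ := contDiff_ofReal hrs
  have hr0 : ∀ x, 1 ≤ ‖x‖ → r x = 0 := fun x hx =>
    Real.smoothTransition.zero_of_nonpos (by nlinarith)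
  have hrc : HasCompactSupport r := by
    refine HasCompactSupport.intro (isCompact_closedBall (0 : Cn n) 1) fun x hx => hr0 x ?_
    rw [Metric.mem_closedBall, dist_zero_right, not_le] at hx
    exact hx.le
  have hρc : HasCompactSupport ρ := hrc.comp_left (g := fun t : ℝ => (t : ℂ)) (by simp)
  have hI : 0 < ∫ x, r x := by
    refine (integral_pos_iff_support_of_nonneg (fun x => Real.smoothTransition.nonneg _)
      (hrs.continuous.integrable_of_hasCompactSupport hrc)).2 ?_
    refine (hrs.continuous.isOpen_support).measure_pos _ ⟨0, ?_⟩
    have : r 0 = 1 := by simp [hr]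
    simp [this]
  set J := ∫ x, r x
  set d := Module.finrank ℝ (Cn n)
  obtain ⟨C1, hC1⟩ := hρc.exists_bound_of_continuous hρs.continuous
  have hC2' : ∀ j : Fin n, ∃ C, ∀ x, ‖wd I j ρ x‖ ≤ C := fun j =>
    (hasCompactSupport_wd hρc).exists_bound_of_continuous (contDiff_wd hρs).continuous
  choose C2 hC2 using hC2'
  set V1 := volume.real (Metric.closedBall (0 : Cn n) 1)
  have hV1 : 0 ≤ V1 := measureReal_nonneg
  have hV : ∀ ε : ℝ, 0 < ε → volume.real (Metric.closedBall (0 : Cn n) ε) = ε ^ d * V1 :=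
    fun ε hε => Measure.addHaar_real_closedBall' volume 0 hε.le
  have hV1' : 0 < V1 :=
    ENNReal.toReal_pos (Metric.measure_closedBall_pos _ _ one_pos).ne'
      (isCompact_closedBall _ _).measure_lt_top.ne
  have hC1' : 0 ≤ C1 := (norm_nonneg _).trans (hC1 0)
  have hC2' : ∀ j, 0 ≤ C2 j := fun j => (norm_nonneg _).trans (hC2 j 0)
  have hS : 0 ≤ ∑ j, C2 j := Finset.sum_nonneg fun j _ => hC2' j
  refine ⟨fun ε x => ((ε ^ d * J : ℝ)⁻¹ : ℂ) * ρ (ε⁻¹ • x), V1 / J * (C1 + ∑ j, C2 j),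
    mul_nonneg (div_nonneg hV1 hI.le) (add_nonneg hC1' hS), fun ε hε => ?_⟩
  have hεd : 0 < ε ^ d := pow_pos hε d
  have hn : ‖((ε ^ d * J : ℝ)⁻¹ : ℂ)‖ = (ε ^ d * J)⁻¹ := by
    rw [norm_inv, norm_real, Real.norm_of_nonneg (by positivity)]
  have hsm : ContDiff ℝ ∞ fun x : Cn n => ρ (ε⁻¹ • x) :=
    hρs.comp (contDiff_const_smul (𝕜 := ℝ) (n := ∞) (ε⁻¹ : ℝ))
  refine ⟨contDiff_const.mul hsm, fun x hx => ?_, ?_, fun c hc x => ?_, fun x => ?_, fun j x => ?_⟩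
  · have : r (ε⁻¹ • x) = 0 := hr0 _ (by
      rw [norm_smul, norm_inv, Real.norm_of_nonneg hε.le]
      field_simp
      exact hx)
    simp [hρ, this]
  · rw [integral_const_mul, Measure.integral_comp_inv_smul_of_nonneg volume ρ hε.le]
    have : ∫ x, ρ x = (J : ℂ) := integral_complex_ofReal
    rw [this]
    have h1 : (J : ℂ) ≠ 0 := by exact_mod_cast hI.ne'
    have h2 : (ε : ℂ) ^ d ≠ 0 := by exact_mod_cast hεd.ne'
    simp only [real_smul]
    push_cast
    field_simp
    rfl
  · have : r (ε⁻¹ • c • x) = r (ε⁻¹ • x) := by simp [hr, norm_smul, hc]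
    simp [hρ, this]
  · rw [norm_mul, hn, hV ε hε]
    calc (ε ^ d * J)⁻¹ * ‖ρ (ε⁻¹ • x)‖ ≤ (ε ^ d * J)⁻¹ * (C1 + ∑ j, C2 j) := by
          gcongr
          exact (hC1 _).trans (by linarith)
      _ = _ := by field_simp
  · have hsd : DifferentiableAt ℝ (fun x : Cn n => ρ (ε⁻¹ • x)) x :=
      hsm.differentiable (by simp) x
    rw [wd_mul (differentiableAt_const _) hsd, wd_const, zero_mul, zero_add,
      wd_comp_smul (hρs.differentiable (by simp)), norm_mul, norm_mul, hn, hV ε hε, norm_real,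
      norm_inv, Real.norm_of_nonneg hε.le]
    calc (ε ^ d * J)⁻¹ * (ε⁻¹ * ‖wd I j ρ (ε⁻¹ • x)‖)
        ≤ (ε ^ d * J)⁻¹ * (ε⁻¹ * (C1 + ∑ j, C2 j)) := by
          gcongr
          refine (hC2 j _).trans ?_
          have := Finset.single_le_sum (fun j _ => hC2' j) (Finset.mem_univ j)
          linarith
      _ = _ := by field_simp

end Mollifier

section Convolution

/-- Convolution of scalar functions on `ℂⁿ`. -/
noncomputable def cv (w g : Cn n → ℂ) (x : Cn n) : ℂ := ∫ y, w y * g (x - y)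

variable {w g : Cn n → ℂ}

theorem cv_eq_convolution : cv w g = (w ⋆[ContinuousLinearMap.mul ℝ ℂ, volume] g) := rfl

theorem contDiff_cv (hw : LocallyIntegrable w) (hg : ContDiff ℝ ∞ g) (hgc : HasCompactSupport g) :
    ContDiff ℝ ∞ (cv w g) :=
  hgc.contDiff_convolution_right (ContinuousLinearMap.mul ℝ ℂ) hw hg

theorem integrable_mul_of_hasCompactSupport (hw : LocallyIntegrable w) (hg : Continuous g)
    (hgc : HasCompactSupport g) : Integrable fun y => w y * g y := by
  have := hw.integrable_smul_right_of_hasCompactSupport hg hgc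
  simpa using this

theorem hasCompactSupport_comp_sub (hgc : HasCompactSupport g) (x : Cn n) :
    HasCompactSupport fun y => g (x - y) :=
  hgc.comp_homeomorph (Homeomorph.subLeft x)

theorem integrable_cv (hw : LocallyIntegrable w) (hg : Continuous g)
    (hgc : HasCompactSupport g) (x : Cn n) : Integrable fun y => w y * g (x - y) :=
  integrable_mul_of_hasCompactSupport hw (by fun_prop) (hasCompactSupport_comp_sub hgc x)

theorem wd_cv {σ : ℂ} {j : Fin n} (hw : LocallyIntegrable w) (hg : ContDiff ℝ ∞ g)
    (hgc : HasCompactSupport g) (x : Cn n) : wd σ j (cv w g) x = cv w (wd σ j g) x := by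
  have h := hgc.hasFDerivAt_convolution_right (ContinuousLinearMap.mul ℝ ℂ) hw
    (hg.of_le (by simp)) x
  have hgd : Continuous (fderiv ℝ g) := (hg.fderiv_right (m := ∞) (by simp)).continuous
  rw [wd, cv_eq_convolution, h.fderiv]
  have key : ∀ v, (w ⋆[(ContinuousLinearMap.mul ℝ ℂ).precompR (Cn n), volume] fderiv ℝ g) x v =
      ∫ y, w y * fderiv ℝ g (x - y) v := fun v =>
    convolution_precompR_apply _ hw (hgc.fderiv ℝ) hgd x v
  rw [key, key, ← integral_const_mul, ← integral_add, ← integral_const_mul]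
  · refine integral_congr_ae (.of_forall fun y => ?_)
    simp only [wd]
    ring
  · exact integrable_cv (g := fun y => fderiv ℝ g y (e j)) hw (by fun_prop)
      (hgc.fderiv_apply ℝ (e j)) x
  · exact (integrable_cv (g := fun y => fderiv ℝ g y (I • e j)) hw (by fun_prop)
      (hgc.fderiv_apply ℝ (I • e j)) x).const_mul σ

end Convolution

section Translation

theorem exists_translation_le {f : Cn n → ℂ} (hf : MemLp f 2 volume) {t : ℝ≥0∞} (ht : t ≠ 0) :
    ∃ δ > 0, ∀ v : Cn n, ‖v‖ ≤ δ → ∫⁻ x, ‖f (x - v) - f x‖ₑ ^ 2 ≤ t := by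
  have : Fact ((1 : ℝ≥0∞) ≤ 2) := ⟨by norm_num⟩
  set F : Lp ℂ 2 (volume : Measure (Cn n)) := hf.toLp f
  have hm : ∀ v : Cn n, MeasurePreserving (fun x : Cn n => x - v) volume volume := fun v =>
    measurePreserving_sub_right volume v
  let S : C(Cn n, C(Cn n, Cn n)) :=
    (ContinuousMap.mk (fun a : Cn n × Cn n => a.2 - a.1) (by fun_prop)).curry
  have hc : Continuous fun v : Cn n => Lp.compMeasurePreserving (S v) (hm v) F :=
    continuous_const.compMeasurePreservingLp S.continuous hm (by norm_num)
  have hcn : Continuous fun v : Cn n => ‖Lp.compMeasurePreserving (S v) (hm v) F - F‖ₑ ^ 2 :=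
    (ENNReal.continuous_pow 2).comp (hc.sub continuous_const).enorm
  have key : ∀ v, ‖Lp.compMeasurePreserving (S v) (hm v) F - F‖ₑ ^ 2 =
      ∫⁻ x, ‖f (x - v) - f x‖ₑ ^ 2 := fun v => by
    rw [Lp.enorm_def, eLpNorm_eq_lintegral_rpow_enorm_toReal (by norm_num) (by norm_num)]
    have : ∀ a : ℝ≥0∞, (a ^ (1 / (2 : ℝ≥0∞).toReal)) ^ 2 = a := fun a => by
      rw [← ENNReal.rpow_natCast, ← ENNReal.rpow_mul]
      norm_num
    rw [this]
    refine lintegral_congr_ae ?_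
    have e1 := Lp.coeFn_sub (Lp.compMeasurePreserving (S v) (hm v) F) F
    have e2 := Lp.coeFn_compMeasurePreserving F (hm v)
    have e3 : F =ᵐ[volume] f := hf.coeFn_toLp
    have e4 : ∀ᵐ x : Cn n, F (x - v) = f (x - v) := (hm v).quasiMeasurePreserving.ae e3
    filter_upwards [e1, e2, e3, e4] with x h1 h2 h3 h4
    have h2' : (Lp.compMeasurePreserving (S v) (hm v) F) x = F (x - v) := h2
    rw [h1, Pi.sub_apply, h2', h4, h3]
    norm_num
  have h0 : ‖Lp.compMeasurePreserving (S 0) (hm 0) F - F‖ₑ ^ 2 < t := by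
    rw [key]
    simpa using pos_iff_ne_zero.2 ht
  obtain ⟨δ, hδ, hball⟩ := Metric.eventually_nhds_iff_ball.1
    ((hcn.tendsto 0).eventually (gt_mem_nhds h0))
  refine ⟨δ / 2, by positivity, fun v hv => ?_⟩
  rw [← key]
  exact (hball v (by rw [Metric.mem_ball, dist_zero_right]; linarith)).le

theorem sq_lintegral_le {α : Type*} [MeasurableSpace α] {μ : Measure α} {h : α → ℝ≥0∞}
    (hm : AEMeasurable h μ) : (∫⁻ x, h x ∂μ) ^ 2 ≤ (∫⁻ x, h x ^ 2 ∂μ) * μ Set.univ := by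
  have := ENNReal.lintegral_mul_le_Lp_mul_Lq (p := 2) (q := 2) μ Real.HolderConjugate.two_two
    hm (aemeasurable_const (b := (1 : ℝ≥0∞)))
  simp only [Pi.mul_apply, mul_one, ENNReal.one_rpow, lintegral_const, one_mul] at this
  refine (pow_le_pow_left' this 2).trans (le_of_eq ?_)
  rw [mul_pow, ← ENNReal.rpow_natCast, ← ENNReal.rpow_natCast, ← ENNReal.rpow_mul,
    ← ENNReal.rpow_mul]
  norm_num

/-- Local uniform estimate for averages of increments of a locally square-integrable function. -/
theorem exists_average_le {w : Cn n → ℂ} (hwm : StronglyMeasurable w)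
    (hw : ∀ R, IntegrableOn (fun x => ‖w x‖ ^ 2) (Metric.closedBall 0 R)) (R : ℝ) {t : ℝ≥0∞}
    (ht : t ≠ 0) : ∃ δ > 0, ∀ ε, 0 < ε → ε ≤ δ → ∀ (C : ℝ) (T : Cn n → ℂ), 0 ≤ C →
      (∀ x ∈ Metric.closedBall (0 : Cn n) R, ‖T x‖ₑ ≤
        ENNReal.ofReal C / volume (Metric.closedBall (0 : Cn n) ε) *
        ∫⁻ v in Metric.closedBall (0 : Cn n) ε, ‖w (x - v) - w x‖ₑ) →
      ∫⁻ x in Metric.closedBall (0 : Cn n) R, ‖T x‖ₑ ^ 2 ≤ ENNReal.ofReal C ^ 2 * t := by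
  set f : Cn n → ℂ := (Metric.closedBall (0 : Cn n) (R + 1)).indicator w
  have hf : MemLp f 2 volume := by
    rw [memLp_indicator_iff_restrict measurableSet_closedBall,
      memLp_two_iff_integrable_sq_norm hwm.aestronglyMeasurable]
    exact hw (R + 1)
  obtain ⟨δ, hδ, h⟩ := exists_translation_le hf ht
  refine ⟨min δ 1, by positivity, fun ε hε hεδ C T hC hT => ?_⟩
  set B := Metric.closedBall (0 : Cn n) ε
  have hB0 : volume B ≠ 0 := (Metric.measure_closedBall_pos _ _ hε).ne'
  have hBt : volume B ≠ ⊤ := (isCompact_closedBall _ _).measure_lt_top.ne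
  have hmeas : Measurable fun p : Cn n × Cn n => ‖w (p.1 - p.2) - w p.1‖ₑ :=
    ((hwm.measurable.comp (measurable_fst.sub measurable_snd)).sub
      (hwm.measurable.comp measurable_fst)).enorm
  have hCS : ∀ x ∈ Metric.closedBall (0 : Cn n) R, ‖T x‖ₑ ^ 2 ≤ ENNReal.ofReal C ^ 2 / volume B *
      ∫⁻ v in B, ‖w (x - v) - w x‖ₑ ^ 2 := fun x hx => by
    have hm1 : Measurable fun v => ‖w (x - v) - w x‖ₑ :=
      ((hwm.measurable.comp (measurable_const.sub measurable_id)).sub measurable_const).enorm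
    have h2 : (∫⁻ v in B, ‖w (x - v) - w x‖ₑ) ^ 2 ≤
        (∫⁻ v in B, ‖w (x - v) - w x‖ₑ ^ 2) * volume B := by
      have := sq_lintegral_le (μ := volume.restrict B) hm1.aemeasurable
      rwa [Measure.restrict_apply MeasurableSet.univ, Set.univ_inter] at this
    calc ‖T x‖ₑ ^ 2 ≤ (ENNReal.ofReal C / volume B * ∫⁻ v in B, ‖w (x - v) - w x‖ₑ) ^ 2 :=
          pow_le_pow_left' (hT x hx) 2
      _ ≤ (ENNReal.ofReal C / volume B) ^ 2 *
          ((∫⁻ v in B, ‖w (x - v) - w x‖ₑ ^ 2) * volume B) := by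
          rw [mul_pow]; gcongr
      _ = ENNReal.ofReal C ^ 2 / volume B * (∫⁻ v in B, ‖w (x - v) - w x‖ₑ ^ 2) *
          ((volume B)⁻¹ * volume B) := by
          simp only [div_eq_mul_inv]; ring
      _ = _ := by rw [ENNReal.inv_mul_cancel hB0 hBt, mul_one]
  calc ∫⁻ x in Metric.closedBall (0 : Cn n) R, ‖T x‖ₑ ^ 2
      ≤ ∫⁻ x in Metric.closedBall (0 : Cn n) R, ENNReal.ofReal C ^ 2 / volume B *
        ∫⁻ v in B, ‖w (x - v) - w x‖ₑ ^ 2 :=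
        setLIntegral_mono' measurableSet_closedBall hCS
    _ = ENNReal.ofReal C ^ 2 / volume B * ∫⁻ x in Metric.closedBall (0 : Cn n) R,
        ∫⁻ v in B, ‖w (x - v) - w x‖ₑ ^ 2 :=
        lintegral_const_mul' _ _ (ENNReal.div_ne_top (by simp) hB0)
    _ = ENNReal.ofReal C ^ 2 / volume B * ∫⁻ v in B, ∫⁻ x in Metric.closedBall (0 : Cn n) R,
        ‖w (x - v) - w x‖ₑ ^ 2 := by
        rw [lintegral_lintegral_swap]
        exact (hmeas.pow_const 2).aemeasurable
    _ ≤ ENNReal.ofReal C ^ 2 / volume B * ∫⁻ v in B, t := by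
        refine mul_le_mul' le_rfl ?_
        refine setLIntegral_mono'
          (measurableSet_closedBall (x := (0 : Cn n)) (ε := ε)) fun v hv => ?_
        have hv' : ‖v‖ ≤ ε := by simpa [B] using hv
        refine le_trans ?_ (h v (hv'.trans (hεδ.trans (min_le_left _ _))))
        refine le_trans ?_ (setLIntegral_le_lintegral (Metric.closedBall (0 : Cn n) R) _)
        refine (setLIntegral_mono'
          (measurableSet_closedBall (x := (0 : Cn n)) (ε := R)) fun x hx => le_of_eq ?_)
        have hx' : ‖x‖ ≤ R := by simpa using hx
        have h1 : ε ≤ 1 := hεδ.trans (min_le_right _ _)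
        have m1 : x ∈ Metric.closedBall (0 : Cn n) (R + 1) := by
          rw [mem_closedBall_zero_iff]; linarith
        have m2 : x - v ∈ Metric.closedBall (0 : Cn n) (R + 1) := by
          rw [mem_closedBall_zero_iff]
          linarith [norm_sub_le x v]
        simp only [f, Set.indicator_of_mem m1, Set.indicator_of_mem m2]
    _ = ENNReal.ofReal C ^ 2 * t * ((volume B)⁻¹ * volume B) := by
        rw [lintegral_const, Measure.restrict_apply MeasurableSet.univ, Set.univ_inter]
        simp only [div_eq_mul_inv]; ring
    _ = _ := by rw [ENNReal.inv_mul_cancel hB0 hBt, mul_one]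

end Translation

section Friedrichs

variable {Φ : Cn n → ℝ} {w : Cn n → ℂ}

/-- Weak solutions of the equation `□_Φ w = 0`. -/
def IsWeakNull (Φ : Cn n → ℝ) (w : Cn n → ℂ) : Prop :=
  ∀ η : Cn n → ℂ, ContDiff ℝ ∞ η → HasCompactSupport η →
    ∫ x, w x * conj (box Φ η x) * wt Φ x = 0

theorem locallyIntegrable_of_sq (hwm : StronglyMeasurable w)
    (hw : ∀ R, IntegrableOn (fun x => ‖w x‖ ^ 2) (Metric.closedBall 0 R)) :
    LocallyIntegrable w := by
  rw [locallyIntegrable_iff]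
  intro k hk
  obtain ⟨R, hR⟩ := hk.isBounded.subset_closedBall (0 : Cn n)
  refine IntegrableOn.mono_set ?_ hR
  have h2 : MemLp w 2 (volume.restrict (Metric.closedBall 0 R)) :=
    (memLp_two_iff_integrable_sq_norm hwm.aestronglyMeasurable).2 (hw R)
  have : IsFiniteMeasure (volume.restrict (Metric.closedBall (0 : Cn n) R)) :=
    isFiniteMeasure_restrict.2 (isCompact_closedBall _ _).measure_lt_top.ne
  exact h2.integrable (by norm_num)

theorem IsWeakNull.integral_eq_zero (hΦ : ContDiff ℝ ∞ Φ) (h : IsWeakNull Φ w) {ζ : Cn n → ℂ}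
    (hζ : ContDiff ℝ ∞ ζ) (hζc : HasCompactSupport ζ) :
    ∫ x, w x * ∑ j, wd I j (fun y => wd (-I) j ζ y +
      wd (-I) j (fun y => (Φ y : ℂ)) y * ζ y) x = 0 := by
  have hΦc := contDiff_ofReal hΦ
  have hd : ∀ {f : Cn n → ℂ}, ContDiff ℝ ∞ f → Differentiable ℝ f := fun hf =>
    hf.differentiable (by simp)
  set E : Cn n → ℂ := fun y => cexp (Φ y : ℂ) with hE
  have hEs : ContDiff ℝ ∞ E := hΦc.cexp
  set η : Cn n → ℂ := fun y => conj (ζ y * E y) with hη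
  have hηs : ContDiff ℝ ∞ η := contDiff_conj (hζ.mul hEs)
  have hηc : HasCompactSupport η := hasCompactSupport_conj hζc.mul_right
  have hcE : ∀ y, conj (E y) = E y := fun y => by simp [hE, ← exp_conj]
  have hEd : ∀ σ j y, wd σ j E y = E y * wd σ j (fun y => (Φ y : ℂ)) y := fun σ j y =>
    wd_cexp (hd hΦc y)
  have h1 : ∀ j y, conj (wd I j η y) =
      E y * (wd (-I) j ζ y + wd (-I) j (fun y => (Φ y : ℂ)) y * ζ y) := fun j y => by
    rw [conj_wd (hd hηs y), conj_I]
    simp only [hη, conj_conj]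
    rw [wd_mul (hd hζ y) (hd hEs y), hEd]
    ring
  have h2 : ∀ y, conj (box Φ η y) * wt Φ y = -∑ j, wd I j (fun y => wd (-I) j ζ y +
      wd (-I) j (fun y => (Φ y : ℂ)) y * ζ y) y := fun y => by
    simp only [box, map_neg, map_sum, neg_mul, Finset.sum_mul]
    congr 1
    refine Finset.sum_congr rfl fun j _ => ?_
    have hξ : ContDiff ℝ ∞ fun y => wd (-I) j ζ y + wd (-I) j (fun y => (Φ y : ℂ)) y * ζ y :=
      (contDiff_wd hζ).add ((contDiff_wd hΦc).mul hζ)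
    simp only [dl, map_sub, map_mul]
    rw [conj_wd (hd (contDiff_wd hηs) y), conj_wd (hd hΦc y)]
    simp only [h1, map_neg, conj_I, neg_neg, conj_ofReal]
    rw [wd_mul (hd hEs y) (hd hξ y), hEd]
    have : E y * wt Φ y = 1 := by simp [hE, wt, ← exp_add]
    linear_combination (wd I j (fun y => wd (-I) j ζ y +
      wd (-I) j (fun y => (Φ y : ℂ)) y * ζ y) y) * this
  have h3 := h η hηs hηc
  simp only [mul_assoc, h2, mul_neg] at h3
  rwa [integral_neg, neg_eq_zero] at h3

theorem wd_comp_sub {σ : ℂ} {j : Fin n} {g : Cn n → ℂ} (hg : Differentiable ℝ g) (x y : Cn n) :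
    wd σ j (fun y => g (x - y)) y = - wd σ j g (x - y) := by
  have h : HasFDerivAt (fun y => g (x - y))
      ((fderiv ℝ g (x - y)) ∘L (-ContinuousLinearMap.id ℝ (Cn n))) y :=
    (hg (x - y)).hasFDerivAt.comp y ((hasFDerivAt_id y).const_sub x)
  simp only [wd, h.fderiv]
  simp
  ring

theorem enorm_integral_increment_le {κ : Cn n → ℂ} {x : Cn n} {ε M : ℝ} (hε : 0 < ε)
    (h0 : ∀ y, ε < ‖x - y‖ → κ y = 0)
    (hκ : ∀ y, ‖κ y‖ ≤ M / volume.real (Metric.closedBall (0 : Cn n) ε)) :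
    ‖∫ y, (w y - w x) * κ y‖ₑ ≤ ENNReal.ofReal M / volume (Metric.closedBall (0 : Cn n) ε) *
      ∫⁻ v in Metric.closedBall (0 : Cn n) ε, ‖w (x - v) - w x‖ₑ := by
  set B := Metric.closedBall (0 : Cn n) ε
  have hB0 : volume B ≠ 0 := (Metric.measure_closedBall_pos _ _ hε).ne'
  have hBt : volume B ≠ ⊤ := (isCompact_closedBall _ _).measure_lt_top.ne
  have hBr : 0 < volume.real B := ENNReal.toReal_pos hB0 hBt
  have hc : ENNReal.ofReal (M / volume.real B) = ENNReal.ofReal M / volume B := by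
    rw [ENNReal.ofReal_div_of_pos hBr, Measure.real, ENNReal.ofReal_toReal hBt]
  rw [← integral_sub_left_eq_self (fun y => (w y - w x) * κ y) volume x]
  refine (enorm_integral_le_lintegral_enorm _).trans ?_
  rw [← hc, ← lintegral_const_mul' _ _ ENNReal.ofReal_ne_top,
    ← lintegral_indicator measurableSet_closedBall]
  refine lintegral_mono fun v => ?_
  by_cases hv : v ∈ B
  · rw [Set.indicator_of_mem hv, enorm_mul, mul_comm]
    gcongr
    rw [← ofReal_norm]
    exact ENNReal.ofReal_le_ofReal (hκ _)
  · have : κ (x - v) = 0 := h0 _ (by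
      rw [sub_sub_cancel]
      simpa [B] using hv)
    simp [this]

theorem integral_wd_eq_zero {σ : ℂ} {j : Fin n} {u : Cn n → ℂ} (hu : ContDiff ℝ ∞ u)
    (hc : HasCompactSupport u) : ∫ x, wd σ j u x = 0 := by
  have := integral_wd_mul (σ := σ) (j := j) hu (contDiff_const (c := (1 : ℂ))) (.inl hc)
  simpa [wd_const] using this

/-- The commutator kernel of `□_Φ` with convolution. -/
noncomputable def ker (Φ : Cn n → ℝ) (g : Cn n → ℂ) (x y : Cn n) : ℂ :=
  ∑ j, ((wd (-I) j (fun y => (Φ y : ℂ)) x - wd (-I) j (fun y => (Φ y : ℂ)) y) * wd I j g (x - y)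
    + wd I j (wd (-I) j (fun y => (Φ y : ℂ))) y * g (x - y))

theorem IsWeakNull.box_cv (hΦ : ContDiff ℝ ∞ Φ) (h : IsWeakNull Φ w) (hw : LocallyIntegrable w)
    {g : Cn n → ℂ} (hg : ContDiff ℝ ∞ g) (hgc : HasCompactSupport g) (x : Cn n) :
    box Φ (cv w g) x = ∫ y, (w y - w x) * ker Φ g x y := by
  have hΦc := contDiff_ofReal hΦ
  have hd : ∀ {f : Cn n → ℂ}, ContDiff ℝ ∞ f → Differentiable ℝ f := fun hf =>
    hf.differentiable (by simp)
  set p : Fin n → Cn n → ℂ := fun j => wd (-I) j (fun y => (Φ y : ℂ)) with hp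
  have hps : ∀ j, ContDiff ℝ ∞ (p j) := fun j => contDiff_wd hΦc
  have hsub : ∀ {f : Cn n → ℂ}, ContDiff ℝ ∞ f → ContDiff ℝ ∞ fun y => f (x - y) := fun hf =>
    hf.comp (contDiff_const.sub contDiff_id)
  have hwd : ∀ σ j, ContDiff ℝ ∞ fun y => wd σ j g (x - y) := fun σ j => hsub (contDiff_wd hg)
  have hwdc : ∀ σ j, HasCompactSupport fun y => wd σ j g (x - y) := fun σ j =>
    hasCompactSupport_comp_sub (hasCompactSupport_wd hgc) x
  have hgx := hasCompactSupport_comp_sub hgc x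
  -- the kernel is a sum of derivatives
  have hk1 : ∀ y, ker Φ g x y = ∑ j, wd I j (fun y => (p j y - p j x) * g (x - y)) y := fun y => by
    refine Finset.sum_congr rfl fun j _ => ?_
    rw [wd_mul (hd ((hps j).sub contDiff_const) y) (hd (hsub hg) y), wd_comp_sub (hd hg),
      wd_sub (hd (hps j) y) (differentiableAt_const _), wd_const]
    ring
  have hk0 : ∫ y, ker Φ g x y = 0 := by
    simp only [hk1]
    have hs : ∀ j, ContDiff ℝ ∞ fun y => (p j y - p j x) * g (x - y) := fun j =>
      ((hps j).sub contDiff_const).mul (hsub hg)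
    have hc : ∀ j, HasCompactSupport fun y => (p j y - p j x) * g (x - y) := fun j => hgx.mul_left
    rw [integral_finsetSum _ fun j _ => (contDiff_wd (hs j)).continuous.integrable_of_hasCompactSupport
      (hasCompactSupport_wd (hc j))]
    exact Finset.sum_eq_zero fun j _ => integral_wd_eq_zero (hs j) (hc j)
  have hkcont : Continuous (ker Φ g x) := by
    have h1 := fun j => (hps j).continuous
    have h2 := fun j => (contDiff_wd (σ := I) (j := j) (hps j)).continuous
    have h3 := fun j => (hwd I j).continuous
    have h4 := (hsub hg).continuous
    exact continuous_finsetSum _ fun j _ =>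
      ((continuous_const.sub (h1 j)).mul (h3 j)).add ((h2 j).mul h4)
  have hkc : HasCompactSupport (ker Φ g x) := by
    refine HasCompactSupport.of_support_subset_isCompact (hgx : IsCompact (tsupport _))
      fun y hy => ?_
    by_contra hyn
    refine hy (Finset.sum_eq_zero fun j _ => ?_)
    have e1 : g (x - y) = 0 := image_eq_zero_of_notMem_tsupport (f := fun y => g (x - y)) hyn
    have e2 : wd I j g (x - y) = 0 := by
      have := image_eq_zero_of_notMem_tsupport (f := wd I j fun y => g (x - y))
        fun h => hyn (tsupport_wd_subset h)
      rw [wd_comp_sub (hd hg)] at this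
      simpa using this
    simp [e1, e2]
  have hik : Integrable (ker Φ g x) := hkcont.integrable_of_hasCompactSupport hkc
  have hi1 : ∀ σ j, Integrable fun y => w y * wd σ j g (x - y) := fun σ j =>
    integrable_cv hw (contDiff_wd hg).continuous (hasCompactSupport_wd hgc) x
  have hi2 : ∀ σ τ j, Integrable fun y => w y * wd σ j (wd τ j g) (x - y) := fun σ τ j =>
    integrable_cv hw (contDiff_wd (contDiff_wd hg)).continuous
      (hasCompactSupport_wd (hasCompactSupport_wd hgc)) x
  have hi5 : ∀ j, Integrable fun y => w y * (p j x * wd I j g (x - y)) := fun j => by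
    simpa only [mul_left_comm] using (hi1 I j).const_mul (p j x)
  have hi6 : ∀ j, Integrable fun y => w y * (p j x * wd I j g (x - y)) -
      w y * wd I j (wd (-I) j g) (x - y) := fun j => (hi5 j).sub (hi2 I (-I) j)
  have hbox : box Φ (cv w g) x = ∫ y, w y *
      ∑ j, (p j x * wd I j g (x - y) - wd I j (wd (-I) j g) (x - y)) := by
    simp only [Finset.mul_sum, mul_sub]
    rw [integral_finsetSum _ fun j _ => hi6 j]
    rw [box, ← Finset.sum_neg_distrib]
    refine Finset.sum_congr rfl fun j _ => ?_
    rw [integral_sub (hi5 j) (hi2 I (-I) j)]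
    have e1 : wd I j (cv w g) = cv w (wd I j g) := funext fun y => wd_cv hw hg hgc y
    have e2 : wd (-I) j (wd I j g) = wd I j (wd (-I) j g) := funext fun y => wd_comm hg
    rw [dl, e1, wd_cv hw (contDiff_wd hg) (hasCompactSupport_wd hgc), e2, neg_sub]
    simp only [cv, mul_left_comm (w _), integral_const_mul]
    rfl
  have hweak := h.integral_eq_zero hΦ (hsub hg) hgx
  have hw2 : ∀ y, w y * ∑ j, wd I j (fun y => wd (-I) j (fun y => g (x - y)) y +
      p j y * g (x - y)) y = w y * ker Φ g x y - w y *
      ∑ j, (p j x * wd I j g (x - y) - wd I j (wd (-I) j g) (x - y)) := fun y => by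
    rw [← mul_sub, ker, ← Finset.sum_sub_distrib]
    congr 1
    refine Finset.sum_congr rfl fun j _ => ?_
    have e1 : wd (-I) j (fun y => g (x - y)) = fun y => - wd (-I) j g (x - y) :=
      funext fun y => wd_comp_sub (hd hg) x y
    rw [e1, wd_add (hd (hwd (-I) j).neg y) (hd ((hps j).mul (hsub hg)) y), wd_neg,
      wd_comp_sub (hd (contDiff_wd hg)), wd_mul (hd (hps j) y) (hd (hsub hg) y),
      wd_comp_sub (hd hg)]
    ring
  have hi3 : Integrable fun y => w y * ker Φ g x y :=
    integrable_mul_of_hasCompactSupport hw hkcont hkc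
  have hi4 : Integrable fun y => w y *
      ∑ j, (p j x * wd I j g (x - y) - wd I j (wd (-I) j g) (x - y)) := by
    simp only [Finset.mul_sum, mul_sub]
    exact integrable_finsetSum _ fun j _ => hi6 j
  simp only [hp] at hw2 hi4
  simp only [hw2] at hweak
  rw [integral_sub hi3 hi4, sub_eq_zero] at hweak
  rw [hbox]
  simp only [sub_mul]
  rw [integral_sub hi3 (hik.const_mul _), integral_const_mul, hk0, mul_zero, sub_zero, hweak]

end Friedrichs

section Friedrichs

variable {Φ : Cn n → ℝ} {w : Cn n → ℂ}

theorem cv_sub_eq (hw : LocallyIntegrable w) {g : Cn n → ℂ} (hg : Continuous g)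
    (hgc : HasCompactSupport g) (h1 : ∫ x, g x = 1) (x : Cn n) :
    cv w g x - w x = ∫ y, (w y - w x) * g (x - y) := by
  have hi : Integrable fun y => g (x - y) :=
    (hg.comp (continuous_const.sub continuous_id)).integrable_of_hasCompactSupport
      (hasCompactSupport_comp_sub hgc x)
  simp only [sub_mul]
  rw [integral_sub (integrable_cv hw hg hgc x) (hi.const_mul _), integral_const_mul,
    integral_sub_left_eq_self g volume x, h1, mul_one]
  rfl

theorem exists_lipschitz_closedBall {p : Cn n → ℂ} (hp : ContDiff ℝ ∞ p) (R : ℝ) :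
    ∃ L, 0 ≤ L ∧ ∀ x ∈ Metric.closedBall (0 : Cn n) R, ∀ y ∈ Metric.closedBall (0 : Cn n) R,
      ‖p x - p y‖ ≤ L * ‖x - y‖ := by
  obtain ⟨L, hL⟩ := (isCompact_closedBall (0 : Cn n) R).exists_bound_of_continuousOn
    (hp.fderiv_right (m := ∞) (by simp)).continuous.continuousOn
  refine ⟨|L|, abs_nonneg _, fun x hx y hy => ?_⟩
  exact (convex_closedBall (0 : Cn n) R).norm_image_sub_le_of_norm_fderiv_le (𝕜 := ℝ)
    (fun z _ => hp.differentiable (by simp) z) (fun z hz => (hL z hz).trans (le_abs_self _)) hy hx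

/-- Friedrichs' lemma: weak solutions of `□_Φ w = 0` are local limits of smooth approximate
solutions. -/
theorem IsWeakNull.exists_approx (hΦ : ContDiff ℝ ∞ Φ) (h : IsWeakNull Φ w)
    (hwm : StronglyMeasurable w)
    (hw : ∀ R, IntegrableOn (fun x => ‖w x‖ ^ 2) (Metric.closedBall 0 R)) (R : ℝ)
    {t : ℝ≥0∞} (ht : t ≠ 0) : ∃ u : Cn n → ℂ, ContDiff ℝ ∞ u ∧
      ∫⁻ x in Metric.closedBall (0 : Cn n) R, ‖u x - w x‖ₑ ^ 2 ≤ t ∧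
      ∫⁻ x in Metric.closedBall (0 : Cn n) R, ‖box Φ u x‖ₑ ^ 2 ≤ t := by
  have hwl := locallyIntegrable_of_sq hwm hw
  have hΦc := contDiff_ofReal hΦ
  obtain ⟨g, C, hC, hg⟩ := exists_mollifier n
  set p : Fin n → Cn n → ℂ := fun j => wd (-I) j (fun y => (Φ y : ℂ)) with hp
  have hps : ∀ j, ContDiff ℝ ∞ (p j) := fun j => contDiff_wd hΦc
  choose L hL0 hL using fun j => exists_lipschitz_closedBall (hps j) (R + 1)
  have hM' : ∀ j, ∃ M, 0 ≤ M ∧ ∀ x ∈ Metric.closedBall (0 : Cn n) (R + 1),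
      ‖wd I j (p j) x‖ ≤ M := fun j => by
    obtain ⟨M, hM⟩ := (isCompact_closedBall (0 : Cn n) (R + 1)).exists_bound_of_continuousOn
      (contDiff_wd (σ := I) (j := j) (hps j)).continuous.continuousOn
    exact ⟨|M|, abs_nonneg _, fun x hx => (hM x hx).trans (le_abs_self _)⟩
  choose M hM0 hM using hM'
  set C' : ℝ := C * (1 + ∑ j, (L j + M j)) with hC'
  have hS0 : 0 ≤ ∑ j, (L j + M j) := Finset.sum_nonneg fun j _ => add_nonneg (hL0 j) (hM0 j)
  have hC'0 : 0 ≤ C' := mul_nonneg hC (by linarith)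
  set s : ℝ≥0∞ := t / (ENNReal.ofReal (C' + 1)) ^ 2
  have hCt : (ENNReal.ofReal (C' + 1)) ^ 2 ≠ ⊤ := by simp
  have hCz : (ENNReal.ofReal (C' + 1)) ^ 2 ≠ 0 := by
    simp only [ne_eq, OfNat.ofNat_ne_zero, not_false_eq_true, pow_eq_zero_iff,
      ENNReal.ofReal_eq_zero, not_le]
    linarith
  have hs : s ≠ 0 := (ENNReal.div_pos ht hCt).ne'
  have hst : ENNReal.ofReal C' ^ 2 * s ≤ t := by
    calc ENNReal.ofReal C' ^ 2 * s ≤ ENNReal.ofReal (C' + 1) ^ 2 * s := by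
          gcongr; linarith
      _ = t := ENNReal.mul_div_cancel hCz hCt
  obtain ⟨δ, hδ, hav⟩ := exists_average_le hwm hw R hs
  set ε := min δ 1
  have hε : 0 < ε := by positivity
  have hε1 : ε ≤ 1 := min_le_right _ _
  obtain ⟨hgs, hg0, hg1, -, hgb, hgd⟩ := hg ε hε
  have hgc : HasCompactSupport (g ε) := by
    refine HasCompactSupport.intro (isCompact_closedBall (0 : Cn n) ε) fun x hx => hg0 x ?_
    rw [mem_closedBall_zero_iff, not_le] at hx
    exact hx.le
  have hgd0 : ∀ j x, ε < ‖x‖ → wd I j (g ε) x = 0 := fun j x hx => by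
    refine image_eq_zero_of_notMem_tsupport fun hmem => ?_
    have : tsupport (g ε) ⊆ Metric.closedBall 0 ε := by
      refine closure_minimal (fun y hy => ?_) Metric.isClosed_closedBall
      by_contra hyn
      rw [mem_closedBall_zero_iff, not_le] at hyn
      exact hy (hg0 y hyn.le)
    have := this (tsupport_wd_subset hmem)
    rw [mem_closedBall_zero_iff] at this
    linarith
  set V := volume.real (Metric.closedBall (0 : Cn n) ε)
  have hV : 0 < V := ENNReal.toReal_pos (Metric.measure_closedBall_pos _ _ hε).ne'
      (isCompact_closedBall _ _).measure_lt_top.ne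
  refine ⟨cv w (g ε), contDiff_cv hwl hgs hgc, ?_, ?_⟩
  · refine (hav ε hε (min_le_left _ _) C' _ hC'0 fun x _ => ?_).trans hst
    rw [cv_sub_eq hwl hgs.continuous hgc hg1]
    refine enorm_integral_increment_le hε (fun y hy => hg0 _ hy.le) fun y => (hgb _).trans ?_
    gcongr
    nlinarith
  · refine (hav ε hε (min_le_left _ _) C' _ hC'0 fun x hx => ?_).trans hst
    rw [h.box_cv hΦ hwl hgs hgc]
    have hker0 : ∀ y, ε < ‖x - y‖ → ker Φ (g ε) x y = 0 := fun y hy =>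
      Finset.sum_eq_zero fun j _ => by rw [hgd0 j _ hy, hg0 _ hy.le]; simp
    refine enorm_integral_increment_le hε hker0 fun y => ?_
    by_cases hy : ε < ‖x - y‖
    · rw [hker0 y hy, norm_zero]
      positivity
    rw [not_lt] at hy
    have hx' : ‖x‖ ≤ R := by simpa using hx
    have m1 : x ∈ Metric.closedBall (0 : Cn n) (R + 1) := by
      rw [mem_closedBall_zero_iff]; linarith
    have m2 : y ∈ Metric.closedBall (0 : Cn n) (R + 1) := by
      rw [mem_closedBall_zero_iff]
      have := norm_sub_le x (x - y)
      rw [sub_sub_cancel] at this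
      linarith
    calc ‖ker Φ (g ε) x y‖ ≤ ∑ j, (L j + M j) * (C / V) := by
          refine norm_sum_le_of_le _ fun j _ => ?_
          refine (norm_add_le _ _).trans ?_
          rw [norm_mul, norm_mul, add_mul]
          refine add_le_add ?_ (mul_le_mul (hM j y m2) (hgb _) (norm_nonneg _) (hM0 j))
          calc _ ≤ (L j * ε) * (C / (ε * V)) := by
                refine mul_le_mul ((hL j x m1 y m2).trans ?_) (hgd j _) (norm_nonneg _)
                  (mul_nonneg (hL0 j) hε.le)
                exact mul_le_mul_of_nonneg_left hy (hL0 j)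
            _ = _ := by field_simp
      _ = C * (∑ j, (L j + M j)) / V := by rw [← Finset.sum_mul]; ring
      _ ≤ C' / V := by gcongr; nlinarith

end Friedrichs

section Caccioppoli

variable {Φ : Cn n → ℝ} {w : Cn n → ℂ}

theorem integral_comb_four {α : Type*} [MeasurableSpace α] {μ : Measure α} {f₁ f₂ f₃ f₄ : α → ℝ}
    (h₁ : Integrable f₁ μ) (h₂ : Integrable f₂ μ) (h₃ : Integrable f₃ μ) (h₄ : Integrable f₄ μ)
    {a b c d : ℝ} : ∫ x, (a * f₁ x - (b * f₂ x + c * f₃ x + d * f₄ x)) ∂μ =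
      a * (∫ x, f₁ x ∂μ) - (b * (∫ x, f₂ x ∂μ) + c * (∫ x, f₃ x ∂μ) + d * (∫ x, f₄ x ∂μ)) := by
  have k1 : Integrable (fun x => b * f₂ x + c * f₃ x) μ := (h₂.const_mul b).add (h₃.const_mul c)
  have k2 : Integrable (fun x => b * f₂ x + c * f₃ x + d * f₄ x) μ := k1.add (h₄.const_mul d)
  rw [integral_sub (h₁.const_mul a) k2, integral_add k1 (h₄.const_mul d),
    integral_add (h₂.const_mul b) (h₃.const_mul c)]
  simp only [integral_const_mul]

theorem caccioppoli (hΦ : ContDiff ℝ ∞ Φ) {u : Cn n → ℂ} (hu : ContDiff ℝ ∞ u) {χ : Cn n → ℝ}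
    (hχ : ContDiff ℝ ∞ χ) (hχc : HasCompactSupport χ) {τ : ℝ} (hτ : 0 < τ) :
    ∫ x, χ x ^ 2 * (∑ j, ‖wd I j u x‖ ^ 2) * Real.exp (-Φ x) ≤
      (4 * ∫ x, (∑ j, ‖wd I j (fun y => (χ y : ℂ)) x‖ ^ 2) * ‖u x‖ ^ 2 * Real.exp (-Φ x)) +
      (τ * ∫ x, χ x ^ 2 * ‖u x‖ ^ 2 * Real.exp (-Φ x)) +
      τ⁻¹ * ∫ x, χ x ^ 2 * ‖box Φ u x‖ ^ 2 * Real.exp (-Φ x) := by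
  have hχs := contDiff_ofReal hχ
  have hχcc : HasCompactSupport fun y => (χ y : ℂ) := hχc.comp_left (g := fun t : ℝ => (t : ℂ)) (by simp)
  have hd : ∀ {f : Cn n → ℂ}, ContDiff ℝ ∞ f → Differentiable ℝ f := fun hf =>
    hf.differentiable (by simp)
  have hW := (contDiff_wt hΦ).continuous
  have hWr : Continuous fun x => Real.exp (-Φ x) := hΦ.continuous.neg.rexp
  set v : Cn n → ℂ := fun y => (χ y : ℂ) * (χ y : ℂ) * u y with hv
  have hvs : ContDiff ℝ ∞ v := (hχs.mul hχs).mul hu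
  have hvc : HasCompactSupport v := hχcc.mul_right.mul_right
  have hbs := contDiff_box hΦ hu
  have key := integral_mul_conj_box hΦ hvs hu (.inl hvc)
  have hi1 : Integrable fun x => v x * conj (box Φ u x) * wt Φ x :=
    ((hvs.continuous.mul (contDiff_conj hbs).continuous).mul hW).integrable_of_hasCompactSupport
      hvc.mul_right.mul_right
  have hi2 : ∀ j, Integrable fun x => wd I j v x * conj (wd I j u x) * wt Φ x := fun j =>
    (((contDiff_wd hvs).continuous.mul (contDiff_conj (contDiff_wd hu)).continuous).mul
      hW).integrable_of_hasCompactSupport (hasCompactSupport_wd hvc).mul_right.mul_right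
  rw [← integral_finsetSum _ fun j _ => hi2 j, eq_comm, ← sub_eq_zero,
    ← integral_sub (integrable_finsetSum _ fun j _ => hi2 j) hi1] at key
  have key2 := congrArg re key
  have hre := integral_re ((integrable_finsetSum Finset.univ fun j _ => hi2 j).sub hi1)
  simp only [RCLike.re_eq_complex_re] at hre
  simp only [zero_re] at key2
  have c0 : Continuous χ := hχ.continuous
  have c1 : Continuous u := hu.continuous
  have c2 : ∀ j, Continuous (wd I j u) := fun j => (contDiff_wd hu).continuous
  have c3 : Continuous (box Φ u) := hbs.continuous
  have c4 : ∀ j, Continuous (wd I j (fun y => (χ y : ℂ))) := fun j => (contDiff_wd hχs).continuous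
  have hχ2 : HasCompactSupport fun x => χ x ^ 2 := hχc.comp_left (g := fun t : ℝ => t ^ 2) (by simp)
  have j1 : Integrable fun x => χ x ^ 2 * (∑ j, ‖wd I j u x‖ ^ 2) * Real.exp (-Φ x) :=
    Continuous.integrable_of_hasCompactSupport (by fun_prop) hχ2.mul_right.mul_right
  have j2 : Integrable fun x => (∑ j, ‖wd I j (fun y => (χ y : ℂ)) x‖ ^ 2) * ‖u x‖ ^ 2 *
      Real.exp (-Φ x) := by
    refine Continuous.integrable_of_hasCompactSupport (by fun_prop) ?_
    refine HasCompactSupport.mul_right (HasCompactSupport.mul_right ?_)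
    refine HasCompactSupport.intro (hχcc : IsCompact (tsupport _)) fun x hx => ?_
    refine Finset.sum_eq_zero fun j _ => ?_
    rw [image_eq_zero_of_notMem_tsupport fun hm => hx (tsupport_wd_subset hm)]
    simp
  have j3 : Integrable fun x => χ x ^ 2 * ‖u x‖ ^ 2 * Real.exp (-Φ x) :=
    Continuous.integrable_of_hasCompactSupport (by fun_prop) hχ2.mul_right.mul_right
  have j4 : Integrable fun x => χ x ^ 2 * ‖box Φ u x‖ ^ 2 * Real.exp (-Φ x) :=
    Continuous.integrable_of_hasCompactSupport (by fun_prop) hχ2.mul_right.mul_right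
  have hpt : ∀ x, (1 / 2) * (χ x ^ 2 * (∑ j, ‖wd I j u x‖ ^ 2) * Real.exp (-Φ x)) -
      (2 * ((∑ j, ‖wd I j (fun y => (χ y : ℂ)) x‖ ^ 2) * ‖u x‖ ^ 2 * Real.exp (-Φ x)) +
      (τ / 2) * (χ x ^ 2 * ‖u x‖ ^ 2 * Real.exp (-Φ x)) +
      τ⁻¹ / 2 * (χ x ^ 2 * ‖box Φ u x‖ ^ 2 * Real.exp (-Φ x))) ≤
      ((∑ j, wd I j v x * conj (wd I j u x) * wt Φ x) - v x * conj (box Φ u x) * wt Φ x).re := by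
    intro x
    have ev : ∀ j, wd I j v x = (χ x : ℂ) ^ 2 * wd I j u x +
        2 * χ x * wd I j (fun y => (χ y : ℂ)) x * u x := fun j => by
      rw [hv, wd_mul (hd (hχs.mul hχs) x) (hd hu x), wd_mul (hd hχs x) (hd hχs x)]
      ring
    have hE : 0 < Real.exp (-Φ x) := Real.exp_pos _
    rw [wt_eq_ofReal, ← Finset.sum_mul, ← sub_mul, re_mul_ofReal]
    have h1 : ∀ j, (1 / 2) * (χ x ^ 2 * ‖wd I j u x‖ ^ 2) -
        2 * (‖wd I j (fun y => (χ y : ℂ)) x‖ ^ 2 * ‖u x‖ ^ 2) ≤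
        (wd I j v x * conj (wd I j u x)).re := fun j => by
      rw [ev, add_mul, add_re]
      have e1 : ((χ x : ℂ) ^ 2 * wd I j u x * conj (wd I j u x)).re =
          χ x ^ 2 * ‖wd I j u x‖ ^ 2 := by
        rw [mul_assoc, mul_conj, normSq_eq_norm_sq, ← ofReal_pow, ← ofReal_mul, ofReal_re]
      have e2 : -‖2 * (χ x : ℂ) * wd I j (fun y => (χ y : ℂ)) x * u x * conj (wd I j u x)‖ ≤
          (2 * (χ x : ℂ) * wd I j (fun y => (χ y : ℂ)) x * u x * conj (wd I j u x)).re :=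
        (abs_le.1 (abs_re_le_norm _)).1
      simp only [norm_mul, norm_real, RCLike.norm_conj, Complex.norm_ofNat] at e2
      have e3 : |χ x| ^ 2 = χ x ^ 2 := sq_abs _
      rw [e1]
      rw [Real.norm_eq_abs] at e2
      nlinarith [sq_nonneg (|χ x| * ‖wd I j u x‖ - 2 * (‖wd I j (fun y => (χ y : ℂ)) x‖ * ‖u x‖))]
    have h2 : (v x * conj (box Φ u x)).re ≤ (τ / 2) * (χ x ^ 2 * ‖u x‖ ^ 2) +
        τ⁻¹ / 2 * (χ x ^ 2 * ‖box Φ u x‖ ^ 2) := by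
      have e2 := (abs_le.1 (abs_re_le_norm (v x * conj (box Φ u x)))).2
      simp only [hv, norm_mul, norm_real, RCLike.norm_conj] at e2
      rw [Real.norm_eq_abs, abs_mul_abs_self] at e2
      refine e2.trans ?_
      have e4 : ‖u x‖ * ‖box Φ u x‖ ≤ (τ / 2) * ‖u x‖ ^ 2 + τ⁻¹ / 2 * ‖box Φ u x‖ ^ 2 := by
        have := sq_nonneg (τ * ‖u x‖ - ‖box Φ u x‖)
        have h5 : τ⁻¹ * τ = 1 := inv_mul_cancel₀ hτ.ne'
        have h6 := mul_nonneg (inv_nonneg.2 hτ.le) this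
        have h7 : τ⁻¹ * (τ * ‖u x‖ - ‖box Φ u x‖) ^ 2 =
          τ * ‖u x‖ ^ 2 - 2 * (‖u x‖ * ‖box Φ u x‖) + τ⁻¹ * ‖box Φ u x‖ ^ 2 := by
          field_simp
          ring
        linarith
      have := mul_le_mul_of_nonneg_left e4 (mul_self_nonneg (χ x))
      calc _ = χ x * χ x * (‖u x‖ * ‖box Φ u x‖) := by ring
        _ ≤ _ := this
        _ = _ := by ring
    have h3 := Finset.sum_le_sum fun j (_ : j ∈ Finset.univ) => h1 j
    rw [Finset.sum_sub_distrib, ← Finset.mul_sum, ← Finset.mul_sum, ← Finset.mul_sum,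
      ← Finset.sum_mul, ← re_sum] at h3
    rw [sub_re]
    have h4 := mul_le_mul_of_nonneg_right (sub_le_sub h3 h2) hE.le
    refine le_trans (le_of_eq ?_) h4
    ring
  have hmono := integral_mono ((j1.const_mul (1 / 2)).sub (((j2.const_mul 2).add
    (j3.const_mul (τ / 2))).add (j4.const_mul (τ⁻¹ / 2))))
    ((integrable_finsetSum Finset.univ fun j _ => hi2 j).sub hi1).re hpt
  simp only [RCLike.re_eq_complex_re] at hmono
  have hz : ∫ x, ((∑ j, wd I j v x * conj (wd I j u x) * wt Φ x) -
      v x * conj (box Φ u x) * wt Φ x).re = 0 := by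
    rw [← key2]
    exact hre
  have hL : ∫ x, ((1 / 2) * (χ x ^ 2 * (∑ j, ‖wd I j u x‖ ^ 2) * Real.exp (-Φ x)) -
      (2 * ((∑ j, ‖wd I j (fun y => (χ y : ℂ)) x‖ ^ 2) * ‖u x‖ ^ 2 * Real.exp (-Φ x)) +
      (τ / 2) * (χ x ^ 2 * ‖u x‖ ^ 2 * Real.exp (-Φ x)) +
      τ⁻¹ / 2 * (χ x ^ 2 * ‖box Φ u x‖ ^ 2 * Real.exp (-Φ x)))) ≤ 0 := by
    rw [← hz]; exact hmono
  rw [integral_comb_four j1 j2 j3 j4] at hL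
  linarith

end Caccioppoli

section WeakDbar

variable {Φ : Cn n → ℝ} {w : Cn n → ℂ}

theorem integral_sq_le_of_lintegral_le {α : Type*} [MeasurableSpace α] {μ : Measure α} {f : α → ℂ}
    {t : ℝ} (ht : 0 ≤ t) (h : ∫⁻ x, ‖f x‖ₑ ^ 2 ∂μ ≤ ENNReal.ofReal t) :
    ∫ x, ‖f x‖ ^ 2 ∂μ ≤ t := by
  by_cases hm : AEStronglyMeasurable (fun x => ‖f x‖ ^ 2) μ
  · rw [integral_eq_lintegral_of_nonneg_ae (.of_forall fun x => by positivity) hm]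
    refine ENNReal.toReal_le_of_le_ofReal ht (le_trans (le_of_eq ?_) h)
    refine lintegral_congr fun x => ?_
    rw [ENNReal.ofReal_pow (norm_nonneg _), ofReal_norm]
  · rw [integral_non_aestronglyMeasurable hm]
    exact ht

theorem exists_cutoff (n : ℕ) : ∃ D : ℝ, 0 ≤ D ∧ ∀ R : ℝ, 0 < R → ∃ χ : Cn n → ℝ,
    ContDiff ℝ ∞ χ ∧ HasCompactSupport χ ∧ (∀ x, 0 ≤ χ x ∧ χ x ≤ 1) ∧
    (∀ x ∈ Metric.closedBall (0 : Cn n) R, χ x = 1) ∧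
    (∀ x ∉ Metric.closedBall (0 : Cn n) (2 * R), χ x = 0) ∧
    (∀ x ∉ Metric.closedBall (0 : Cn n) (2 * R), ∀ j, wd I j (fun y => (χ y : ℂ)) x = 0) ∧
    ∀ x, ∑ j, ‖wd I j (fun y => (χ y : ℂ)) x‖ ^ 2 ≤ D / R ^ 2 := by
  let β : ContDiffBump (0 : Cn n) := ⟨1, 2, one_pos, one_lt_two⟩
  have hβ : ContDiff ℝ ∞ β := β.contDiff
  have hβc := contDiff_ofReal hβ
  have hβs : HasCompactSupport fun y => (β y : ℂ) :=
    β.hasCompactSupport.comp_left (g := fun t : ℝ => (t : ℂ)) (by simp)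
  have hD : ∀ j, ∃ D, ∀ x, ‖wd I j (fun y => (β y : ℂ)) x‖ ≤ D := fun j =>
    (hasCompactSupport_wd hβs).exists_bound_of_continuous (contDiff_wd hβc).continuous
  choose D hD using hD
  refine ⟨∑ j, D j ^ 2, by positivity, fun R hR => ⟨fun x => β (R⁻¹ • x), ?_⟩⟩
  have hz : ∀ x ∉ Metric.closedBall (0 : Cn n) (2 * R), β (R⁻¹ • x) = 0 := fun x hx => by
    refine β.zero_of_le_dist ?_
    rw [mem_closedBall_zero_iff, not_le] at hx
    rw [dist_zero_right, norm_smul, norm_inv, Real.norm_of_nonneg hR.le]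
    show (2 : ℝ) ≤ _
    field_simp
    linarith
  refine ⟨hβ.comp (contDiff_const_smul (𝕜 := ℝ) (n := ∞) (R⁻¹ : ℝ)),
    HasCompactSupport.intro (isCompact_closedBall 0 (2 * R)) hz,
    fun x => ⟨β.nonneg, β.le_one⟩, fun x hx => β.one_of_mem_closedBall ?_, hz, fun x hx j => ?_,
    fun x => ?_⟩
  · rw [mem_closedBall_zero_iff] at hx ⊢
    rw [norm_smul, norm_inv, Real.norm_of_nonneg hR.le]
    show _ ≤ (1 : ℝ)
    field_simp
    exact hx
  · have : (fun y => ((β (R⁻¹ • y) : ℝ) : ℂ)) =ᶠ[nhds x] fun _ => 0 := by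
      filter_upwards [Metric.isClosed_closedBall.isOpen_compl.mem_nhds hx] with y hy
      rw [hz y hy, ofReal_zero]
    rw [wd_congr this, wd_const]
  · rw [Finset.sum_div]
    refine Finset.sum_le_sum fun j _ => ?_
    rw [wd_comp_smul (u := fun y => (β y : ℂ)) (hβc.differentiable (by simp)), norm_mul, norm_real,
      norm_inv, Real.norm_of_nonneg hR.le, mul_pow, inv_pow, div_eq_inv_mul]
    gcongr
    exact hD j _

theorem integrableOn_sq_of_weight (hΦ : Continuous Φ)
    (hw : Integrable fun x => ‖w x‖ ^ 2 * Real.exp (-Φ x)) (R : ℝ) :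
    IntegrableOn (fun x => ‖w x‖ ^ 2) (Metric.closedBall 0 R) := by
  have := hw.integrableOn (s := Metric.closedBall 0 R).mul_continuousOn
    (g' := fun x => Real.exp (Φ x)) hΦ.rexp.continuousOn (isCompact_closedBall 0 R)
  refine this.congr (.of_forall fun x => ?_)
  simp [mul_assoc, ← Real.exp_add]

theorem IsWeakNull.exists_approx_dbar (hΦ : ContDiff ℝ ∞ Φ) (h : IsWeakNull Φ w)
    (hwm : StronglyMeasurable w) (hw : Integrable fun x => ‖w x‖ ^ 2 * Real.exp (-Φ x))
    (R₀ : ℝ) {κ : ℝ} (hκ : 0 < κ) : ∃ u : Cn n → ℂ, ContDiff ℝ ∞ u ∧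
      ∫ x in Metric.closedBall 0 R₀, ‖u x - w x‖ ^ 2 ≤ κ ∧
      ∫ x in Metric.closedBall 0 R₀, (∑ j, ‖wd I j u x‖ ^ 2) * Real.exp (-Φ x) ≤ κ := by
  have hloc := integrableOn_sq_of_weight hΦ.continuous hw
  obtain ⟨D, hD, hcut⟩ := exists_cutoff n
  set N := ∫ x, ‖w x‖ ^ 2 * Real.exp (-Φ x)
  have hN : 0 ≤ N := integral_nonneg fun x => by positivity
  set R := max 1 R₀ + 12 * D * (2 * N + 2) / κ
  have hR1 : 1 ≤ R := by
    have : 0 ≤ 12 * D * (2 * N + 2) / κ := by positivity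
    linarith [le_max_left 1 R₀]
  have hRR : R₀ ≤ R := by
    have : 0 ≤ 12 * D * (2 * N + 2) / κ := by positivity
    linarith [le_max_right 1 R₀]
  have hRD : 4 * (D / R ^ 2) * (2 * N + 2) ≤ κ / 3 := by
    have h1 : 12 * D * (2 * N + 2) / κ ≤ R ^ 2 := by
      have : 12 * D * (2 * N + 2) / κ ≤ R := by
        linarith [le_max_left 1 R₀]
      nlinarith
    rw [div_le_iff₀ hκ] at h1
    have h2 : 4 * (D / R ^ 2) * (2 * N + 2) = (4 * D * (2 * N + 2)) / R ^ 2 := by ring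
    rw [h2, div_le_iff₀ (by positivity)]
    linarith
  set τ := κ / (3 * (2 * N + 2)) with hτ
  have hτ0 : 0 < τ := by positivity
  set B := Metric.closedBall (0 : Cn n) (2 * R)
  obtain ⟨S', hS'⟩ := (isCompact_closedBall (0 : Cn n) (2 * R)).exists_bound_of_continuousOn
    hΦ.continuous.neg.rexp.continuousOn
  set S := max S' 1
  have hS1 : 1 ≤ S := le_max_right _ _
  have hS : ∀ x ∈ B, Real.exp (-Φ x) ≤ S := fun x hx =>
    (Real.le_norm_self _).trans ((hS' x hx).trans (le_max_left _ _))
  set t := min κ (min (1 / S) (κ * τ / (3 * S)))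
  have ht : 0 < t := by positivity
  have ht1 : t ≤ κ := min_le_left _ _
  have ht2 : t * S ≤ 1 := by
    have : t ≤ 1 / S := (min_le_right _ _).trans (min_le_left _ _)
    rwa [le_div_iff₀ (by positivity)] at this
  have ht3 : τ⁻¹ * (t * S) ≤ κ / 3 := by
    have : t ≤ κ * τ / (3 * S) := (min_le_right _ _).trans (min_le_right _ _)
    rw [le_div_iff₀ (by positivity)] at this
    rw [inv_mul_le_iff₀ hτ0]
    linarith
  obtain ⟨u, hu, hu1, hu2⟩ := h.exists_approx hΦ hwm hloc (2 * R)
    (t := ENNReal.ofReal t) (by simpa using ht)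
  replace hu1 := integral_sq_le_of_lintegral_le ht.le hu1
  replace hu2 := integral_sq_le_of_lintegral_le ht.le hu2
  have cW : Continuous fun x => Real.exp (-Φ x) := hΦ.continuous.neg.rexp
  have c1 : Continuous u := hu.continuous
  have c2 : ∀ j, Continuous (wd I j u) := fun j => (contDiff_wd hu).continuous
  have c3 : Continuous (box Φ u) := (contDiff_box hΦ hu).continuous
  have hBc : IsCompact B := isCompact_closedBall _ _
  have hBm : MeasurableSet B := measurableSet_closedBall
  have iB : ∀ {f : Cn n → ℝ}, Continuous f → IntegrableOn f B := fun hf =>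
    hf.continuousOn.integrableOn_compact hBc
  have hsub : Metric.closedBall (0 : Cn n) R₀ ⊆ B := Metric.closedBall_subset_closedBall (by linarith)
  have iD : IntegrableOn (fun x => ‖u x - w x‖ ^ 2) B := by
    have m1 : MemLp u 2 (volume.restrict B) :=
      (memLp_two_iff_integrable_sq_norm c1.aestronglyMeasurable).2 (iB (by fun_prop))
    have m2 : MemLp w 2 (volume.restrict B) :=
      (memLp_two_iff_integrable_sq_norm hwm.aestronglyMeasurable).2 (hloc (2 * R))
    exact (memLp_two_iff_integrable_sq_norm
      (c1.aestronglyMeasurable.sub hwm.aestronglyMeasurable)).1 (m1.sub m2)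
  refine ⟨u, hu, ?_, ?_⟩
  · refine le_trans ?_ (hu1.trans ht1)
    exact setIntegral_mono_set iD (.of_forall fun x => by positivity) hsub.eventuallyLE
  obtain ⟨χ, hχ, hχc, hχ01, hχ1, hχ0, hχd0, hχd⟩ := hcut R (by linarith)
  have cχ := hχ.continuous
  have key := caccioppoli hΦ hu hχ hχc hτ0
  have hle1 : ∀ x, χ x ^ 2 ≤ 1 := fun x => pow_le_one₀ (hχ01 x).1 (hχ01 x).2
  have hU : ∫ x in B, ‖u x‖ ^ 2 * Real.exp (-Φ x) ≤ 2 * N + 2 := by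
    calc ∫ x in B, ‖u x‖ ^ 2 * Real.exp (-Φ x)
        ≤ ∫ x in B, (2 * (‖w x‖ ^ 2 * Real.exp (-Φ x)) + 2 * S * ‖u x - w x‖ ^ 2) := by
          refine setIntegral_mono_on (iB (by fun_prop))
            ((hw.integrableOn.const_mul 2).add (iD.const_mul _)) hBm fun x hx => ?_
          have h1 : ‖u x‖ ≤ ‖w x‖ + ‖u x - w x‖ := by
            simpa using norm_add_le (w x) (u x - w x)
          have h2 : ‖u x‖ ^ 2 ≤ 2 * ‖w x‖ ^ 2 + 2 * ‖u x - w x‖ ^ 2 := by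
            nlinarith [norm_nonneg (u x), sq_nonneg (‖w x‖ - ‖u x - w x‖)]
          have h3 := mul_le_mul_of_nonneg_right h2 (Real.exp_pos (-Φ x)).le
          have h4 := mul_le_mul_of_nonneg_left (hS x hx) (sq_nonneg ‖u x - w x‖)
          linarith
      _ = 2 * (∫ x in B, ‖w x‖ ^ 2 * Real.exp (-Φ x)) + 2 * S * ∫ x in B, ‖u x - w x‖ ^ 2 := by
          rw [integral_add (hw.integrableOn.const_mul 2) (iD.const_mul _), integral_const_mul,
            integral_const_mul]
      _ ≤ 2 * N + 2 * S * t := by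
          gcongr
          exact setIntegral_le_integral hw (.of_forall fun x => by positivity)
      _ ≤ _ := by linarith
  have k1 : ∫ x, (∑ j, ‖wd I j (fun y => (χ y : ℂ)) x‖ ^ 2) * ‖u x‖ ^ 2 * Real.exp (-Φ x) ≤
      D / R ^ 2 * (2 * N + 2) := by
    have c4 : ∀ j, Continuous (wd I j (fun y => (χ y : ℂ))) := fun j =>
      (contDiff_wd (contDiff_ofReal hχ)).continuous
    rw [← setIntegral_eq_integral_of_forall_compl_eq_zero (s := B) fun x hx => by
      simp [hχd0 x hx]]
    calc _ ≤ ∫ x in B, D / R ^ 2 * (‖u x‖ ^ 2 * Real.exp (-Φ x)) := by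
          refine setIntegral_mono_on (iB (by fun_prop)) (iB (by fun_prop)) hBm fun x _ => ?_
          rw [mul_assoc]
          exact mul_le_mul_of_nonneg_right (hχd x) (by positivity)
      _ ≤ _ := by
          rw [integral_const_mul]
          gcongr
  have k2 : ∫ x, χ x ^ 2 * ‖u x‖ ^ 2 * Real.exp (-Φ x) ≤ 2 * N + 2 := by
    rw [← setIntegral_eq_integral_of_forall_compl_eq_zero (s := B) fun x hx => by
      simp [hχ0 x hx]]
    refine le_trans ?_ hU
    refine setIntegral_mono_on (iB (by fun_prop)) (iB (by fun_prop)) hBm fun x _ => ?_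
    rw [mul_assoc]
    exact mul_le_of_le_one_left (by positivity) (hle1 x)
  have k3 : ∫ x, χ x ^ 2 * ‖box Φ u x‖ ^ 2 * Real.exp (-Φ x) ≤ t * S := by
    rw [← setIntegral_eq_integral_of_forall_compl_eq_zero (s := B) fun x hx => by
      simp [hχ0 x hx]]
    calc _ ≤ ∫ x in B, ‖box Φ u x‖ ^ 2 * S := by
          refine setIntegral_mono_on (iB (by fun_prop)) (iB (by fun_prop)) hBm fun x hx => ?_
          have := mul_le_mul (hle1 x) (mul_le_mul_of_nonneg_left (hS x hx)
            (sq_nonneg ‖box Φ u x‖)) (by positivity) zero_le_one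
          linarith
      _ ≤ _ := by
          rw [integral_mul_const]
          gcongr
  have k4 : ∫ x in Metric.closedBall 0 R₀, (∑ j, ‖wd I j u x‖ ^ 2) * Real.exp (-Φ x) ≤
      ∫ x, χ x ^ 2 * (∑ j, ‖wd I j u x‖ ^ 2) * Real.exp (-Φ x) := by
    have e : ∫ x in Metric.closedBall 0 R₀, (∑ j, ‖wd I j u x‖ ^ 2) * Real.exp (-Φ x) =
        ∫ x in Metric.closedBall 0 R₀, χ x ^ 2 * (∑ j, ‖wd I j u x‖ ^ 2) * Real.exp (-Φ x) := by
      refine setIntegral_congr_fun measurableSet_closedBall fun x hx => ?_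
      rw [hχ1 x (Metric.closedBall_subset_closedBall hRR hx)]
      ring
    rw [e]
    refine setIntegral_le_integral ?_ (.of_forall fun x => by positivity)
    exact Continuous.integrable_of_hasCompactSupport (by fun_prop)
      (hχc.comp_left (g := fun t : ℝ => t ^ 2) (by simp)).mul_right.mul_right
  refine k4.trans (key.trans ?_)
  have f1 := mul_le_mul_of_nonneg_left k1 (by norm_num : (0 : ℝ) ≤ 4)
  have f2 := mul_le_mul_of_nonneg_left k2 hτ0.le
  have f3 := mul_le_mul_of_nonneg_left k3 (inv_nonneg.2 hτ0.le)
  have f4 : τ * (2 * N + 2) = κ / 3 := by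
    rw [hτ]
    field_simp
  linarith

end WeakDbar

section Weyl

variable {Φ : Cn n → ℝ} {w F : Cn n → ℂ}

theorem norm_setIntegral_mul_le {B : Set (Cn n)} (hB : IsCompact B) {f g : Cn n → ℂ}
    {M s : ℝ} (hM : 0 ≤ M) (hs : 0 < s) (hg : ∀ x ∈ B, ‖g x‖ ≤ M)
    (hf : IntegrableOn (fun x => ‖f x‖ ^ 2) B) :
    ‖∫ x in B, f x * g x‖ ≤ M * (s * volume.real B + s⁻¹ * ∫ x in B, ‖f x‖ ^ 2) := by
  have hc : IntegrableOn (fun _ => s) B := integrableOn_const hB.measure_lt_top.ne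
  have hi : IntegrableOn (fun x => M * (s + s⁻¹ * ‖f x‖ ^ 2)) B :=
    Integrable.const_mul (hc.add (hf.const_mul _)) _
  refine (norm_integral_le_of_norm_le hi ?_).trans (le_of_eq ?_)
  · refine (ae_restrict_iff' hB.measurableSet).2 (.of_forall fun x hx => ?_)
    rw [norm_mul, mul_comm]
    have h1 : ‖f x‖ ≤ s + s⁻¹ * ‖f x‖ ^ 2 := by
      rw [← sub_nonneg]
      have : s + s⁻¹ * ‖f x‖ ^ 2 - ‖f x‖ = s⁻¹ * ((‖f x‖ - s / 2) ^ 2 + 3 / 4 * s ^ 2) := by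
        field_simp
        ring
      rw [this]
      positivity
    exact mul_le_mul (hg x hx) h1 (norm_nonneg _) hM
  · rw [integral_const_mul, integral_add hc (hf.const_mul _), integral_const_mul]
    simp [mul_comm]

/-- Weak solutions of `□_Φ w = 0` in the weighted `L²` space are weakly holomorphic. -/
theorem IsWeakNull.integral_mul_wd_eq_zero (hΦ : ContDiff ℝ ∞ Φ) (h : IsWeakNull Φ w)
    (hwm : StronglyMeasurable w) (hw : Integrable fun x => ‖w x‖ ^ 2 * Real.exp (-Φ x))
    {ζ : Cn n → ℂ} (hζ : ContDiff ℝ ∞ ζ) (hζc : HasCompactSupport ζ) (j : Fin n) :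
    ∫ x, w x * wd I j ζ x = 0 := by
  have hsq := integrableOn_sq_of_weight hΦ.continuous hw
  have hloc := locallyIntegrable_of_sq hwm hsq
  have hζ' := contDiff_wd (σ := I) (j := j) hζ
  have hζc' := hasCompactSupport_wd (σ := I) (j := j) hζc
  obtain ⟨R, hR⟩ := (hζc : IsCompact (tsupport ζ)).isBounded.subset_closedBall (0 : Cn n)
  set B := Metric.closedBall (0 : Cn n) R
  have hB : IsCompact B := isCompact_closedBall _ _
  obtain ⟨M₁, hM₁⟩ := hB.exists_bound_of_continuousOn hζ.continuous.continuousOn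
  obtain ⟨M₂, hM₂⟩ := hB.exists_bound_of_continuousOn hζ'.continuous.continuousOn
  obtain ⟨P, hP⟩ := hB.exists_bound_of_continuousOn hΦ.continuous.rexp.continuousOn
  set M := max 0 (max M₁ M₂)
  have hM : 0 ≤ M := le_max_left _ _
  have hζM : ∀ x ∈ B, ‖ζ x‖ ≤ M := fun x hx =>
    (hM₁ x hx).trans ((le_max_left _ _).trans (le_max_right _ _))
  have hζM' : ∀ x ∈ B, ‖wd I j ζ x‖ ≤ M := fun x hx =>
    (hM₂ x hx).trans ((le_max_right _ _).trans (le_max_right _ _))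
  have z1 : ∀ x ∉ B, ζ x = 0 := fun x hx =>
    image_eq_zero_of_notMem_tsupport fun hh => hx (hR hh)
  have z2 : ∀ x ∉ B, wd I j ζ x = 0 := fun x hx =>
    image_eq_zero_of_notMem_tsupport fun hh => hx (hR (tsupport_wd_subset hh))
  have key : ∀ s : ℝ, 0 < s → ‖∫ x, w x * wd I j ζ x‖ ≤
      s * (M * (2 * volume.real B + 1 + |P|)) := fun s hs => by
    obtain ⟨u, hu, hu1, hu2⟩ := h.exists_approx_dbar hΦ hwm hw R (pow_pos hs 2)
    have hud : ∀ k, ContDiff ℝ ∞ (wd I k u) := fun k => contDiff_wd hu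
    have i1 : Integrable fun x => w x * wd I j ζ x :=
      integrable_mul_of_hasCompactSupport hloc hζ'.continuous hζc'
    have i2 : Integrable fun x => u x * wd I j ζ x :=
      (hu.continuous.mul hζ'.continuous).integrable_of_hasCompactSupport hζc'.mul_left
    have e1 : ∫ x, w x * wd I j ζ x =
        -(∫ x in B, (u x - w x) * wd I j ζ x) - ∫ x in B, wd I j u x * ζ x := by
      rw [setIntegral_eq_integral_of_forall_compl_eq_zero (fun x hx => by simp [z2 x hx]),
        setIntegral_eq_integral_of_forall_compl_eq_zero (fun x hx => by simp [z1 x hx]),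
        integral_wd_mul hu hζ (.inr hζc)]
      simp only [sub_mul]
      rw [integral_sub i2 i1]
      ring
    have iw : IntegrableOn (fun x => ‖u x - w x‖ ^ 2) B := by
      have m1 : MemLp w 2 (volume.restrict B) :=
        (memLp_two_iff_integrable_sq_norm hwm.aestronglyMeasurable).2 (hsq R)
      have m2 : MemLp u 2 (volume.restrict B) :=
        (memLp_two_iff_integrable_sq_norm hu.continuous.aestronglyMeasurable).2
          ((hu.continuous.norm.pow 2).continuousOn.integrableOn_compact hB)
      exact (memLp_two_iff_integrable_sq_norm (m2.sub m1).1).1 (m2.sub m1)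
    have iu : IntegrableOn (fun x => ‖wd I j u x‖ ^ 2) B :=
      ((hud j).continuous.norm.pow 2).continuousOn.integrableOn_compact hB
    have iS : IntegrableOn (fun x => (∑ k, ‖wd I k u x‖ ^ 2) * Real.exp (-Φ x)) B := by
      refine Continuous.continuousOn ?_ |>.integrableOn_compact hB
      exact (continuous_finsetSum _ fun k _ => (hud k).continuous.norm.pow 2).mul
        hΦ.continuous.neg.rexp
    have b1 := norm_setIntegral_mul_le hB hM hs hζM' iw
    have b2 := norm_setIntegral_mul_le hB hM hs hζM iu
    have b3 : ∫ x in B, ‖wd I j u x‖ ^ 2 ≤ |P| * s ^ 2 := by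
      calc _ ≤ ∫ x in B, |P| * ((∑ k, ‖wd I k u x‖ ^ 2) * Real.exp (-Φ x)) := by
            refine setIntegral_mono_on iu (iS.const_mul _) hB.measurableSet fun x hx => ?_
            have a1 : ‖wd I j u x‖ ^ 2 ≤ ∑ k, ‖wd I k u x‖ ^ 2 :=
              Finset.single_le_sum (f := fun k => ‖wd I k u x‖ ^ 2) (fun k _ => by positivity)
                (Finset.mem_univ j)
            have a2 : Real.exp (Φ x) ≤ |P| := (le_abs_self _).trans ((hP x hx).trans (le_abs_self _))
            calc ‖wd I j u x‖ ^ 2 ≤ ∑ k, ‖wd I k u x‖ ^ 2 := a1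
              _ = Real.exp (Φ x) * ((∑ k, ‖wd I k u x‖ ^ 2) * Real.exp (-Φ x)) := by
                  rw [mul_left_comm, ← Real.exp_add]; simp
              _ ≤ _ := by gcongr
        _ ≤ _ := by
            rw [integral_const_mul]
            gcongr
    have b4 : s⁻¹ * ∫ x in B, ‖u x - w x‖ ^ 2 ≤ s := by
      calc _ ≤ s⁻¹ * s ^ 2 := by gcongr
        _ = s := by field_simp
    have b5 : s⁻¹ * ∫ x in B, ‖wd I j u x‖ ^ 2 ≤ s * |P| := by
      calc _ ≤ s⁻¹ * (|P| * s ^ 2) := by gcongr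
        _ = s * |P| := by field_simp
    rw [e1]
    calc _ ≤ ‖∫ x in B, (u x - w x) * wd I j ζ x‖ + ‖∫ x in B, wd I j u x * ζ x‖ := by
          rw [← norm_neg (∫ x in B, (u x - w x) * wd I j ζ x)]
          exact norm_sub_le _ _
      _ ≤ M * (s * volume.real B + s) + M * (s * volume.real B + s * |P|) := by
          refine add_le_add (b1.trans ?_) (b2.trans ?_) <;> gcongr
      _ = _ := by ring
  rw [← norm_le_zero_iff]
  refine le_of_forall_pos_le_add fun t ht => ?_
  set A := M * (2 * volume.real B + 1 + |P|)
  have hA : 0 ≤ A := by positivity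
  refine (key (t / (A + 1)) (by positivity)).trans ?_
  rw [zero_add, div_mul_eq_mul_div, div_le_iff₀ (by positivity)]
  nlinarith

theorem differentiableAt_of_wd_eq_zero {x : Cn n} (hF : DifferentiableAt ℝ F x)
    (h : ∀ j, wd I j F x = 0) : DifferentiableAt ℂ F x := by
  rw [differentiableAt_iff_restrictScalars ℝ hF]
  set L := fderiv ℝ F x
  have h1 : ∀ j, L (I • e j) = I * L (e j) := fun j => by
    have := h j
    simp only [wd] at this
    have h2 : L (e j) + I * L (I • e j) = 0 := by simpa using this
    linear_combination -I * h2 + L (I • e j) * I_mul_I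
  have h2 : ∀ (c : ℂ) j, L (c • e j) = c * L (e j) := fun c j => by
    have : c • (e j : Cn n) = c.re • e j + c.im • (I • e j) := by
      conv_lhs => rw [← re_add_im c]
      rw [add_smul, mul_smul]
      rfl
    rw [this, map_add, map_smul, map_smul, h1]
    conv_rhs => rw [← re_add_im c]
    simp only [real_smul]
    ring
  have h3 : ∀ v, L v = ∑ j, v j * L (e j) := fun v => by
    conv_lhs => rw [← sum_smul_e v]
    rw [map_sum]
    exact Finset.sum_congr rfl fun j _ => h2 _ _
  refine ⟨⟨⟨⟨L, L.map_add⟩, fun c v => ?_⟩, L.cont⟩, rfl⟩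
  simp only [RingHom.id_apply]
  rw [h3, h3 v, smul_eq_mul, Finset.mul_sum]
  exact Finset.sum_congr rfl fun j _ => by simp [mul_assoc]

theorem wd_eq_zero_of_differentiableAt {x : Cn n} (hF : DifferentiableAt ℂ F x) (j : Fin n) :
    wd I j F x = 0 := by
  have : fderiv ℝ F x = (fderiv ℂ F x).restrictScalars ℝ :=
    (hF.hasFDerivAt.restrictScalars ℝ).fderiv
  simp only [wd, this]
  simp only [ContinuousLinearMap.coe_restrictScalars', map_smul, smul_eq_mul]
  linear_combination (1 / 2) * (fderiv ℂ F x (e j)) * I_mul_I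

/-- Averaging a holomorphic function against a circle-invariant kernel. -/
theorem integral_comp_sub_mul {p : Cn n} {r ε : ℝ} (hF : DifferentiableOn ℂ F (Metric.ball p r))
    (hε : ε < r) {g : Cn n → ℂ} (hg : Continuous g) (hg0 : ∀ x, ε ≤ ‖x‖ → g x = 0)
    (hg1 : ∫ x, g x = 1) (hgc : ∀ c : ℂ, ‖c‖ = 1 → ∀ x, g (c • x) = g x) :
    ∫ y, F (p - y) * g y = F p := by
  set B := Metric.closedBall (0 : Cn n) ε
  have hB : IsCompact B := isCompact_closedBall _ _
  have z : ∀ x ∉ B, g x = 0 := fun x hx => hg0 x (by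
    have : ¬ ‖x‖ ≤ ε := by simpa [B] using hx
    exact (not_le.1 this).le)
  have hmem : ∀ y ∈ B, ∀ c : ℂ, ‖c‖ ≤ 1 → p - c • y ∈ Metric.ball p r := fun y hy c hc => by
    rw [mem_ball_iff_norm, sub_sub_cancel_left, norm_neg, norm_smul]
    have : ‖y‖ ≤ ε := by simpa [B] using hy
    nlinarith [norm_nonneg y]
  have hrot : ∀ θ : ℝ, ∫ y in B, F (p - circleMap 0 1 θ • y) * g y = ∫ y, F (p - y) * g y :=
    fun θ => by
    have hc : ‖circleMap 0 1 θ‖ = 1 := by simp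
    rw [setIntegral_eq_integral_of_forall_compl_eq_zero (fun x hx => by simp [z x hx])]
    let S : Cn n ≃ₗᵢ[ℝ] Cn n := LinearIsometryEquiv.mk
      ((LinearEquiv.smulOfNeZero ℂ (Cn n) (circleMap 0 1 θ) (by
        rw [← norm_ne_zero_iff, hc]; exact one_ne_zero)).restrictScalars ℝ) (fun x => by
          change ‖circleMap 0 1 θ • x‖ = ‖x‖
          rw [norm_smul, hc, one_mul])
    have hS : MeasurePreserving S volume volume := S.measurePreserving
    rw [← hS.integral_comp S.toHomeomorph.measurableEmbedding fun y => F (p - y) * g y]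
    refine integral_congr_ae (.of_forall fun y => ?_)
    change F (p - circleMap 0 1 θ • y) * g y =
      F (p - circleMap 0 1 θ • y) * g (circleMap 0 1 θ • y)
    rw [hgc _ hc]
  have hmean : ∀ y ∈ B, Real.circleAverage (fun c : ℂ => F (p - c • y)) 0 1 = F p := fun y hy => by
    have hd : DifferentiableOn ℂ (fun c : ℂ => F (p - c • y)) (Metric.closedBall 0 |(1 : ℝ)|) := by
      refine hF.comp (by fun_prop) fun c hc => hmem y hy c ?_
      simpa using hc
    rw [DiffContOnCl.circleAverage (hd.diffContOnCl_ball subset_rfl)]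
    simp
  have hcont : ContinuousOn (Function.uncurry fun (θ : ℝ) (y : Cn n) =>
      F (p - circleMap 0 1 θ • y) * g y) (Set.Icc 0 (2 * Real.pi) ×ˢ B) := by
    refine ContinuousOn.mul ?_ (by fun_prop)
    refine hF.continuousOn.comp ?_ fun q hq => hmem q.2 hq.2 _ (by simp)
    have : Continuous (circleMap 0 1) := continuous_circleMap 0 1
    fun_prop
  have h_int : Integrable (Function.uncurry fun (θ : ℝ) (y : Cn n) =>
      F (p - circleMap 0 1 θ • y) * g y)
      ((volume.restrict (Set.Ioc 0 (2 * Real.pi))).prod (volume.restrict B)) := by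
    rw [Measure.prod_restrict]
    exact (hcont.integrableOn_compact (isCompact_Icc.prod hB)).mono_set
      (Set.prod_mono Set.Ioc_subset_Icc_self subset_rfl)
  have hsw := integral_integral_swap h_int
  simp only [hrot] at hsw
  have e1 : ∀ y ∈ B, ∫ θ in Set.Ioc 0 (2 * Real.pi), F (p - circleMap 0 1 θ • y) * g y =
      (2 * Real.pi : ℝ) • (F p * g y) := fun y hy => by
    have h1 := hmean y hy
    rw [Real.circleAverage, intervalIntegral.integral_of_le (by positivity)] at h1
    rw [integral_mul_const, ← h1, smul_mul_assoc, smul_smul, mul_inv_cancel₀ (by positivity),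
      one_smul]
  rw [setIntegral_congr_fun (g := fun y => (2 * Real.pi : ℝ) • (F p * g y)) hB.measurableSet e1,
    setIntegral_const, integral_smul, integral_const_mul,
    setIntegral_eq_integral_of_forall_compl_eq_zero z, hg1, mul_one] at hsw
  have hv : volume.real (Set.Ioc 0 (2 * Real.pi)) = 2 * Real.pi := by
    rw [Real.volume_real_Ioc_of_le (by positivity)]; ring
  rw [hv] at hsw
  exact smul_right_injective ℂ (by positivity : (2 * Real.pi : ℝ) ≠ 0) hsw

/-- Interior estimate for holomorphic functions. -/
theorem exists_interior_estimate (n : ℕ) {r : ℝ} (hr : 0 < r) : ∃ C : ℝ, 0 ≤ C ∧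
    ∀ (p : Cn n) (F : Cn n → ℂ), DifferentiableOn ℂ F (Metric.ball p r) →
      ‖F p‖ ^ 2 ≤ C * ∫ x in Metric.closedBall p (r / 2), ‖F x‖ ^ 2 := by
  obtain ⟨g₀, _, _, hg⟩ := exists_mollifier n
  obtain ⟨hgs, hg0, hg1, hgc, -⟩ := hg (r / 2) (by positivity)
  set g := g₀ (r / 2)
  obtain ⟨M₀, hM₀⟩ := (isCompact_closedBall (0 : Cn n) (r / 2)).exists_bound_of_continuousOn
    hgs.continuous.continuousOn
  set M := |M₀| + 1
  have hM : 0 < M := by positivity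
  set V := volume.real (Metric.closedBall (0 : Cn n) (r / 2))
  have hV : 0 < V := ENNReal.toReal_pos (Metric.measure_closedBall_pos _ _ (by positivity)).ne'
      (isCompact_closedBall _ _).measure_lt_top.ne
  refine ⟨M ^ 2 * V * 4, by positivity, fun p F hF => ?_⟩
  set B := Metric.closedBall p (r / 2)
  have hB : IsCompact B := isCompact_closedBall _ _
  have hVB : volume.real B = V := by
    simp only [V, B, Measure.real, Measure.addHaar_closedBall_center]
  have hBr : B ⊆ Metric.ball p r := Metric.closedBall_subset_ball (by linarith)
  have h1 := integral_comp_sub_mul hF (by linarith : r / 2 < r) hgs.continuous hg0 hg1 hgc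
  rw [← integral_sub_left_eq_self _ _ p] at h1
  simp only [sub_sub_cancel] at h1
  rw [← setIntegral_eq_integral_of_forall_compl_eq_zero (s := B) (fun x hx => by
    rw [hg0 (p - x), mul_zero]
    have : ¬ ‖p - x‖ ≤ r / 2 := by
      rw [← dist_eq_norm, dist_comm]
      simpa [B] using hx
    exact (not_le.1 this).le)] at h1
  have hgM : ∀ x ∈ B, ‖g (p - x)‖ ≤ M := fun x hx => by
    refine (hM₀ _ ?_).trans (by simp only [M]; linarith [le_abs_self M₀])
    rw [mem_closedBall_zero_iff, ← dist_eq_norm, dist_comm]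
    exact hx
  have hFi : IntegrableOn (fun x => ‖F x‖ ^ 2) B :=
    ((hF.continuousOn.mono hBr).norm.pow 2).integrableOn_compact hB
  set Q := ∫ x in B, ‖F x‖ ^ 2
  have hQ : 0 ≤ Q := integral_nonneg fun x => by positivity
  rcases (norm_nonneg (F p)).eq_or_lt with h0 | h0
  · rw [← h0, zero_pow two_ne_zero]; positivity
  set s := ‖F p‖ / (2 * M * V)
  have hs : 0 < s := by positivity
  have h2 := norm_setIntegral_mul_le hB hM.le hs hgM hFi
  rw [h1, hVB, mul_add] at h2
  have e1 : M * (s * V) = ‖F p‖ / 2 := by simp only [s]; field_simp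
  have e2 : M * (s⁻¹ * Q) = 2 * M ^ 2 * V * Q / ‖F p‖ := by simp only [s]; field_simp
  rw [e1, e2, ← sub_le_iff_le_add', le_div_iff₀ h0] at h2
  nlinarith

theorem cv_cv_comm (hw : LocallyIntegrable w) {g k : Cn n → ℂ} (hg : Continuous g)
    (hgc : HasCompactSupport g) (hk : Continuous k) (hkc : HasCompactSupport k) :
    cv (cv w g) k = cv (cv w k) g := by
  have key : ∀ {g k : Cn n → ℂ}, Continuous g → HasCompactSupport g → Continuous k →
      HasCompactSupport k → cv (cv w g) k = cv w (cv g k) := fun {g k} hg hgc hk hkc => by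
    funext x
    simp only [cv_eq_convolution]
    have h1 : LocallyIntegrable fun x => ‖w x‖ := fun x => (hw x).norm
    have h2 : LocallyIntegrable fun x => ‖g x‖ := hg.norm.locallyIntegrable
    have h3 : HasCompactSupport ((fun x => ‖g x‖) ⋆[ContinuousLinearMap.mul ℝ ℝ, volume]
        fun x => ‖k x‖) := HasCompactSupport.convolution _ hgc.norm hkc.norm
    have h4 : Continuous ((fun x => ‖g x‖) ⋆[ContinuousLinearMap.mul ℝ ℝ, volume]
        fun x => ‖k x‖) := hkc.norm.continuous_convolution_right _ h2 hk.norm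
    have h5 := hkc.norm.convolutionExists_right (ContinuousLinearMap.mul ℝ ℝ) h2 hk.norm
    have h6 := hgc.convolutionExists_right (ContinuousLinearMap.mul ℝ ℂ) hw hg
    have h7 := h3.convolutionExists_right (ContinuousLinearMap.mul ℝ ℝ) h1 h4 x
    exact convolution_assoc (ContinuousLinearMap.mul ℝ ℂ) (ContinuousLinearMap.mul ℝ ℂ)
      (ContinuousLinearMap.mul ℝ ℂ) (ContinuousLinearMap.mul ℝ ℂ) (fun a b c => mul_assoc a b c)
      hw.aestronglyMeasurable hg.aestronglyMeasurable hk.aestronglyMeasurable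
      (.of_forall h6) (.of_forall h5) h7
  have hsymm : cv g k = cv k g := by
    have := convolution_flip (f := k) (g := g) (L := ContinuousLinearMap.mul ℝ ℂ) (μ := volume)
    rw [ContinuousLinearMap.flip_mul] at this
    exact this
  rw [key hg hgc hk hkc, key hk hkc hg hgc, hsymm]

/-- Weyl's lemma for `∂̄`. -/
theorem exists_entire_of_weak (hwm : StronglyMeasurable w)
    (hw : ∀ R, IntegrableOn (fun x => ‖w x‖ ^ 2) (Metric.closedBall 0 R))
    (h : ∀ ζ : Cn n → ℂ, ContDiff ℝ ∞ ζ → HasCompactSupport ζ → ∀ j,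
      ∫ x, w x * wd I j ζ x = 0) : ∃ F : Cn n → ℂ, Differentiable ℂ F ∧ w =ᵐ[volume] F := by
  have hwl := locallyIntegrable_of_sq hwm hw
  obtain ⟨g, C, hC, hg⟩ := exists_mollifier n
  have hgc : ∀ ε, 0 < ε → HasCompactSupport (g ε) := fun ε hε => by
    refine HasCompactSupport.intro (isCompact_closedBall (0 : Cn n) ε) fun x hx =>
      (hg ε hε).2.1 x ?_
    rw [mem_closedBall_zero_iff, not_le] at hx
    exact hx.le
  have hent : ∀ ε, 0 < ε → Differentiable ℂ (cv w (g ε)) := fun ε hε x => by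
    have hgs := (hg ε hε).1
    refine differentiableAt_of_wd_eq_zero
      ((contDiff_cv hwl hgs (hgc ε hε)).differentiable (by simp) x) fun j => ?_
    rw [wd_cv hwl hgs (hgc ε hε)]
    have := h (fun y => g ε (x - y)) (hgs.comp (contDiff_const.sub contDiff_id))
      (hasCompactSupport_comp_sub (hgc ε hε) x) j
    simp only [wd_comp_sub (hgs.differentiable (by simp)), mul_neg, integral_neg,
      neg_eq_zero] at this
    exact this
  have hrep : ∀ F : Cn n → ℂ, Differentiable ℂ F → ∀ ε, 0 < ε → cv F (g ε) = F := fun F hF ε hε => by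
    obtain ⟨hgs, hg0, hg1, hgr, -⟩ := hg ε hε
    funext p
    rw [cv, ← integral_sub_left_eq_self _ _ p]
    simp only [sub_sub_cancel]
    exact integral_comp_sub_mul (r := ε + 1) hF.differentiableOn (by linarith) hgs.continuous
      hg0 hg1 hgr
  have hsame : ∀ ε, 0 < ε → cv w (g ε) = cv w (g 1) := fun ε hε => by
    rw [← hrep _ (hent ε hε) 1 one_pos, cv_cv_comm hwl (hg ε hε).1.continuous (hgc ε hε)
      (hg 1 one_pos).1.continuous (hgc 1 one_pos), hrep _ (hent 1 one_pos) ε hε]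
  refine ⟨cv w (g 1), hent 1 one_pos, ?_⟩
  set F := cv w (g 1)
  have hFc : Continuous F := (hent 1 one_pos).continuous
  have hz : ∀ R : ℝ, ∫⁻ x in Metric.closedBall (0 : Cn n) R, ‖F x - w x‖ₑ ^ 2 = 0 := fun R => by
    have hle : ∀ t : ℝ≥0∞, t ≠ 0 →
        ∫⁻ x in Metric.closedBall (0 : Cn n) R, ‖F x - w x‖ₑ ^ 2 ≤ ENNReal.ofReal C ^ 2 * t :=
      fun t ht => by
      obtain ⟨δ, hδ, hav⟩ := exists_average_le hwm hw R ht
      obtain ⟨hgs, hg0, hg1, -, hgb, -⟩ := hg δ hδ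
      refine hav δ hδ le_rfl C _ hC fun x _ => ?_
      rw [← hsame δ hδ, cv_sub_eq hwl hgs.continuous (hgc δ hδ) hg1]
      exact enorm_integral_increment_le hδ (fun y hy => hg0 _ hy.le) fun y => hgb _
    by_contra hne
    set A := ∫⁻ x in Metric.closedBall (0 : Cn n) R, ‖F x - w x‖ₑ ^ 2
    set c := ENNReal.ofReal C ^ 2
    have hct : c ≠ ⊤ := by simp [c]
    have hA : A ≠ ⊤ := ne_top_of_le_ne_top (by simpa using hct) (hle 1 one_ne_zero)
    have h2c : (2 * (c + 1)) ≠ ⊤ := ENNReal.mul_ne_top (by simp) (by simpa using hct)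
    have := hle (A / (2 * (c + 1))) (ENNReal.div_pos hne h2c).ne'
    have h3 : c * (A / (2 * (c + 1))) ≤ A / 2 := by
      rw [ENNReal.div_eq_inv_mul, ENNReal.mul_inv (by simp) (by simp), ENNReal.div_eq_inv_mul]
      calc c * (2⁻¹ * (c + 1)⁻¹ * A) ≤ (c + 1) * (2⁻¹ * (c + 1)⁻¹ * A) := by gcongr; simp
        _ = ((c + 1) * (c + 1)⁻¹) * (2⁻¹ * A) := by ring
        _ = 2⁻¹ * A := by
          rw [ENNReal.mul_inv_cancel (by simp) (by simpa using hct), one_mul]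
    exact absurd (this.trans h3) (not_le.2 (ENNReal.half_lt_self hne hA))
  have hae : ∀ k : ℕ, ∀ᵐ x ∂(volume.restrict (Metric.closedBall (0 : Cn n) k)), w x = F x :=
    fun k => by
    have := (lintegral_eq_zero_iff' (by
      exact ((hFc.aestronglyMeasurable.sub hwm.aestronglyMeasurable).enorm.pow_const 2))).1 (hz k)
    filter_upwards [this] with x hx
    have : F x - w x = 0 := by simpa using hx
    exact (sub_eq_zero.1 this).symm
  have hall : ∀ᵐ x : Cn n, ∀ k : ℕ, x ∈ Metric.closedBall (0 : Cn n) k → w x = F x :=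
    ae_all_iff.2 fun k => (ae_restrict_iff' measurableSet_closedBall).1 (hae k)
  filter_upwards [hall] with x hx
  obtain ⟨k, hk⟩ := exists_nat_ge ‖x‖
  exact hx k (by simpa using hk)

end Weyl

section Hormander

variable {Φ : Cn n → ℝ} {u v s : Cn n → ℂ} {c : ℝ}

theorem box_add (hu : ContDiff ℝ ∞ u) (hv : ContDiff ℝ ∞ v) (x : Cn n) :
    box Φ (fun y => u y + v y) x = box Φ u x + box Φ v x := by
  have hd : ∀ {f : Cn n → ℂ}, ContDiff ℝ ∞ f → Differentiable ℝ f := fun hf =>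
    hf.differentiable (by simp)
  simp only [box, ← neg_add, ← Finset.sum_add_distrib]
  congr 1
  refine Finset.sum_congr rfl fun j _ => ?_
  have h : wd I j (fun y => u y + v y) = fun y => wd I j u y + wd I j v y :=
    funext fun y => wd_add (hd hu y) (hd hv y)
  simp only [dl, h]
  rw [wd_add (hd (contDiff_wd hu) x) (hd (contDiff_wd hv) x)]
  ring

theorem box_const_mul (hu : ContDiff ℝ ∞ u) (a : ℂ) (x : Cn n) :
    box Φ (fun y => a * u y) x = a * box Φ u x := by
  have hd : ∀ {f : Cn n → ℂ}, ContDiff ℝ ∞ f → Differentiable ℝ f := fun hf =>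
    hf.differentiable (by simp)
  have hc : ∀ {σ : ℂ} {j : Fin n} {f : Cn n → ℂ}, ContDiff ℝ ∞ f →
      wd σ j (fun y => a * f y) = fun y => a * wd σ j f y := fun {σ j f} hf => by
    funext y
    rw [wd_mul (differentiableAt_const a) (hd hf y), wd_const]
    ring
  simp only [box, mul_neg, Finset.mul_sum]
  congr 1
  refine Finset.sum_congr rfl fun j _ => ?_
  simp only [dl, hc hu, hc (contDiff_wd (σ := I) (j := j) hu)]
  ring

theorem memLp_mul_exp_half (hΦ : Continuous Φ) (hu : Continuous u) (huc : HasCompactSupport u) :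
    MemLp (fun x => u x * (Real.exp (-Φ x / 2) : ℂ)) 2 volume := by
  refine Continuous.memLp_of_hasCompactSupport ?_ huc.mul_right
  fun_prop

/-- Images of test functions under `□_Φ`, viewed in the unweighted `L²` space. -/
noncomputable def boxRange (Φ : Cn n → ℝ) :
    Submodule ℂ (Lp ℂ 2 (volume : Measure (Cn n))) where
  carrier := {f | ∃ η : Cn n → ℂ, ContDiff ℝ ∞ η ∧ HasCompactSupport η ∧
    f =ᵐ[volume] fun x => box Φ η x * (Real.exp (-Φ x / 2) : ℂ)}
  add_mem' := by
    rintro f g ⟨η, h1, h2, h3⟩ ⟨θ, k1, k2, k3⟩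
    refine ⟨fun y => η y + θ y, h1.add k1, h2.add k2, ?_⟩
    filter_upwards [h3, k3, Lp.coeFn_add f g] with x a b d
    rw [d, Pi.add_apply, a, b, box_add h1 k1]
    ring
  zero_mem' := by
    refine ⟨fun _ => 0, contDiff_const, HasCompactSupport.zero, ?_⟩
    filter_upwards [Lp.coeFn_zero ℂ 2 (volume : Measure (Cn n))] with x hx
    have := box_const_mul (Φ := Φ) (u := fun _ : Cn n => (0 : ℂ)) contDiff_const 0 x
    simp only [mul_zero, zero_mul] at this
    rw [hx, this]
    simp
  smul_mem' := by
    rintro a f ⟨η, h1, h2, h3⟩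
    refine ⟨fun y => a * η y, contDiff_const.mul h1, h2.mul_left, ?_⟩
    filter_upwards [h3, Lp.coeFn_smul a f] with x p q
    rw [q, Pi.smul_apply, p, box_const_mul h1, smul_eq_mul, mul_assoc]

theorem norm_integral_mul_conj_box_sq_le (hΦ : ContDiff ℝ ∞ Φ) (hc : 0 < c)
    (hlev : ∀ x w, 4 * c * ‖w‖ ^ 2 ≤ leviForm Φ x w) (hs : ContDiff ℝ ∞ s)
    (hsc : HasCompactSupport s) {η : Cn n → ℂ} (hη : ContDiff ℝ ∞ η) (hηc : HasCompactSupport η) :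
    ‖∫ x, s x * conj (box Φ η x) * wt Φ x‖ ^ 2 ≤
      (c⁻¹ * ∫ x, (∑ j, ‖wd I j s x‖ ^ 2) * Real.exp (-Φ x)) *
        ∫ x, ‖box Φ η x‖ ^ 2 * Real.exp (-Φ x) := by
  have hsd : ∀ j, Continuous (wd I j s) := fun j => (contDiff_wd hs).continuous
  have hηd : ∀ j, Continuous (wd I j η) := fun j => (contDiff_wd hη).continuous
  have hsdc : ∀ j, HasCompactSupport (wd I j s) := fun j => hasCompactSupport_wd hsc
  have hηdc : ∀ j, HasCompactSupport (wd I j η) := fun j => hasCompactSupport_wd hηc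
  have hE : Continuous fun x => Real.exp (-Φ x) := hΦ.continuous.neg.rexp
  have hsq : ∀ {f : Cn n → ℂ}, HasCompactSupport f →
      HasCompactSupport fun x => ‖f x‖ ^ 2 * Real.exp (-Φ x) := fun {f} hf => by
    refine hf.mono fun x hx => ?_
    rw [Function.mem_support] at hx ⊢
    rintro h0
    simp [h0] at hx
  have hmul : ∀ {f g : Cn n → ℂ}, HasCompactSupport f →
      HasCompactSupport fun x => ‖f x‖ * ‖g x‖ * Real.exp (-Φ x) := fun {f g} hf => by
    refine hf.mono fun x hx => ?_
    rw [Function.mem_support] at hx ⊢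
    rintro h0
    simp [h0] at hx
  have iS : Integrable fun x => (∑ j, ‖wd I j s x‖ ^ 2) * Real.exp (-Φ x) := by
    simp only [Finset.sum_mul]
    refine integrable_finsetSum _ fun j _ => ?_
    exact (((hsd j).norm.pow 2).mul hE).integrable_of_hasCompactSupport
      (hsq (hsdc j))
  have iQ : Integrable fun x => (∑ j, ‖wd I j η x‖ ^ 2) * Real.exp (-Φ x) := by
    simp only [Finset.sum_mul]
    refine integrable_finsetSum _ fun j _ => ?_
    exact (((hηd j).norm.pow 2).mul hE).integrable_of_hasCompactSupport
      (hsq (hηdc j))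
  have iXj : ∀ j, Integrable fun x => ‖wd I j s x‖ * ‖wd I j η x‖ * Real.exp (-Φ x) := fun j =>
    (((hsd j).norm.mul (hηd j).norm).mul hE).integrable_of_hasCompactSupport
      (hmul (hsdc j))
  have iX : Integrable fun x => (∑ j, ‖wd I j s x‖ * ‖wd I j η x‖) * Real.exp (-Φ x) := by
    simp only [Finset.sum_mul]
    exact integrable_finsetSum _ fun j _ => iXj j
  set S := ∫ x, (∑ j, ‖wd I j s x‖ ^ 2) * Real.exp (-Φ x)
  set Q := ∫ x, (∑ j, ‖wd I j η x‖ ^ 2) * Real.exp (-Φ x)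
  set X := ∫ x, (∑ j, ‖wd I j s x‖ * ‖wd I j η x‖) * Real.exp (-Φ x) with hX
  set N := ∫ x, ‖box Φ η x‖ ^ 2 * Real.exp (-Φ x)
  have hS : 0 ≤ S := integral_nonneg fun x => by positivity
  have hQ : c * Q ≤ N := dbar_le_box hΦ hη hηc hlev
  have h1 : ‖∫ x, s x * conj (box Φ η x) * wt Φ x‖ ≤ X := by
    rw [integral_mul_conj_box hΦ hs hη (.inl hsc), hX]
    simp only [Finset.sum_mul]
    rw [integral_finsetSum _ fun j _ => iXj j]
    refine (norm_sum_le _ _).trans (Finset.sum_le_sum fun j _ => ?_)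
    refine norm_integral_le_of_norm_le (iXj j) (.of_forall fun x => le_of_eq ?_)
    simp [wt_eq_ofReal, abs_of_pos (Real.exp_pos _), -ofReal_exp]
  have h2 : ∀ t : ℝ, 0 ≤ S * (t * t) + (-2 * X) * t + Q := fun t => by
    have e : ∫ x, (∑ j, (t * ‖wd I j s x‖ - ‖wd I j η x‖) ^ 2) * Real.exp (-Φ x) =
        S * (t * t) + (-2 * X) * t + Q := by
      have e1 : ∀ x, (∑ j, (t * ‖wd I j s x‖ - ‖wd I j η x‖) ^ 2) * Real.exp (-Φ x) =
          (t * t) * ((∑ j, ‖wd I j s x‖ ^ 2) * Real.exp (-Φ x)) +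
          (-2 * t) * ((∑ j, ‖wd I j s x‖ * ‖wd I j η x‖) * Real.exp (-Φ x)) +
          (∑ j, ‖wd I j η x‖ ^ 2) * Real.exp (-Φ x) := fun x => by
        rw [← mul_assoc, ← mul_assoc, ← add_mul, ← add_mul, Finset.mul_sum, Finset.mul_sum,
          ← Finset.sum_add_distrib, ← Finset.sum_add_distrib]
        congr 1
        exact Finset.sum_congr rfl fun j _ => by ring
      simp only [e1]
      have i1 := iS.const_mul (t * t)
      have i2 := iX.const_mul (-2 * t)
      have i3 : Integrable fun x => t * t * ((∑ j, ‖wd I j s x‖ ^ 2) * Real.exp (-Φ x)) +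
          -2 * t * ((∑ j, ‖wd I j s x‖ * ‖wd I j η x‖) * Real.exp (-Φ x)) := i1.add i2
      rw [integral_add i3 iQ, integral_add i1 i2, integral_const_mul, integral_const_mul]
      ring
    rw [← e]
    exact integral_nonneg fun x => by positivity
  have h3 := discrim_le_zero h2
  rw [discrim] at h3
  calc _ ≤ X ^ 2 := by gcongr
    _ ≤ S * Q := by nlinarith
    _ = (c⁻¹ * S) * (c * Q) := by field_simp
    _ ≤ _ := by gcongr

/-- Hörmander's `L²` theorem, as an approximation statement: a test function is approximated by an
entire function with error controlled by the weighted norm of its `∂̄`. -/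
theorem exists_entire_sub_le (hΦ : ContDiff ℝ ∞ Φ) (hc : 0 < c)
    (hlev : ∀ x w, 4 * c * ‖w‖ ^ 2 ≤ leviForm Φ x w) (hs : ContDiff ℝ ∞ s)
    (hsc : HasCompactSupport s) : ∃ F : Cn n → ℂ, Differentiable ℂ F ∧
      Integrable (fun x => ‖F x - s x‖ ^ 2 * Real.exp (-Φ x)) ∧
      ∫ x, ‖F x - s x‖ ^ 2 * Real.exp (-Φ x) ≤
        c⁻¹ * ∫ x, (∑ j, ‖wd I j s x‖ ^ 2) * Real.exp (-Φ x) := by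
  have : Fact ((1 : ℝ≥0∞) ≤ 2) := ⟨by norm_num⟩
  set A := c⁻¹ * ∫ x, (∑ j, ‖wd I j s x‖ ^ 2) * Real.exp (-Φ x)
  have hA : 0 ≤ A := mul_nonneg (by positivity) (integral_nonneg fun x => by positivity)
  have hhalf : ∀ x, (Real.exp (-Φ x / 2) : ℂ) * (Real.exp (-Φ x / 2) : ℂ) = wt Φ x := fun x => by
    rw [wt_eq_ofReal, ← ofReal_mul, ← Real.exp_add]
    congr 2
    ring
  have hhalfR : ∀ x, Real.exp (-Φ x / 2) ^ 2 = Real.exp (-Φ x) := fun x => by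
    rw [← Real.exp_nat_mul]
    congr 1
    push_cast
    ring
  have hnsq : ∀ f : Lp ℂ 2 (volume : Measure (Cn n)), ‖f‖ ^ 2 = ∫ x, ‖f x‖ ^ 2 := fun f => by
    have h1 : (⟪f, f⟫_ℂ).re = ‖f‖ ^ 2 := by
      have := inner_self_eq_norm_sq (𝕜 := ℂ) f
      exact this
    rw [← h1, L2.inner_def]
    have h2 : ∀ x, ⟪f x, f x⟫_ℂ = ((‖f x‖ ^ 2 : ℝ) : ℂ) := fun x => by
      rw [inner_self_eq_norm_sq_to_K]
      norm_cast
    simp only [h2]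
    rw [integral_complex_ofReal, ofReal_re]
  have hsm := memLp_mul_exp_half hΦ.continuous hs.continuous hsc
  set S : Lp ℂ 2 (volume : Measure (Cn n)) := hsm.toLp _
  set M := (boxRange Φ).topologicalClosure
  have : CompleteSpace M := (boxRange Φ).isClosed_topologicalClosure.completeSpace_coe
  have hSb : ∀ f ∈ M, ‖⟪f, S⟫_ℂ‖ ≤ √A * ‖f‖ := fun f hf => by
    have hf' : f ∈ closure (boxRange Φ : Set (Lp ℂ 2 (volume : Measure (Cn n)))) := hf
    refine closure_minimal (t := {f | ‖⟪f, S⟫_ℂ‖ ≤ √A * ‖f‖}) ?_ ?_ hf'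
    · rintro f ⟨η, h1, h2, h3⟩
      have e1 : ⟪f, S⟫_ℂ = ∫ x, s x * conj (box Φ η x) * wt Φ x := by
        rw [L2.inner_def]
        refine integral_congr_ae ?_
        filter_upwards [h3, hsm.coeFn_toLp] with x a b
        rw [RCLike.inner_apply, a, b, map_mul, conj_ofReal, ← hhalf]
        ring
      have e2 : ‖f‖ ^ 2 = ∫ x, ‖box Φ η x‖ ^ 2 * Real.exp (-Φ x) := by
        rw [hnsq]
        refine integral_congr_ae ?_
        filter_upwards [h3] with x a
        rw [a, norm_mul, norm_real, Real.norm_of_nonneg (Real.exp_pos _).le, mul_pow, hhalfR]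
      have := norm_integral_mul_conj_box_sq_le hΦ hc hlev hs hsc h1 h2
      rw [← e1, ← e2] at this
      change ‖⟪f, S⟫_ℂ‖ ≤ √A * ‖f‖
      rw [← Real.sqrt_sq (norm_nonneg f), ← Real.sqrt_mul hA]
      exact Real.le_sqrt_of_sq_le this
    · exact isClosed_le (by fun_prop) (by fun_prop)
  set p := M.starProjection S
  have hp : p ∈ M := M.starProjection_apply_mem S
  have hort : ∀ f ∈ M, ⟪f, S - p⟫_ℂ = 0 := fun f hf => by
    rw [← inner_conj_symm, M.starProjection_inner_eq_zero S f hf, map_zero]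
  have hpn : ‖p‖ ^ 2 ≤ A := by
    have h1 : ⟪p, S⟫_ℂ = ⟪p, p⟫_ℂ := by
      have := hort p hp
      rwa [inner_sub_right, sub_eq_zero] at this
    have h2 := hSb p hp
    rw [h1, inner_self_eq_norm_sq_to_K, norm_pow, RCLike.norm_ofReal, abs_norm] at h2
    rcases (norm_nonneg p).eq_or_lt with h0 | h0
    · rw [← h0]; simpa using hA
    have h3 : ‖p‖ ≤ √A := by nlinarith
    calc ‖p‖ ^ 2 ≤ √A ^ 2 := by gcongr
      _ = A := Real.sq_sqrt hA
  set f := S - p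
  set w : Cn n → ℂ := fun x => f x * (Real.exp (Φ x / 2) : ℂ)
  have hEc : Continuous fun x => (Real.exp (Φ x / 2) : ℂ) := by
    have := hΦ.continuous
    fun_prop
  have hwm : StronglyMeasurable w := (Lp.stronglyMeasurable f).mul hEc.stronglyMeasurable
  have hwf : ∀ x, f x = w x * (Real.exp (-Φ x / 2) : ℂ) := fun x => by
    simp only [w]
    rw [mul_assoc, ← ofReal_mul, ← Real.exp_add, neg_div, add_neg_cancel]
    simp
  have hwi : Integrable fun x => ‖w x‖ ^ 2 * Real.exp (-Φ x) := by
    have := (memLp_two_iff_integrable_sq_norm (Lp.memLp f).1).1 (Lp.memLp f)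
    refine this.congr (.of_forall fun x => ?_)
    simp only [hwf x, norm_mul, norm_real, Real.norm_of_nonneg (Real.exp_pos _).le, mul_pow,
      hhalfR]
  have hnull : IsWeakNull Φ w := fun η h1 h2 => by
    have hm := memLp_mul_exp_half hΦ.continuous (contDiff_box hΦ h1).continuous
      (hasCompactSupport_box (Φ := Φ) h2)
    have := hort (hm.toLp _) ((boxRange Φ).le_topologicalClosure
      ⟨η, h1, h2, hm.coeFn_toLp⟩)
    rw [L2.inner_def] at this
    rw [← this]
    refine integral_congr_ae ?_
    filter_upwards [hm.coeFn_toLp] with x a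
    rw [RCLike.inner_apply, a, map_mul, conj_ofReal, ← hhalf, hwf x]
    ring
  obtain ⟨F, hF, hwF⟩ := exists_entire_of_weak hwm (integrableOn_sq_of_weight hΦ.continuous hwi)
    fun ζ hζ hζc j => hnull.integral_mul_wd_eq_zero hΦ hwm hwi hζ hζc j
  have hae : (fun x => ‖F x - s x‖ ^ 2 * Real.exp (-Φ x)) =ᵐ[volume] fun x => ‖p x‖ ^ 2 := by
    filter_upwards [hwF, Lp.coeFn_sub S p, hsm.coeFn_toLp] with x a b d
    have h1 : p x = -((F x - s x) * (Real.exp (-Φ x / 2) : ℂ)) := by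
      have h2 := hwf x
      rw [b, Pi.sub_apply, d, a] at h2
      linear_combination -h2
    rw [h1, norm_neg, norm_mul, norm_real, Real.norm_of_nonneg (Real.exp_pos _).le, mul_pow,
      hhalfR]
  refine ⟨F, hF, ?_, ?_⟩
  · exact ((memLp_two_iff_integrable_sq_norm (Lp.memLp p).1).1 (Lp.memLp p)).congr hae.symm
  · rw [integral_congr_ae hae, ← hnsq]
    exact hpn

end Hormander

section LeviCalculus

variable {φ ψ : Cn n → ℝ} {x w : Cn n}

theorem leviForm_congr (h : φ =ᶠ[nhds x] ψ) (w : Cn n) : leviForm φ x w = leviForm ψ x w := by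
  simp only [leviForm, (h.iteratedFDeriv ℝ 2).eq_of_nhds]

theorem eventually_differentiableAt {E F : Type*} [NormedAddCommGroup E] [NormedSpace ℝ E]
    [NormedAddCommGroup F] [NormedSpace ℝ F] {f : E → F} {x : E} (h : ContDiffAt ℝ ∞ f x) :
    ∀ᶠ y in nhds x, DifferentiableAt ℝ f y := by
  have h2 : ContDiffAt ℝ 1 f x := h.of_le (by exact_mod_cast le_top)
  filter_upwards [h2.eventually (by simp)] with y hy using hy.differentiableAt (by simp)

theorem differentiableAt_fderiv {E F : Type*} [NormedAddCommGroup E] [NormedSpace ℝ E]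
    [NormedAddCommGroup F] [NormedSpace ℝ F] {f : E → F} {x : E} (h : ContDiffAt ℝ ∞ f x) :
    DifferentiableAt ℝ (fderiv ℝ f) x :=
  (h.fderiv_right (m := ∞) (by simp)).differentiableAt (by simp)

theorem fderiv_fderiv_symm {E F : Type*} [NormedAddCommGroup E] [NormedSpace ℝ E]
    [NormedAddCommGroup F] [NormedSpace ℝ F] {f : E → F} {x : E} (h : ContDiffAt ℝ ∞ f x)
    (v w : E) : fderiv ℝ (fderiv ℝ f) x v w = fderiv ℝ (fderiv ℝ f) x w v :=
  h.isSymmSndFDerivAt (by simpa using WithTop.coe_le_coe.2 (le_top : (2 : ℕ∞) ≤ ⊤)) v w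

theorem leviForm_add (hφ : ContDiffAt ℝ ∞ φ x) (hψ : ContDiffAt ℝ ∞ ψ x) (w : Cn n) :
    leviForm (fun y => φ y + ψ y) x w = leviForm φ x w + leviForm ψ x w := by
  have e1 : fderiv ℝ (fun y => φ y + ψ y) =ᶠ[nhds x] fun y => fderiv ℝ φ y + fderiv ℝ ψ y := by
    filter_upwards [eventually_differentiableAt hφ, eventually_differentiableAt hψ] with y h1 h2
    exact fderiv_fun_add h1 h2
  simp only [leviForm_eq]
  rw [e1.fderiv_eq, fderiv_fun_add (differentiableAt_fderiv hφ) (differentiableAt_fderiv hψ)]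
  simp only [add_apply]
  ring

theorem leviForm_const_mul (hφ : ContDiffAt ℝ ∞ φ x) (c : ℝ) (w : Cn n) :
    leviForm (fun y => c * φ y) x w = c * leviForm φ x w := by
  have e1 : fderiv ℝ (fun y => c * φ y) =ᶠ[nhds x] fun y => c • fderiv ℝ φ y := by
    filter_upwards [eventually_differentiableAt hφ] with y h1
    exact fderiv_const_mul h1 c
  simp only [leviForm_eq]
  rw [e1.fderiv_eq, fderiv_fun_const_smul (differentiableAt_fderiv hφ)]
  simp only [smul_apply, smul_eq_mul]
  ring

theorem leviForm_const (c : ℝ) (x w : Cn n) : leviForm (fun _ => c) x w = 0 := by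
  simp [leviForm_eq]

theorem leviForm_sub (hφ : ContDiffAt ℝ ∞ φ x) (hψ : ContDiffAt ℝ ∞ ψ x) (w : Cn n) :
    leviForm (fun y => φ y - ψ y) x w = leviForm φ x w - leviForm ψ x w := by
  have h := leviForm_add hφ (contDiffAt_const.mul hψ : ContDiffAt ℝ ∞ (fun y => (-1) * ψ y) x) w
  rw [leviForm_const_mul hψ] at h
  simp only [neg_one_mul, ← sub_eq_add_neg] at h
  exact h

theorem leviForm_sum {ι : Type*} {s : Finset ι} {φ : ι → Cn n → ℝ}
    (h : ∀ i ∈ s, ContDiffAt ℝ ∞ (φ i) x) (w : Cn n) :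
    leviForm (fun y => ∑ i ∈ s, φ i y) x w = ∑ i ∈ s, leviForm (φ i) x w := by
  classical
  induction s using Finset.induction_on with
  | empty => simpa using leviForm_const 0 x w
  | insert a s ha ih =>
    have h1 : ∀ i ∈ s, ContDiffAt ℝ ∞ (φ i) x := fun i hi => h i (Finset.mem_insert_of_mem hi)
    simp only [Finset.sum_insert ha]
    rw [leviForm_add (h a (Finset.mem_insert_self a s)) (ContDiffAt.sum h1), ih h1]

theorem leviForm_comp {G : ℝ → ℝ} (hG : ContDiffAt ℝ ∞ G (φ x)) (hφ : ContDiffAt ℝ ∞ φ x)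
    (w : Cn n) :
    leviForm (fun y => G (φ y)) x w = deriv G (φ x) * leviForm φ x w +
      deriv (deriv G) (φ x) * ((fderiv ℝ φ x w) ^ 2 + (fderiv ℝ φ x (I • w)) ^ 2) := by
  have hφd : DifferentiableAt ℝ φ x := hφ.differentiableAt (by simp)
  have e1 : fderiv ℝ (fun y => G (φ y)) =ᶠ[nhds x] fun y => deriv G (φ y) • fderiv ℝ φ y := by
    filter_upwards [eventually_differentiableAt hφ,
      hφ.continuousAt.eventually (eventually_differentiableAt hG)] with y h1 h2
    exact (h2.hasDerivAt.comp_hasFDerivAt y h1.hasFDerivAt).fderiv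
  have hG2 : DifferentiableAt ℝ (deriv G) (φ x) :=
    (differentiableAt_fderiv hG).clm_apply (differentiableAt_const (1 : ℝ))
  have e2 := ((hG2.hasDerivAt.comp_hasFDerivAt x hφd.hasFDerivAt).smul
    (differentiableAt_fderiv hφ).hasFDerivAt).fderiv
  simp only [leviForm_eq]
  rw [e1.fderiv_eq]
  erw [e2]
  simp
  ring

theorem leviForm_real_smul (t : ℝ) (x w : Cn n) :
    leviForm φ x (t • w) = t ^ 2 * leviForm φ x w := by
  simp only [leviForm_eq, smul_comm I t w, map_smul, smul_apply, smul_eq_mul]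
  ring

theorem leviForm_zero (φ : Cn n → ℝ) (x : Cn n) : leviForm φ x 0 = 0 := by
  simp [leviForm_eq]

theorem leviForm_norm_sq (x w : Cn n) : leviForm (fun y => ‖y‖ ^ 2) x w = 4 * ‖w‖ ^ 2 := by
  have e1 : fderiv ℝ (fun y : Cn n => ‖y‖ ^ 2) = fun y => (2 : ℝ) • innerSL ℝ y := by
    funext y
    ext v
    rw [fderiv_norm_sq_apply]
    simp
  have e2 : fderiv ℝ (fun y : Cn n => (2 : ℝ) • innerSL ℝ y) x = (2 : ℝ) • innerSL ℝ :=
    ((innerSL ℝ (E := Cn n)).hasFDerivAt.const_smul (2 : ℝ)).fderiv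
  rw [leviForm_eq, e1, e2]
  have h : ∀ v : Cn n, innerSL ℝ v v = ‖v‖ ^ 2 := fun v => real_inner_self_eq_norm_sq v
  simp only [smul_apply, h, norm_smul, norm_I, one_mul, smul_eq_mul]
  ring

end LeviCalculus

section Compactness

variable {φ : Cn n → ℝ} {U Q : Set (Cn n)}

theorem continuousOn_fderiv_fderiv (hU : IsOpen U) (hφ : ContDiffOn ℝ ∞ φ U) :
    ContinuousOn (fderiv ℝ (fderiv ℝ φ)) U :=
  ((hφ.fderiv_of_isOpen hU (m := ∞) (by simp)).fderiv_of_isOpen hU (m := ∞) (by simp)).continuousOn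

theorem continuousOn_leviForm (hU : IsOpen U) (hφ : ContDiffOn ℝ ∞ φ U) :
    ContinuousOn (fun p : Cn n × Cn n => leviForm φ p.1 p.2) (U ×ˢ Set.univ) := by
  have h : ContinuousOn (fun p : Cn n × Cn n => fderiv ℝ (fderiv ℝ φ) p.1) (U ×ˢ Set.univ) :=
    (continuousOn_fderiv_fderiv hU hφ).comp continuousOn_fst fun p hp => hp.1
  simp only [leviForm_eq]
  have h1 : ContinuousOn (fun p : Cn n × Cn n => p.2) (U ×ˢ Set.univ) := continuousOn_snd
  have h2 : ContinuousOn (fun p : Cn n × Cn n => I • p.2) (U ×ˢ Set.univ) := h1.const_smul I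
  exact ((h.clm_apply h1).clm_apply h1).add ((h.clm_apply h2).clm_apply h2)

theorem exists_leviForm_le (hU : IsOpen U) (hφ : ContDiffOn ℝ ∞ φ U) (hQ : IsCompact Q)
    (hQU : Q ⊆ U) : ∃ B : ℝ, 0 ≤ B ∧ ∀ x ∈ Q, ∀ w, |leviForm φ x w| ≤ B * ‖w‖ ^ 2 := by
  obtain ⟨B, hB⟩ := hQ.exists_bound_of_continuousOn (f := fderiv ℝ (fderiv ℝ φ))
    ((continuousOn_fderiv_fderiv hU hφ).mono hQU)
  refine ⟨2 * max B 0, by positivity, fun x hx w => ?_⟩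
  have h : ∀ v : Cn n, ‖v‖ = ‖w‖ → |fderiv ℝ (fderiv ℝ φ) x v v| ≤ max B 0 * ‖w‖ ^ 2 := by
    intro v hv
    calc |fderiv ℝ (fderiv ℝ φ) x v v| ≤ ‖fderiv ℝ (fderiv ℝ φ) x‖ * ‖v‖ * ‖v‖ :=
          (fderiv ℝ (fderiv ℝ φ) x).le_opNorm₂ v v
      _ = ‖fderiv ℝ (fderiv ℝ φ) x‖ * ‖w‖ ^ 2 := by rw [hv]; ring
      _ ≤ _ := by gcongr; exact (hB x hx).trans (le_max_left _ _)
  rw [leviForm_eq]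
  have h1 := h w rfl
  have h2 := h (I • w) (by simp [norm_smul])
  have := abs_add_le (fderiv ℝ (fderiv ℝ φ) x w w) (fderiv ℝ (fderiv ℝ φ) x (I • w) (I • w))
  linarith

theorem exists_le_leviForm (hU : IsOpen U) (hφ : ContDiffOn ℝ ∞ φ U) (hQ : IsCompact Q)
    (hQU : Q ⊆ U) (hpos : ∀ x ∈ Q, ∀ w, w ≠ 0 → 0 < leviForm φ x w) :
    ∃ b : ℝ, 0 < b ∧ ∀ x ∈ Q, ∀ w, b * ‖w‖ ^ 2 ≤ leviForm φ x w := by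
  have hc : ContinuousOn (fun p : Cn n × Cn n => leviForm φ p.1 p.2)
      (Q ×ˢ Metric.sphere (0 : Cn n) 1) :=
    (continuousOn_leviForm hU hφ).mono (Set.prod_mono hQU (Set.subset_univ _))
  have hp : ∀ p ∈ Q ×ˢ Metric.sphere (0 : Cn n) 1, 0 < leviForm φ p.1 p.2 := fun p hp =>
    hpos p.1 hp.1 p.2 (by
      rintro h
      have := hp.2
      rw [h] at this
      simp at this)
  obtain ⟨b, hb, hb2⟩ := (hQ.prod (isCompact_sphere (0 : Cn n) 1)).exists_forall_le' hc hp
  refine ⟨b, hb, fun x hx w => ?_⟩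
  rcases eq_or_ne w 0 with rfl | hw
  · simp [leviForm_zero]
  · have h0 : 0 < ‖w‖ := norm_pos_iff.2 hw
    have := hb2 (x, ‖w‖⁻¹ • w) ⟨hx, by simp [norm_smul, h0.ne']⟩
    simp only [leviForm_real_smul] at this
    rw [inv_pow, inv_mul_eq_div, le_div_iff₀ (by positivity)] at this
    exact this

end Compactness

section Holomorphic

variable {f : Cn n → ℂ} {x w : Cn n}

theorem contDiff_of_differentiable (hf : Differentiable ℂ f) : ContDiff ℝ ∞ f := by
  obtain ⟨g, C, -, hg⟩ := exists_mollifier n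
  obtain ⟨h1, h2, h3, h4, -⟩ := hg 1 one_pos
  have hc : HasCompactSupport (g 1) := HasCompactSupport.of_support_subset_isCompact
    (isCompact_closedBall (0 : Cn n) 1) fun x hx => by
      by_contra h
      exact hx (h2 x (by simpa using (not_le.1 (by simpa using h)).le))
  have : f = cv f (g 1) := by
    funext p
    have e := integral_comp_sub_mul (p := p) (r := 2) (ε := 1) hf.differentiableOn (by norm_num)
      h1.continuous h2 h3 h4
    rw [← e, cv, ← integral_sub_left_eq_self _ volume p]
    simp
  rw [this]
  exact contDiff_cv hf.continuous.locallyIntegrable h1 hc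

theorem fderiv_real_smul_I (hf : DifferentiableAt ℂ f x) (w : Cn n) :
    fderiv ℝ f x (I • w) = I * fderiv ℝ f x w := by
  rw [hf.fderiv_restrictScalars ℝ]
  simp

theorem fderiv_fderiv_I_I (hf : ContDiffAt ℝ ∞ f x) (hd : ∀ᶠ y in nhds x, DifferentiableAt ℂ f y)
    (w : Cn n) : fderiv ℝ (fderiv ℝ f) x (I • w) (I • w) = - fderiv ℝ (fderiv ℝ f) x w w := by
  have key : ∀ v, fderiv ℝ (fderiv ℝ f) x v (I • w) = I * fderiv ℝ (fderiv ℝ f) x v w := by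
    intro v
    have e : (fun y => fderiv ℝ f y (I • w)) =ᶠ[nhds x] fun y => I * fderiv ℝ f y w := by
      filter_upwards [hd] with y hy using fderiv_real_smul_I hy w
    have h2 := (differentiableAt_fderiv hf).hasFDerivAt
    have e1 := (h2.clm_apply (hasFDerivAt_const (I • w) x)).fderiv
    have e2 := ((h2.clm_apply (hasFDerivAt_const w x)).const_mul I).fderiv
    rw [e.fderiv_eq, e2] at e1
    have := congrArg (fun T => T v) e1
    simpa using this.symm
  rw [key, fderiv_fderiv_symm hf, key, ← mul_assoc, I_mul_I, neg_one_mul]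

theorem contDiffAt_re (hf : ContDiffAt ℝ ∞ f x) : ContDiffAt ℝ ∞ (fun y => (f y).re) x :=
  (reCLM.contDiff.contDiffAt).comp x hf

theorem contDiffAt_im (hf : ContDiffAt ℝ ∞ f x) : ContDiffAt ℝ ∞ (fun y => (f y).im) x :=
  (imCLM.contDiff.contDiffAt).comp x hf

theorem leviForm_clm (hf : ContDiffAt ℝ ∞ f x) (hd : ∀ᶠ y in nhds x, DifferentiableAt ℂ f y)
    (ℓ : ℂ →L[ℝ] ℝ) (w : Cn n) : leviForm (fun y => ℓ (f y)) x w = 0 := by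
  have e1 : fderiv ℝ (fun y => ℓ (f y)) =ᶠ[nhds x] fun y => ℓ ∘L fderiv ℝ f y := by
    filter_upwards [eventually_differentiableAt hf] with y hy
    exact (ℓ.hasFDerivAt.comp y hy.hasFDerivAt).fderiv
  have e2 : HasFDerivAt (fun y => ℓ ∘L fderiv ℝ f y)
      ((ContinuousLinearMap.compL ℝ (Cn n) ℂ ℝ ℓ) ∘L fderiv ℝ (fderiv ℝ f) x) x :=
    ((ContinuousLinearMap.compL ℝ (Cn n) ℂ ℝ ℓ).hasFDerivAt
      (x := fderiv ℝ f x)).comp x (differentiableAt_fderiv hf).hasFDerivAt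
  rw [leviForm_eq, e1.fderiv_eq, e2.fderiv]
  simp [fderiv_fderiv_I_I hf hd]

theorem leviForm_comp_normSq {G : ℝ → ℝ} (hG : ContDiff ℝ ∞ G) (hf : Differentiable ℂ f)
    (x w : Cn n) : leviForm (fun y => G (‖f y‖ ^ 2)) x w =
      4 * ‖fderiv ℝ f x w‖ ^ 2 *
        (deriv G (‖f x‖ ^ 2) + ‖f x‖ ^ 2 * deriv (deriv G) (‖f x‖ ^ 2)) := by
  have hs := contDiff_of_differentiable hf
  have hfx := (hs.differentiable (by simp)) x
  have hq : ∀ y, ‖f y‖ ^ 2 = (f y).re ^ 2 + (f y).im ^ 2 := fun y => by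
    rw [← normSq_eq_norm_sq, normSq_apply]; ring
  have hre := contDiffAt_re (hs.contDiffAt (x := x))
  have him := contDiffAt_im (hs.contDiffAt (x := x))
  have dre : ∀ v, fderiv ℝ (fun y => (f y).re) x v = (fderiv ℝ f x v).re := fun v => by
    rw [show fderiv ℝ (fun y => (f y).re) x = reCLM ∘L fderiv ℝ f x from
      (reCLM.hasFDerivAt.comp x hfx.hasFDerivAt).fderiv]; rfl
  have dim : ∀ v, fderiv ℝ (fun y => (f y).im) x v = (fderiv ℝ f x v).im := fun v => by
    rw [show fderiv ℝ (fun y => (f y).im) x = imCLM ∘L fderiv ℝ f x from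
      (imCLM.hasFDerivAt.comp x hfx.hasFDerivAt).fderiv]; rfl
  have hsq : ContDiff ℝ ∞ (fun t : ℝ => t ^ 2) := contDiff_id.pow 2
  have d1 : deriv (fun t : ℝ => t ^ 2) = fun t => 2 * t := by
    funext t; simp
  have d2 : ∀ t : ℝ, deriv (deriv (fun t : ℝ => t ^ 2)) t = 2 := fun t => by
    rw [d1]; simp
  have hall : ∀ᶠ y in nhds x, DifferentiableAt ℂ f y := .of_forall fun y => hf y
  have l1 := leviForm_comp hsq.contDiffAt hre w
  have l2 := leviForm_comp hsq.contDiffAt him w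
  rw [show leviForm (fun y => (f y).re) x w = 0 from leviForm_clm hs.contDiffAt hall reCLM w,
    dre, dre, d2, fderiv_real_smul_I (hf x)] at l1
  rw [show leviForm (fun y => (f y).im) x w = 0 from leviForm_clm hs.contDiffAt hall imCLM w,
    dim, dim, d2, fderiv_real_smul_I (hf x)] at l2
  have l3 := leviForm_add (hre.pow 2) (him.pow 2) w
  rw [l1, l2] at l3
  have hqs : ContDiffAt ℝ ∞ (fun y => (f y).re ^ 2 + (f y).im ^ 2) x := (hre.pow 2).add (him.pow 2)
  have dq : ∀ v, fderiv ℝ (fun y => (f y).re ^ 2 + (f y).im ^ 2) x v =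
      2 * ((f x).re * (fderiv ℝ f x v).re + (f x).im * (fderiv ℝ f x v).im) := by
    intro v
    have h1 := (hre.differentiableAt (by simp)).hasFDerivAt
    have h2 := (him.differentiableAt (by simp)).hasFDerivAt
    have h3 := congrArg (fun T => T v) ((h1.pow 2).add (h2.pow 2)).fderiv
    simp only [add_apply, smul_apply, dre, dim] at h3
    refine h3.trans ?_
    simp
    ring
  simp only [hq]
  rw [leviForm_comp hG.contDiffAt hqs, l3, dq, dq, fderiv_real_smul_I (hf x)]
  simp only [← normSq_eq_norm_sq, normSq_apply, mul_re, mul_im, I_re, I_im]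
  ring

end Holomorphic

section Ramp

/-- A smooth convex function vanishing on `(-∞, 0]` and of slope one on `[1, ∞)`. -/
noncomputable def ramp (s : ℝ) : ℝ := ∫ t in (0 : ℝ)..s, Real.smoothTransition t

theorem hasDerivAt_ramp (s : ℝ) : HasDerivAt ramp (Real.smoothTransition s) s :=
  intervalIntegral.integral_hasDerivAt_right (Real.smoothTransition.continuous.intervalIntegrable _ _)
    Real.smoothTransition.continuous.stronglyMeasurable.stronglyMeasurableAtFilter
    Real.smoothTransition.continuous.continuousAt

theorem deriv_ramp : deriv ramp = Real.smoothTransition := funext fun s => (hasDerivAt_ramp s).deriv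

theorem contDiff_ramp : ContDiff ℝ ∞ ramp := by
  rw [contDiff_infty_iff_deriv]
  refine ⟨fun s => (hasDerivAt_ramp s).differentiableAt, ?_⟩
  rw [deriv_ramp]
  exact Real.smoothTransition.contDiff

theorem ramp_monotone : Monotone ramp := monotone_of_deriv_nonneg
  (fun s => (hasDerivAt_ramp s).differentiableAt) fun s => by
    rw [deriv_ramp]; exact Real.smoothTransition.nonneg s

theorem ramp_of_nonpos {s : ℝ} (hs : s ≤ 0) : ramp s = 0 := by
  rw [ramp, intervalIntegral.integral_symm, neg_eq_zero]
  rw [intervalIntegral.integral_congr (g := fun _ => (0 : ℝ))]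
  · simp
  · intro t ht
    rw [Set.uIcc_of_le hs] at ht
    exact Real.smoothTransition.zero_of_nonpos ht.2

theorem ramp_nonneg (s : ℝ) : 0 ≤ ramp s := by
  rcases le_total s 0 with h | h
  · rw [ramp_of_nonpos h]
  · rw [← ramp_of_nonpos le_rfl]; exact ramp_monotone h

theorem ramp_pos {s : ℝ} (hs : 0 < s) : 0 < ramp s := by
  have h : StrictMonoOn ramp (Set.Ici 0) := by
    refine strictMonoOn_of_deriv_pos (convex_Ici 0)
      (contDiff_ramp.continuous.continuousOn) fun t ht => ?_
    rw [interior_Ici] at ht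
    rw [deriv_ramp]
    exact Real.smoothTransition.pos_of_pos ht
  simpa [ramp_of_nonpos le_rfl] using h (Set.self_mem_Ici) hs.le hs

theorem deriv_deriv_ramp_nonneg (s : ℝ) : 0 ≤ deriv (deriv ramp) s := by
  rw [deriv_ramp]
  exact Real.smoothTransition.monotone.deriv_nonneg

theorem deriv_deriv_ramp_of_one_lt {s : ℝ} (hs : 1 < s) : deriv (deriv ramp) s = 0 := by
  have : Real.smoothTransition =ᶠ[nhds s] fun _ => 1 := by
    filter_upwards [lt_mem_nhds hs] with t ht using Real.smoothTransition.one_of_one_le ht.le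
  rw [deriv_ramp, this.deriv_eq, deriv_const]

theorem exists_deriv_deriv_ramp_pos : ∃ s, 0 < s ∧ s < 1 ∧ 0 < deriv (deriv ramp) s := by
  obtain ⟨s, hs, h⟩ := exists_deriv_eq_slope Real.smoothTransition zero_lt_one
    Real.smoothTransition.continuous.continuousOn
    ((Real.smoothTransition.contDiff (n := 1)).differentiable (by simp)).differentiableOn
  refine ⟨s, hs.1, hs.2, ?_⟩
  rw [deriv_ramp, h, Real.smoothTransition.one, Real.smoothTransition.zero]
  norm_num

/-- The composition of `ramp` with the logarithm. -/
noncomputable def logRamp (t : ℝ) : ℝ := ramp (Real.log t)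

theorem contDiff_logRamp : ContDiff ℝ ∞ logRamp := by
  rw [contDiff_iff_contDiffAt]
  intro t
  rcases eq_or_ne t 0 with rfl | ht
  · have : logRamp =ᶠ[nhds 0] fun _ => 0 := by
      filter_upwards [Metric.ball_mem_nhds (0 : ℝ) one_pos] with t ht
      rw [logRamp, ← Real.log_abs]
      refine ramp_of_nonpos (Real.log_nonpos (abs_nonneg t) ?_)
      simpa using (mem_ball_zero_iff.1 ht).le
    exact contDiffAt_const.congr_of_eventuallyEq this
  · exact contDiff_ramp.contDiffAt.comp t (Real.contDiffAt_log.2 ht)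

theorem deriv_logRamp_add {t : ℝ} (ht : 0 < t) :
    deriv logRamp t + t * deriv (deriv logRamp) t = deriv (deriv ramp) (Real.log t) / t := by
  have h1 : ∀ u, 0 < u → HasDerivAt logRamp (deriv ramp (Real.log u) * u⁻¹) u := fun u hu => by
    rw [deriv_ramp]
    exact (hasDerivAt_ramp _).comp u (Real.hasDerivAt_log hu.ne')
  have h2 : deriv logRamp =ᶠ[nhds t] fun u => deriv ramp (Real.log u) * u⁻¹ := by
    filter_upwards [lt_mem_nhds ht] with u hu using (h1 u hu).deriv
  have h3 : DifferentiableAt ℝ (deriv ramp) (Real.log t) := by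
    rw [deriv_ramp]
    exact (Real.smoothTransition.contDiff (n := 1)).differentiable (by simp) _
  have h4 := ((h3.hasDerivAt.comp t (Real.hasDerivAt_log ht.ne')).mul (hasDerivAt_inv ht.ne')).deriv
  rw [h2.deriv_eq, (h1 t ht).deriv]
  erw [h4]
  simp only [Function.comp]
  field_simp
  ring

theorem leviForm_logRamp {f : Cn n → ℂ} (hf : Differentiable ℂ f) {x : Cn n} (hx : f x ≠ 0)
    (w : Cn n) : leviForm (fun y => logRamp (‖f y‖ ^ 2)) x w =
      4 * ‖fderiv ℝ f x w‖ ^ 2 * (deriv (deriv ramp) (Real.log (‖f x‖ ^ 2)) / ‖f x‖ ^ 2) := by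
  have h : 0 < ‖f x‖ ^ 2 := by positivity
  rw [leviForm_comp_normSq contDiff_logRamp hf, deriv_logRamp_add h]

theorem leviForm_logRamp_nonneg {f : Cn n → ℂ} (hf : Differentiable ℂ f) (x w : Cn n) :
    0 ≤ leviForm (fun y => logRamp (‖f y‖ ^ 2)) x w := by
  rcases eq_or_ne (f x) 0 with hx | hx
  · have : (fun y => logRamp (‖f y‖ ^ 2)) =ᶠ[nhds x] fun _ => 0 := by
      have hc : ContinuousAt (fun y => ‖f y‖ ^ 2) x := (hf.continuous.norm.pow 2).continuousAt
      filter_upwards [hc.eventually (gt_mem_nhds (show ‖f x‖ ^ 2 < 1 by simp [hx]))] with y hy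
      exact ramp_of_nonpos (Real.log_nonpos (by positivity) hy.le)
    rw [leviForm_congr this, leviForm_const]
  · rw [leviForm_logRamp hf hx]
    have := deriv_deriv_ramp_nonneg (Real.log (‖f x‖ ^ 2))
    positivity

theorem contDiff_logRamp_norm_sq {f : Cn n → ℂ} (hf : Differentiable ℂ f) :
    ContDiff ℝ ∞ (fun y => logRamp (‖f y‖ ^ 2)) :=
  contDiff_logRamp.comp ((contDiff_of_differentiable hf).norm_sq ℝ)

end Ramp

section PeakPotential

variable {K : Set (Cn n)} {a : Cn n}

/-- A plurisubharmonic function which is strictly plurisubharmonic near `a` and pluriharmonic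
near `K`. -/
theorem exists_potential (hK : IsCompact K) {f : Cn n → ℂ} (hf : Differentiable ℂ f)
    (hfa : f a = 0) (hfK : ∀ z ∈ K, f z ≠ 0) :
    ∃ σ : Cn n → ℝ, ContDiff ℝ ∞ σ ∧ (∀ x w, 0 ≤ leviForm σ x w) ∧
      (∃ N : Set (Cn n), IsOpen N ∧ K ⊆ N ∧ ∀ x ∈ N, ∀ w, leviForm σ x w = 0) ∧
      ∃ b : ℝ, 0 < b ∧ ∃ N : Set (Cn n), IsOpen N ∧ a ∈ N ∧
        ∀ x ∈ N, ∀ w, b * ‖w‖ ^ 2 ≤ leviForm σ x w := by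
  obtain ⟨s, hs0, hs1, hs⟩ := exists_deriv_deriv_ramp_pos
  have hfc := hf.continuous
  set c : ℝ := Real.exp (s / 2) with hc
  have hc0 : 0 < c := Real.exp_pos _
  have hlogc : Real.log (c ^ 2) = s := by
    rw [hc, ← Real.exp_nat_mul, Real.log_exp]; push_cast; ring
  have hc2 : c ^ 2 < 4 := by
    rw [← Real.exp_log (show 0 < c ^ 2 by positivity), hlogc]
    have := Real.exp_one_lt_d9
    have := Real.exp_lt_exp.2 hs1
    linarith
  obtain ⟨m, hm, hmK⟩ : ∃ m : ℝ, 0 < m ∧ ∀ z ∈ K, m ≤ ‖f z‖ :=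
    hK.exists_forall_le' hfc.norm.continuousOn fun z hz => norm_pos_iff.2 (hfK z hz)
  obtain ⟨B, hB⟩ := hK.exists_bound_of_continuousOn (f := fun z => z - a) (by fun_prop)
  set A : ℝ := (max B 0 + 4 + c) / m with hA
  set v : Option (Fin n) → Cn n → ℂ := fun o z => match o with
    | none => 0
    | some k => z k - a k with hv
  have hvd : ∀ o, Differentiable ℂ (v o) := by
    rintro (_ | k)
    · exact differentiable_const 0
    · exact ((EuclideanSpace.proj k : Cn n →L[ℂ] ℂ).differentiable).sub_const _
  have hvn : ∀ o z, ‖v o z‖ ≤ ‖z - a‖ := by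
    rintro (_ | k) z
    · simp [hv]
    · simpa [hv] using PiLp.norm_apply_le (z - a) k
  have hva : ∀ o, v o a = 0 := by rintro (_ | k) <;> simp [hv]
  set F : Option (Fin n) → Cn n → ℂ := fun o z => A * f z + c + v o z with hF
  have hFd : ∀ o, Differentiable ℂ (F o) := fun o => ((hf.const_mul _).add_const _).add (hvd o)
  have hFK : ∀ o, ∀ z ∈ K, 4 ≤ ‖F o z‖ := by
    intro o z hz
    have h1 : max B 0 + 4 + c ≤ ‖(A : ℂ) * f z‖ := by
      rw [norm_mul, norm_real, Real.norm_of_nonneg (by positivity), hA, div_mul_eq_mul_div,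
        le_div_iff₀ hm]
      exact mul_le_mul_of_nonneg_left (hmK z hz) (by positivity)
    have h2 : ‖v o z‖ ≤ max B 0 := (hvn o z).trans ((hB z hz).trans (le_max_left _ _))
    have h3 : ‖(A : ℂ) * f z‖ ≤ ‖F o z‖ + ‖(c : ℂ)‖ + ‖v o z‖ := by
      have : (A : ℂ) * f z = F o z - c - v o z := by simp only [hF]; ring
      rw [this]
      exact (norm_sub_le _ _).trans (by gcongr; exact norm_sub_le _ _)
    rw [norm_real, Real.norm_of_nonneg hc0.le] at h3
    linarith
  have hFa : ∀ o, F o a = c := fun o => by simp [hF, hfa, hva]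
  set σ : Cn n → ℝ := fun y => ∑ o, logRamp (‖F o y‖ ^ 2) with hσ
  have hσs : ContDiff ℝ ∞ σ := ContDiff.sum fun o _ => contDiff_logRamp_norm_sq (hFd o)
  have hlev : ∀ x w, leviForm σ x w = ∑ o, leviForm (fun y => logRamp (‖F o y‖ ^ 2)) x w :=
    fun x w => leviForm_sum (fun o _ => (contDiff_logRamp_norm_sq (hFd o)).contDiffAt) w
  have hnn : ∀ x w, 0 ≤ leviForm σ x w := fun x w => by
    rw [hlev]
    exact Finset.sum_nonneg fun o _ => leviForm_logRamp_nonneg (hFd o) x w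
  refine ⟨σ, hσs, hnn, ⟨{z | ∀ o, 3 < ‖F o z‖}, ?_, fun z hz o => ?_, fun x hx w => ?_⟩, ?_⟩
  · simp only [Set.ofPred_forall]
    exact isOpen_iInter_of_finite fun o => isOpen_lt continuous_const (hFd o).continuous.norm
  · linarith [hFK o z hz]
  · rw [hlev]
    refine Finset.sum_eq_zero fun o _ => ?_
    have h3 : 3 < ‖F o x‖ := hx o
    rw [leviForm_logRamp (hFd o) (norm_pos_iff.1 (by linarith)), deriv_deriv_ramp_of_one_lt]
    · simp
    · rw [Real.lt_log_iff_exp_lt (by positivity)]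
      have := Real.exp_one_lt_d9
      nlinarith
  · have hpos : ∀ w, w ≠ 0 → 0 < leviForm σ a w := by
      intro w hw
      refine lt_of_le_of_ne (hnn a w) fun h0 => hw ?_
      have hz : ∀ o, fderiv ℝ (F o) a w = 0 := by
        intro o
        have h1 := (Finset.sum_eq_zero_iff_of_nonneg fun o _ =>
          leviForm_logRamp_nonneg (hFd o) a w).1 ((hlev a w).symm.trans h0.symm) o (Finset.mem_univ o)
        rw [leviForm_logRamp (hFd o) (by rw [hFa]; exact_mod_cast hc0.ne'), hFa, norm_real,
          Real.norm_of_nonneg hc0.le, hlogc] at h1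
        have h2 : deriv (deriv ramp) s / c ^ 2 ≠ 0 := by positivity
        simpa [h2] using h1
      ext k
      have hk : F (some k) = fun z => F none z + (z k - a k) := by
        funext z; simp [hF, hv]
      have h1 := hz (some k)
      have h2 : HasFDerivAt (fun z : Cn n => z k - a k)
          ((EuclideanSpace.proj k : Cn n →L[ℂ] ℂ).restrictScalars ℝ) a :=
        ((EuclideanSpace.proj k : Cn n →L[ℂ] ℂ).restrictScalars ℝ).hasFDerivAt.sub_const _
      have h3 : HasFDerivAt (F none) (fderiv ℝ (F none) a) a :=
        (((contDiff_of_differentiable (hFd none)).differentiable (by simp)) a).hasFDerivAt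
      have h4 := congrArg (fun T => T w) (h3.add h2).fderiv
      rw [hk] at h1
      have h5 := h4.symm.trans h1
      simpa [hz none] using h5
    obtain ⟨b, hb, hbl⟩ := exists_le_leviForm isOpen_univ hσs.contDiffOn
      (isCompact_singleton (x := a)) (Set.subset_univ _) (fun x hx => by
        rw [Set.mem_singleton_iff.1 hx]; exact hpos)
    have hlc : Continuous (fderiv ℝ (fderiv ℝ σ)) := continuousOn_univ.1
      (continuousOn_fderiv_fderiv isOpen_univ hσs.contDiffOn)
    refine ⟨b / 2, by positivity,
      fderiv ℝ (fderiv ℝ σ) ⁻¹' Metric.ball (fderiv ℝ (fderiv ℝ σ) a) (b / 4),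
      Metric.isOpen_ball.preimage hlc, ?_, fun x hx w => ?_⟩
    · simpa using hb
    have hx2 : ‖fderiv ℝ (fderiv ℝ σ) x - fderiv ℝ (fderiv ℝ σ) a‖ < b / 4 := by
      have h := Metric.mem_ball.1 hx
      exact lt_of_eq_of_lt (dist_eq_norm (E := Cn n →L[ℝ] Cn n →L[ℝ] ℝ) _ _).symm h
    have h1 := hbl a rfl w
    have h2 : ∀ v : Cn n, ‖v‖ = ‖w‖ → fderiv ℝ (fderiv ℝ σ) a v v - b / 4 * ‖w‖ ^ 2
        ≤ fderiv ℝ (fderiv ℝ σ) x v v := by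
      intro v hv
      have h3 := (fderiv ℝ (fderiv ℝ σ) x - fderiv ℝ (fderiv ℝ σ) a).le_opNorm₂ v v
      have h4 : ‖fderiv ℝ (fderiv ℝ σ) x - fderiv ℝ (fderiv ℝ σ) a‖ * ‖v‖ * ‖v‖ ≤ b / 4 * ‖w‖ ^ 2 := by
        rw [hv, mul_assoc, ← sq]
        exact mul_le_mul_of_nonneg_right hx2.le (by positivity)
      have h5 := (abs_le.1 (h3.trans h4)).1
      simp only [sub_apply] at h5
      linarith
    have h3 := h2 w rfl
    have h4 := h2 (I • w) (by simp [norm_smul])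
    rw [leviForm_eq] at h1 ⊢
    linarith

end PeakPotential

section Bump

theorem exists_bump {K U : Set (Cn n)} (hK : IsCompact K) (hU : IsOpen U) (hKU : K ⊆ U) :
    ∃ χ : Cn n → ℝ, ContDiff ℝ ∞ χ ∧ HasCompactSupport χ ∧ tsupport χ ⊆ U ∧
      (∀ x, 0 ≤ χ x) ∧ (∀ x, χ x ≤ 1) ∧ ∃ N : Set (Cn n), IsOpen N ∧ K ⊆ N ∧ ∀ x ∈ N, χ x = 1 := by
  obtain ⟨K₁, hK₁, h1, h2⟩ := exists_compact_between hK hU hKU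
  obtain ⟨K₂, hK₂, h3, h4⟩ := exists_compact_between hK₁ hU h2
  obtain ⟨χ, hχ, hr, hs, ho⟩ := exists_contMDiff_support_eq_eq_one_iff
    (modelWithCornersSelf ℝ (Cn n)) (n := ⊤) isOpen_interior hK₁.isClosed h3
  have hts : tsupport χ ⊆ K₂ := by
    rw [tsupport, hs]
    exact closure_minimal interior_subset hK₂.isClosed
  exact ⟨χ, hχ.contDiff, hK₂.of_isClosed_subset (isClosed_tsupport _) hts, hts.trans h4,
    fun x => (hr (Set.mem_range_self x)).1, fun x => (hr (Set.mem_range_self x)).2,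
    interior K₁, isOpen_interior, h1, fun x hx => (ho x).1 (interior_subset hx)⟩

theorem contDiff_mul_of_tsupport_subset {F : Type*} [NormedAddCommGroup F] [NormedSpace ℝ F]
    {U : Set (Cn n)} (hU : IsOpen U) {χ : Cn n → ℝ} (hχ : ContDiff ℝ ∞ χ)
    (hχU : tsupport χ ⊆ U) {φ : Cn n → F} (hφ : ContDiffOn ℝ ∞ φ U) :
    ContDiff ℝ ∞ (fun z => χ z • φ z) := by
  rw [contDiff_iff_contDiffAt]
  intro x
  by_cases hx : x ∈ tsupport χ
  · exact hχ.contDiffAt.smul (hφ.contDiffAt (hU.mem_nhds (hχU hx)))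
  · refine (contDiffAt_const (c := (0 : F))).congr_of_eventuallyEq ?_
    filter_upwards [notMem_tsupport_iff_eventuallyEq.1 hx] with y hy
    simp [hy]

end Bump

section Forward

theorem contDiff_ramp_norm_sq_sub (c : ℝ) : ContDiff ℝ ∞ (fun z : Cn n => ramp (‖z‖ ^ 2 - c)) :=
  contDiff_ramp.comp ((contDiff_id.norm_sq ℝ).sub contDiff_const)

theorem leviForm_ramp_norm_sq_sub (c : ℝ) (x w : Cn n) :
    4 * Real.smoothTransition (‖x‖ ^ 2 - c) * ‖w‖ ^ 2 ≤
      leviForm (fun z : Cn n => ramp (‖z‖ ^ 2 - c)) x w := by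
  have h0 : ContDiff ℝ ∞ (fun z : Cn n => ‖z‖ ^ 2) := contDiff_id.norm_sq ℝ
  have h1 : leviForm (fun z : Cn n => ‖z‖ ^ 2 - c) x w = 4 * ‖w‖ ^ 2 := by
    rw [leviForm_sub h0.contDiffAt contDiffAt_const, leviForm_norm_sq, leviForm_const, sub_zero]
  have h2 : ContDiff ℝ ∞ (fun z : Cn n => ‖z‖ ^ 2 - c) := h0.sub contDiff_const
  rw [leviForm_comp contDiff_ramp.contDiffAt h2.contDiffAt, h1, deriv_ramp]
  have h3 := deriv_deriv_ramp_nonneg (‖x‖ ^ 2 - c)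
  rw [deriv_ramp] at h3
  have h4 := mul_nonneg h3 (add_nonneg (sq_nonneg (fderiv ℝ (fun z : Cn n => ‖z‖ ^ 2 - c) x w))
    (sq_nonneg (fderiv ℝ (fun z : Cn n => ‖z‖ ^ 2 - c) x (I • w))))
  linarith

theorem exists_extension_of_principalConvex {U K : Set (Cn n)} {φ : Cn n → ℝ} (hU : IsOpen U)
    (hφ : ContDiffOn ℝ ∞ φ U) (hpos : ∀ x ∈ U, ∀ w, w ≠ 0 → 0 < leviForm φ x w)
    (hKU : K ⊆ U) (hK : IsCompact K) (hconv : PrincipalConvex K) :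
    ∃ ψ : Cn n → ℝ, ContDiff ℝ ∞ ψ ∧ (∀ x w, w ≠ 0 → 0 < leviForm ψ x w) ∧
      ∃ V : Set (Cn n), IsOpen V ∧ K ⊆ V ∧ V ⊆ U ∧
        ∀ x ∈ V, ∀ w, leviForm (fun z => ψ z - φ z) x w = 0 := by
  classical
  obtain ⟨R, hR, hKR⟩ := hK.isBounded.subset_ball_lt 0 0
  obtain ⟨χ, hχ, hχc, hχU, -, -, N, hN, hKN, hχN⟩ := exists_bump hK
    (hU.inter Metric.isOpen_ball) (Set.subset_inter hKU hKR)
  have hNU : N ⊆ U ∩ Metric.ball 0 R := fun x hx =>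
    hχU (subset_tsupport χ (by simp [hχN x hx]))
  have hpot : ∀ a : Cn n, ∃ (σ : Cn n → ℝ) (M M' : Set (Cn n)), ContDiff ℝ ∞ σ ∧
      (∀ x w, 0 ≤ leviForm σ x w) ∧ IsOpen M' ∧ K ⊆ M' ∧ (∀ x ∈ M', ∀ w, leviForm σ x w = 0) ∧
      IsOpen M ∧ (a ∉ K → a ∈ M) ∧ ∀ x ∈ M, ∀ w, w ≠ 0 → 0 < leviForm σ x w := by
    intro a
    by_cases ha : a ∈ K
    · exact ⟨fun _ => 0, ∅, Set.univ, contDiff_const, fun x w => (leviForm_const 0 x w).ge,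
        isOpen_univ, Set.subset_univ _, fun x _ w => leviForm_const 0 x w, isOpen_empty,
        fun h => absurd ha h, fun x hx => absurd hx (Set.notMem_empty x)⟩
    · obtain ⟨f, hf, hfa, hfK⟩ := hconv a ha
      obtain ⟨σ, h1, h2, ⟨M', h3, h4, h5⟩, b, hb, M, h6, h7, h8⟩ := exists_potential hK hf hfa hfK
      refine ⟨σ, M, M', h1, h2, h3, h4, h5, h6, fun _ => h7, fun x hx w hw => ?_⟩
      have := norm_pos_iff.2 hw
      exact lt_of_lt_of_le (by positivity) (h8 x hx w)
  choose σ M M' hσ hσ0 hM'o hKM' hM' hMo haM hM using hpot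
  set Q : Set (Cn n) := Metric.closedBall 0 (R + 1) \ N with hQ
  have hQc : IsCompact Q := (isCompact_closedBall _ _).diff hN
  obtain ⟨t, ht, hQt⟩ := hQc.elim_nhds_subcover M fun a ha =>
    (hMo a).mem_nhds (haM a fun h => ha.2 (hKN h))
  set S : Cn n → ℝ := fun y => ∑ a ∈ t, σ a y with hS
  have hSs : ContDiff ℝ ∞ S := ContDiff.sum fun a _ => hσ a
  have hlS : ∀ x w, leviForm S x w = ∑ a ∈ t, leviForm (σ a) x w := fun x w =>
    leviForm_sum (fun a _ => (hσ a).contDiffAt) w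
  have hS0 : ∀ x w, 0 ≤ leviForm S x w := fun x w => by
    rw [hlS]; exact Finset.sum_nonneg fun a _ => hσ0 a x w
  obtain ⟨b, hb, hbQ⟩ := exists_le_leviForm isOpen_univ hSs.contDiffOn hQc (Set.subset_univ _)
    (fun x hx w hw => by
      rw [hlS]
      obtain ⟨a, ha, hxa⟩ := Set.mem_iUnion₂.1 (hQt hx)
      exact Finset.sum_pos' (fun a _ => hσ0 a x w) ⟨a, ha, hM a x hxa w hw⟩)
  set P : Cn n → ℝ := fun z => χ z * φ z with hP
  have hPs : ContDiff ℝ ∞ P :=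
    contDiff_mul_of_tsupport_subset hU hχ (fun x hx => (hχU hx).1) hφ
  obtain ⟨B, hB, hBl⟩ := exists_leviForm_le isOpen_univ hPs.contDiffOn
    (isCompact_closedBall (0 : Cn n) (R + 1)) (Set.subset_univ _)
  set C : ℝ := (B + 1) / b with hC
  set T : Cn n → ℝ := fun z => ramp (‖z‖ ^ 2 - R ^ 2) with hT
  have hTs : ContDiff ℝ ∞ T := contDiff_ramp_norm_sq_sub _
  have hCS : ContDiff ℝ ∞ (fun z => C * S z) := contDiff_const.mul hSs
  have hlev : ∀ x w, leviForm (fun z => P z + (C * S z + T z)) x w =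
      leviForm P x w + (C * leviForm S x w + leviForm T x w) := fun x w => by
    rw [leviForm_add hPs.contDiffAt (hCS.add hTs).contDiffAt,
      leviForm_add hCS.contDiffAt hTs.contDiffAt, leviForm_const_mul hSs.contDiffAt]
  have hT0 : ∀ x w, 0 ≤ leviForm T x w := fun x w =>
    le_trans (by have := Real.smoothTransition.nonneg (‖x‖ ^ 2 - R ^ 2); positivity)
      (leviForm_ramp_norm_sq_sub (R ^ 2) x w)
  have hPN : ∀ x ∈ N, P =ᶠ[nhds x] φ := fun x hx => by
    filter_upwards [hN.mem_nhds hx] with y hy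
    simp [hP, hχN y hy]
  refine ⟨fun z => P z + (C * S z + T z), hPs.add (hCS.add hTs), fun x w hw => ?_,
    N ∩ ⋂ a ∈ t, M' a, hN.inter (isOpen_biInter_finset fun a _ => hM'o a),
    Set.subset_inter hKN (Set.subset_iInter₂ fun a _ => hKM' a),
    fun x hx => (hNU hx.1).1, fun x hx w => ?_⟩
  · rw [hlev]
    have hw0 := norm_pos_iff.2 hw
    have hC0 : 0 < C := by positivity
    have hCS0 : 0 ≤ C * leviForm S x w := mul_nonneg hC0.le (hS0 x w)
    by_cases hxN : x ∈ N
    · rw [leviForm_congr (hPN x hxN)]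
      have := hpos x (hNU hxN).1 w hw
      have := hT0 x w
      linarith
    · by_cases hxR : x ∈ Metric.closedBall (0 : Cn n) (R + 1)
      · have h1 := (abs_le.1 (hBl x hxR w)).1
        have h2 : (B + 1) * ‖w‖ ^ 2 ≤ C * leviForm S x w := by
          calc (B + 1) * ‖w‖ ^ 2 = C * (b * ‖w‖ ^ 2) := by rw [hC]; field_simp
            _ ≤ _ := mul_le_mul_of_nonneg_left (hbQ x ⟨hxR, hxN⟩ w) hC0.le
        have := hT0 x w
        nlinarith [sq_pos_of_pos hw0]
      · have hx1 : R + 1 < ‖x‖ := by simpa using hxR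
        have hP0 : P =ᶠ[nhds x] fun _ => 0 := by
          have : x ∉ tsupport χ := fun h => by
            have := (hχU h).2
            rw [mem_ball_zero_iff] at this
            linarith
          filter_upwards [notMem_tsupport_iff_eventuallyEq.1 this] with y hy
          simp [hP, hy]
        rw [leviForm_congr hP0, leviForm_const]
        have h1 := leviForm_ramp_norm_sq_sub (R ^ 2) x w
        rw [Real.smoothTransition.one_of_one_le (by nlinarith)] at h1
        have : 0 < 4 * 1 * ‖w‖ ^ 2 := by positivity
        linarith
  · have e1 : (fun z => P z + (C * S z + T z) - φ z) =ᶠ[nhds x] fun z => C * S z := by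
      have hxR : ‖x‖ < R := by simpa using (hNU hx.1).2
      filter_upwards [hPN x hx.1, (Metric.isOpen_ball (x := (0 : Cn n)) (ε := R)).mem_nhds
        (hNU hx.1).2] with y hy hyR
      have hyR' : ‖y‖ < R := mem_ball_zero_iff.1 hyR
      have : T y = 0 := ramp_of_nonpos (by nlinarith [norm_nonneg y])
      rw [hy, this]
      ring
    rw [leviForm_congr e1, leviForm_const_mul hSs.contDiffAt, hlS,
      Finset.sum_eq_zero fun a ha => hM' a x (Set.mem_iInter₂.1 hx.2 a ha) w, mul_zero]

end Forward

section LocalPotential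

variable {h : Cn n → ℝ} {B : Set (Cn n)} {f g : Cn n → ℂ}

theorem fderiv_fderiv_add_I_eq_zero {x : Cn n} (hh : ContDiffAt ℝ ∞ h x)
    (hl : ∀ w, leviForm h x w = 0) (v w : Cn n) :
    fderiv ℝ (fderiv ℝ h) x v w + fderiv ℝ (fderiv ℝ h) x (I • v) (I • w) = 0 := by
  have h1 := hl (v + w)
  have h2 := hl v
  have h3 := hl w
  rw [leviForm_eq] at h1 h2 h3
  simp only [smul_add, map_add, add_apply] at h1
  rw [fderiv_fderiv_symm hh w v, fderiv_fderiv_symm hh (I • w) (I • v)] at h1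
  linarith

/-- A pluriharmonic function on a convex open set is the real part of a holomorphic function. -/
theorem exists_re_eq (hB : IsOpen B) (hBc : Convex ℝ B) (hh : ContDiffOn ℝ ∞ h B)
    (hl : ∀ x ∈ B, ∀ w, leviForm h x w = 0) :
    ∃ f : Cn n → ℂ, DifferentiableOn ℂ f B ∧ ContDiffOn ℝ ∞ f B ∧ ∀ x ∈ B, (f x).re = h x := by
  set J : Cn n →L[ℝ] Cn n := (I • ContinuousLinearMap.id ℂ (Cn n)).restrictScalars ℝ with hJ
  have hJa : ∀ v, J v = I • v := fun v => rfl
  set η : Cn n → Cn n →L[ℝ] ℝ := fun y => -((fderiv ℝ h y) ∘L J) with hη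
  have hat : ∀ x ∈ B, ContDiffAt ℝ ∞ h x := fun x hx => hh.contDiffAt (hB.mem_nhds hx)
  have hηs : ContDiffOn ℝ ∞ η B :=
    ((hh.fderiv_of_isOpen hB (m := ∞) (by simp)).clm_comp contDiffOn_const).neg
  have hηd : ∀ x ∈ B, ∀ v w, fderiv ℝ η x v w = - fderiv ℝ (fderiv ℝ h) x v (I • w) := by
    intro x hx v w
    have e : HasFDerivAt η (-((ContinuousLinearMap.compL ℝ (Cn n) (Cn n) ℝ).flip J ∘L
        fderiv ℝ (fderiv ℝ h) x)) x :=
      ((((ContinuousLinearMap.compL ℝ (Cn n) (Cn n) ℝ).flip J).hasFDerivAt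
        (x := fderiv ℝ h x)).comp x (differentiableAt_fderiv (hat x hx)).hasFDerivAt).neg
    rw [e.fderiv]
    rfl
  obtain ⟨g, hg⟩ := Convex.exists_forall_hasFDerivAt_of_fderiv_symmetric hBc hB
    (hηs.differentiableOn (by simp)) fun x hx v w => by
      rw [hηd x hx, hηd x hx]
      have h1 := fderiv_fderiv_add_I_eq_zero (hat x hx) (hl x hx) v (I • w)
      rw [smul_smul, I_mul_I, neg_one_smul, map_neg] at h1
      rw [fderiv_fderiv_symm (hat x hx) w]
      linarith
  have hgs : ContDiffOn ℝ ∞ g B := by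
    rw [contDiffOn_infty_iff_fderiv_of_isOpen hB]
    exact ⟨fun x hx => (hg x hx).differentiableAt.differentiableWithinAt,
      hηs.congr fun x hx => (hg x hx).fderiv⟩
  have hfs : ContDiffOn ℝ ∞ (fun x => (h x : ℂ) + I * (g x : ℂ)) B :=
    (ofRealCLM.contDiff.comp_contDiffOn hh).add
      (contDiffOn_const.mul (ofRealCLM.contDiff.comp_contDiffOn hgs))
  refine ⟨fun x => (h x : ℂ) + I * (g x : ℂ), fun x hx => ?_, hfs, fun x hx => by simp⟩
  have hx1 := (hat x hx).differentiableAt (by simp)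
  have d : HasFDerivAt (fun x => (h x : ℂ) + I * (g x : ℂ))
      (ofRealCLM ∘L fderiv ℝ h x + I • (ofRealCLM ∘L η x)) x :=
    (ofRealCLM.hasFDerivAt.comp x hx1.hasFDerivAt).add
      ((ofRealCLM.hasFDerivAt.comp x (hg x hx)).const_mul I)
  refine (differentiableAt_of_wd_eq_zero d.differentiableAt fun j => ?_).differentiableWithinAt
  rw [wd, d.fderiv]
  simp [hη, hJa, smul_smul]
  linear_combination (fderiv ℝ h x (e j) : ℂ) * I_sq

theorem exists_eq_add_of_re_eq (hB : IsOpen B) (hBc : Convex ℝ B) (hf : DifferentiableOn ℂ f B)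
    (hg : DifferentiableOn ℂ g B) (hre : ∀ x ∈ B, (f x).re = (g x).re) :
    ∃ c : ℝ, ∀ x ∈ B, f x = g x + c * I := by
  have hd : DifferentiableOn ℂ (fun x => f x - g x) B := hf.sub hg
  obtain ⟨a, ha⟩ := hB.exists_is_const_of_fderiv_eq_zero hBc.isPreconnected hd fun x hx => by
    have hx1 : DifferentiableAt ℂ (fun x => f x - g x) x := (hd x hx).differentiableAt (hB.mem_nhds hx)
    have hx2 := hx1.restrictScalars ℝ
    have key : ∀ v, (fderiv ℝ (fun x => f x - g x) x v).re = 0 := by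
      intro v
      have e1 : (fun x => (f x - g x).re) =ᶠ[nhds x] fun _ => 0 := by
        filter_upwards [hB.mem_nhds hx] with y hy
        simp [hre y hy]
      have e2 := (reCLM.hasFDerivAt.comp x hx2.hasFDerivAt).fderiv
      have e3 := congrArg (fun T => T v) (e2.symm.trans e1.fderiv_eq)
      simpa using e3
    ext v
    have h1 := key v
    have h2 := key (I • v)
    rw [fderiv_real_smul_I hx1] at h2
    rw [hx1.fderiv_restrictScalars ℝ] at h1 h2
    apply Complex.ext
    · simpa using h1
    · simpa using h2
  refine ⟨a.im, fun x hx => ?_⟩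
  have h1 := ha x hx
  have h2 : a.re = 0 := by rw [← h1]; simp [hre x hx]
  rw [← sub_eq_iff_eq_add', h1]
  apply Complex.ext <;> simp [h2]

end LocalPotential

section Dirichlet

theorem exists_nat_cexp_sub_one_le {ι : Type*} [Fintype ι] (c : ι → ℝ) {ε : ℝ} (hε : 0 < ε)
    (N₀ : ℕ) : ∃ N : ℕ, N₀ ≤ N ∧ ∀ i, ‖cexp (N * (c i * I)) - 1‖ ≤ ε := by
  set u : ℕ → ι → ℂ := fun k i => cexp (k * (c i * I)) with hu
  have hn : ∀ k i, ‖u k i‖ = 1 := fun k i => by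
    simp only [hu]
    rw [show (k : ℂ) * (c i * I) = ((k * c i : ℝ) : ℂ) * I by push_cast; ring,
      norm_exp_ofReal_mul_I]
  obtain ⟨a, -, φ, hφ, hlim⟩ := (isCompact_closedBall (0 : ι → ℂ) 1).tendsto_subseq (x := u)
    fun k => by
      rw [mem_closedBall_zero_iff]
      exact (pi_norm_le_iff_of_nonneg zero_le_one).2 fun i => (hn k i).le
  obtain ⟨m, hm⟩ := Metric.cauchySeq_iff'.1 hlim.cauchySeq ε hε
  have hle : φ m + N₀ ≤ φ (m + N₀) := by
    induction N₀ with
    | zero => simp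
    | succ k ih => have := hφ (show m + k < m + (k + 1) by omega); omega
  refine ⟨φ (m + N₀) - φ m, by omega, fun i => ?_⟩
  have h1 : u (φ (m + N₀) - φ m) i * u (φ m) i = u (φ (m + N₀)) i := by
    simp only [hu]
    rw [← Complex.exp_add, Nat.cast_sub (by omega)]
    congr 1
    ring
  have h2 : ‖u (φ (m + N₀)) i - u (φ m) i‖ ≤ ε := by
    have h3 := (hm (m + N₀) (by omega)).le
    rw [dist_eq_norm] at h3
    exact (norm_le_pi_norm (u (φ (m + N₀)) - u (φ m)) i).trans h3
  rw [← h1, ← sub_one_mul, norm_mul, hn, mul_one] at h2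
  exact h2

end Dirichlet

section Sections

theorem wd_mul_cexp {B : Set (Cn n)} (hB : IsOpen B) {f : Cn n → ℂ} (hf : DifferentiableOn ℂ f B)
    {u : Cn n → ℂ} (hu : ContDiff ℝ ∞ u) (huB : tsupport u ⊆ B) (c : ℂ) (j : Fin n) (x : Cn n) :
    wd I j (fun y => u y * cexp (c * f y)) x = wd I j u x * cexp (c * f x) := by
  by_cases hx : x ∈ tsupport u
  · have hfx : DifferentiableAt ℂ f x := (hf x (huB hx)).differentiableAt (hB.mem_nhds (huB hx))
    have hcf : DifferentiableAt ℂ (fun y => c * f y) x := hfx.const_mul c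
    have hcr : DifferentiableAt ℝ (fun y => c * f y) x := hcf.restrictScalars ℝ
    rw [wd_mul ((hu.differentiable (by simp)) x) hcr.cexp, wd_cexp hcr,
      wd_eq_zero_of_differentiableAt hcf]
    ring
  · have h0 := notMem_tsupport_iff_eventuallyEq.1 hx
    have h1 : (fun y => u y * cexp (c * f y)) =ᶠ[nhds x] fun _ => 0 := by
      filter_upwards [h0] with y hy
      simp [hy]
    have h2 : u =ᶠ[nhds x] fun _ => 0 := h0
    rw [wd_congr h1, wd_congr h2, wd_const, zero_mul]

/-- Approximately holomorphic sections of large powers of the flat bundle with metric `e^{-2h}`. -/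
theorem exists_section {W : Set (Cn n)} (hW : IsOpen W) {h : Cn n → ℝ} (hh : ContDiffOn ℝ ∞ h W)
    (hl : ∀ x ∈ W, ∀ w, leviForm h x w = 0) {χ : Cn n → ℝ} (hχ : ContDiff ℝ ∞ χ)
    (hχc : HasCompactSupport χ) (hχW : tsupport χ ⊆ W) (hχ0 : ∀ x, 0 ≤ χ x) :
    ∃ r : ℝ, 0 < r ∧ ∃ D : ℝ, 0 ≤ D ∧ ∀ ε : ℝ, 0 < ε → ∀ N₀ : ℕ, ∃ N : ℕ, N₀ ≤ N ∧
      ∃ s : Cn n → ℂ, ContDiff ℝ ∞ s ∧ tsupport s ⊆ tsupport χ ∧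
      (∀ x ∈ tsupport χ, ∑ j, ‖wd I j s x‖ ^ 2 ≤ Real.exp (2 * N * h x) *
        (D * ε ^ 2 + 2 * ∑ j, ‖wd I j (fun y => (χ y : ℂ)) x‖ ^ 2)) ∧
      ∀ p ∈ tsupport χ, Metric.ball p r ⊆ W ∧ ∃ g : Cn n → ℂ,
        DifferentiableOn ℂ g (Metric.ball p r) ∧ (∀ x ∈ Metric.ball p r, (g x).re = h x) ∧
        ∀ x ∈ Metric.ball p r, ‖s x * cexp (-N * g x) - χ x‖ ≤ ε * χ x := by
  classical
  have hρ : ∀ x ∈ W, ∃ ρ : ℝ, 0 < ρ ∧ Metric.ball x ρ ⊆ W := fun x hx =>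
    Metric.isOpen_iff.1 hW x hx
  choose! ρ hρ0 hρW using hρ
  obtain ⟨t, ht, htc⟩ := (show IsCompact (tsupport χ) from hχc).elim_nhds_subcover
    (fun x => Metric.ball x (ρ x)) fun x hx => Metric.ball_mem_nhds x (hρ0 x (hχW hx))
  set B : t → Set (Cn n) := fun i => Metric.ball i.1 (ρ i.1) with hB
  have hBo : ∀ i, IsOpen (B i) := fun i => Metric.isOpen_ball
  have hBW : ∀ i, B i ⊆ W := fun i => hρW _ (hχW (ht _ i.2))
  have hcov : tsupport χ ⊆ ⋃ i, B i := fun x hx => by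
    obtain ⟨a, ha, hxa⟩ := Set.mem_iUnion₂.1 (htc hx)
    exact Set.mem_iUnion.2 ⟨⟨a, ha⟩, hxa⟩
  have hloc : ∀ i, ∃ f : Cn n → ℂ, DifferentiableOn ℂ f (B i) ∧ ContDiffOn ℝ ∞ f (B i) ∧
      ∀ x ∈ B i, (f x).re = h x := fun i =>
    exists_re_eq (hBo i) (convex_ball _ _) (hh.mono (hBW i)) fun x hx => hl x (hBW i hx)
  choose f hf hfs hfr using hloc
  have hcst : ∀ i k, ∃ c : ℝ, ∀ x ∈ B i ∩ B k, f k x = f i x + c * I := fun i k =>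
    exists_eq_add_of_re_eq ((hBo i).inter (hBo k)) ((convex_ball _ _).inter (convex_ball _ _))
      ((hf k).mono Set.inter_subset_right) ((hf i).mono Set.inter_subset_left)
      fun x hx => by rw [hfr k x hx.2, hfr i x hx.1]
  choose c hc using hcst
  obtain ⟨P, hP⟩ := SmoothPartitionOfUnity.exists_isSubordinate
    (modelWithCornersSelf ℝ (Cn n)) (isClosed_tsupport χ) B hBo hcov
  set u : t → Cn n → ℂ := fun i x => ((χ x * P i x : ℝ) : ℂ) with hu
  have hus : ∀ i, ContDiff ℝ ∞ (u i) := fun i =>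
    ofRealCLM.contDiff.comp (hχ.mul (P i).contMDiff.contDiff)
  have huB : ∀ i, tsupport (u i) ⊆ B i := fun i => by
    refine subset_trans (closure_mono fun x hx => ?_) (hP i)
    simp only [hu, Function.mem_support, ne_eq, ofReal_eq_zero, mul_eq_zero, not_or] at hx
    exact hx.2
  have hun : ∀ i x, ‖u i x‖ = χ x * P i x := fun i x => by
    rw [hu, norm_real, Real.norm_of_nonneg (mul_nonneg (hχ0 x) (P.nonneg i x))]
  have hsum : ∀ x, ∑ i, χ x * P i x = χ x := by
    intro x
    by_cases hx : x ∈ tsupport χ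
    · rw [← Finset.mul_sum, ← finsum_eq_sum_of_fintype, P.sum_eq_one hx, mul_one]
    · simp [image_eq_zero_of_notMem_tsupport hx]
  have hsumu : (fun x => ∑ i, u i x) = fun x => (χ x : ℂ) := by
    funext x
    simp only [hu]
    rw [← ofReal_sum, hsum]
  obtain ⟨r, hr, hrL⟩ := lebesgue_number_lemma_of_metric hχc hBo hcov
  have hScont : Continuous fun x => 2 * ∑ j, (∑ i, ‖wd I j (u i) x‖) ^ 2 :=
    continuous_const.mul (continuous_finsetSum _ fun j _ => (continuous_finsetSum _ fun i _ =>
      (contDiff_wd (hus i)).continuous.norm).pow 2)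
  obtain ⟨D, hD⟩ := (show IsCompact (tsupport χ) from hχc).exists_bound_of_continuousOn
    hScont.continuousOn
  refine ⟨r, hr, max D 0, le_max_right _ _, fun ε hε N₀ => ?_⟩
  obtain ⟨N, hN, hNc⟩ := exists_nat_cexp_sub_one_le (fun q : t × t => c q.1 q.2) hε N₀
  have hsec : ∀ i, ∀ x ∈ B i, ∀ v : t → ℂ, (∀ k, x ∉ B k → v k = 0) →
      ‖(∑ k, v k * cexp (N * f k x)) * cexp (-N * f i x) - ∑ k, v k‖ ≤ ε * ∑ k, ‖v k‖ := by
    intro i x hx v hv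
    rw [Finset.sum_mul, ← Finset.sum_sub_distrib, Finset.mul_sum]
    refine norm_sum_le_of_le _ fun k _ => ?_
    by_cases hk : x ∈ B k
    · have e1 : v k * cexp (N * f k x) * cexp (-N * f i x) - v k =
          v k * (cexp (N * (c i k * I)) - 1) := by
        rw [mul_assoc, ← Complex.exp_add, hc i k x ⟨hx, hk⟩, mul_sub, mul_one]
        congr 3
        ring
      rw [e1, norm_mul, mul_comm]
      exact mul_le_mul_of_nonneg_right (hNc (i, k)) (norm_nonneg _)
    · simp [hv k hk]
  set T : t → Cn n → ℂ := fun k x => u k x * cexp (N * f k x) with hT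
  have hTs : ∀ k, ContDiff ℝ ∞ (T k) := by
    intro k
    have h1 : ContDiffOn ℝ ∞ (fun x => cexp (N * f k x)) (B k) :=
      (contDiffOn_const.mul (hfs k)).cexp
    have h2 := contDiff_mul_of_tsupport_subset (hBo k) (χ := fun x => χ x * P k x)
      (hχ.mul (P k).contMDiff.contDiff)
      ((tsupport_mul_subset_right (f := χ) (g := P k)).trans (hP k)) h1
    simpa [hT, hu] using h2
  have huz : ∀ x k, x ∉ B k → u k x = 0 := fun x k hk =>
    image_eq_zero_of_notMem_tsupport fun h => hk (huB k h)
  have hwz : ∀ j x k, x ∉ B k → wd I j (u k) x = 0 := fun j x k hk =>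
    image_eq_zero_of_notMem_tsupport fun h => hk (huB k (tsupport_wd_subset h))
  have hds : ∀ j x, wd I j (fun x => ∑ k, T k x) x = ∑ k, wd I j (u k) x * cexp (N * f k x) := by
    intro j x
    rw [wd_sum fun k _ => ((hTs k).differentiable (by simp)) x]
    exact Finset.sum_congr rfl fun k _ => wd_mul_cexp (hBo k) (hf k) (hus k) (huB k) N j x
  have hdχ : ∀ j x, wd I j (fun y => (χ y : ℂ)) x = ∑ k, wd I j (u k) x := by
    intro j x
    rw [← hsumu, wd_sum fun k _ => ((hus k).differentiable (by simp)) x]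
  refine ⟨N, hN, fun x => ∑ k, T k x, ContDiff.sum fun k _ => hTs k, ?_, fun x hx => ?_,
    fun p hp => ?_⟩
  · refine closure_mono fun x hx => ?_
    contrapose! hx
    have : χ x = 0 := by simpa using hx
    simp [hT, hu, this]
  · obtain ⟨i, hi⟩ := Set.mem_iUnion.1 (hcov hx)
    have hj : ∀ j, ‖wd I j (fun x => ∑ k, T k x) x‖ ^ 2 ≤ Real.exp (2 * N * h x) *
        (2 * ε ^ 2 * (∑ k, ‖wd I j (u k) x‖) ^ 2 + 2 * ‖wd I j (fun y => (χ y : ℂ)) x‖ ^ 2) := by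
      intro j
      have h1 := hsec i x hi (fun k => wd I j (u k) x) fun k hk => hwz j x k hk
      rw [← hds, ← hdχ] at h1
      have h2 : ‖wd I j (fun x => ∑ k, T k x) x * cexp (-N * f i x)‖ =
          ‖wd I j (fun x => ∑ k, T k x) x‖ * Real.exp (-(N * h x)) := by
        rw [norm_mul, norm_exp]
        congr 2
        simp [hfr i x hi]
      have h3 := h2 ▸ (norm_le_insert' (wd I j (fun x => ∑ k, T k x) x * cexp (-N * f i x))
        (wd I j (fun y => (χ y : ℂ)) x))
      have h4 : ‖wd I j (fun x => ∑ k, T k x) x‖ * Real.exp (-(N * h x)) ≤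
          ‖wd I j (fun y => (χ y : ℂ)) x‖ + ε * ∑ k, ‖wd I j (u k) x‖ := h3.trans (by gcongr)
      have h5 : ‖wd I j (fun x => ∑ k, T k x) x‖ ≤ Real.exp (N * h x) *
          (‖wd I j (fun y => (χ y : ℂ)) x‖ + ε * ∑ k, ‖wd I j (u k) x‖) := by
        rw [Real.exp_neg, ← div_eq_mul_inv, div_le_iff₀ (Real.exp_pos _)] at h4
        linarith
      calc ‖wd I j (fun x => ∑ k, T k x) x‖ ^ 2 ≤ (Real.exp (N * h x) *
          (‖wd I j (fun y => (χ y : ℂ)) x‖ + ε * ∑ k, ‖wd I j (u k) x‖)) ^ 2 := by gcongr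
        _ = Real.exp (2 * N * h x) *
          (‖wd I j (fun y => (χ y : ℂ)) x‖ + ε * ∑ k, ‖wd I j (u k) x‖) ^ 2 := by
            rw [mul_pow, ← Real.exp_nat_mul]
            congr 2
            push_cast
            ring
        _ ≤ _ := by
            gcongr
            nlinarith [sq_nonneg (‖wd I j (fun y => (χ y : ℂ)) x‖ - ε * ∑ k, ‖wd I j (u k) x‖)]
    refine (Finset.sum_le_sum fun j _ => hj j).trans ?_
    rw [← Finset.mul_sum, Finset.sum_add_distrib, ← Finset.mul_sum, ← Finset.mul_sum]
    refine mul_le_mul_of_nonneg_left ?_ (Real.exp_pos _).le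
    have h1 := (le_abs_self _).trans ((hD x hx).trans (le_max_left D 0))
    nlinarith [mul_le_mul_of_nonneg_left h1 (sq_nonneg ε)]
  · obtain ⟨i, hi⟩ := hrL p hp
    refine ⟨hi.trans (hBW i), f i, (hf i).mono hi, fun x hx => hfr i x (hi hx), fun x hx => ?_⟩
    have h1 := hsec i x (hi hx) (fun k => u k x) (huz x)
    simp only [hun, hsum] at h1
    rw [show ∑ k, u k x = (χ x : ℂ) from congrFun hsumu x] at h1
    exact h1

end Sections

section PointwiseBounds

/-- A solution of the Cauchy-Riemann equations with the weight `e^{-kΨ}`, together with the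
pointwise bounds that follow from the `L²` estimate. -/
theorem exists_entire_bound (n : ℕ) (R : ℝ) {r : ℝ} (hr : 0 < r) : ∃ C : ℝ, 0 ≤ C ∧
    ∀ (Ψ : Cn n → ℝ), ContDiff ℝ ∞ Ψ → (∀ x w, 0 ≤ leviForm Ψ x w) → ∀ k : ℝ, 0 ≤ k →
    ∀ s : Cn n → ℂ, ContDiff ℝ ∞ s → tsupport s ⊆ Metric.closedBall 0 R → ∀ M : ℝ, 0 ≤ M →
    (∀ x, (∑ j, ‖wd I j s x‖ ^ 2) * Real.exp (-(k * Ψ x)) ≤ M) →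
    ∃ F : Cn n → ℂ, Differentiable ℂ F ∧ ∀ p, Metric.closedBall p r ⊆ Metric.closedBall 0 R →
      ∀ H : Cn n → ℂ, DifferentiableOn ℂ H (Metric.ball p r) → ∀ A E : ℝ, 0 ≤ A → 0 ≤ E →
      (∀ x ∈ Metric.closedBall p (r / 2),
        ‖H x‖ ^ 2 ≤ A * (‖F x - s x‖ ^ 2 * Real.exp (-(k * Ψ x))) + E) →
      ‖H p‖ ^ 2 ≤ C * (A * M + E) := by
  obtain ⟨C, hC, hCe⟩ := exists_interior_estimate n hr
  set v := (volume (Metric.closedBall (0 : Cn n) R)).toReal with hv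
  have hv0 : 0 ≤ v := ENNReal.toReal_nonneg
  have hfin : volume (Metric.closedBall (0 : Cn n) R) ≠ ⊤ :=
    (isCompact_closedBall _ _).measure_lt_top.ne
  refine ⟨C * (Real.exp (R ^ 2) * v + v), by positivity,
    fun Ψ hΨ hΨl k hk s hs hsR M hM hsM => ?_⟩
  have hsc : HasCompactSupport s :=
    (isCompact_closedBall (0 : Cn n) R).of_isClosed_subset (isClosed_tsupport s) hsR
  have hΦ : ContDiff ℝ ∞ fun x : Cn n => k * Ψ x + ‖x‖ ^ 2 :=
    (contDiff_const.mul hΨ).add (contDiff_norm_sq ℝ)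
  obtain ⟨F, hF, hFi, hFe⟩ := exists_entire_sub_le (c := 1) hΦ one_pos (fun x w => by
    rw [leviForm_add (contDiffAt_const.mul hΨ.contDiffAt) (contDiff_norm_sq ℝ).contDiffAt,
      leviForm_const_mul hΨ.contDiffAt, leviForm_norm_sq]
    nlinarith [mul_nonneg hk (hΨl x w)]) hs hsc
  refine ⟨F, hF, fun p hp H hH A E hA hE hHb => ?_⟩
  have hI : ∫ x, (∑ j, ‖wd I j s x‖ ^ 2) * Real.exp (-(k * Ψ x + ‖x‖ ^ 2)) ≤ M * v := by
    rw [← setIntegral_eq_integral_of_forall_compl_eq_zero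
      (s := Metric.closedBall (0 : Cn n) R) fun x hx => by
        rw [Finset.sum_eq_zero fun j _ => ?_, zero_mul]
        rw [image_eq_zero_of_notMem_tsupport fun h => hx (hsR (tsupport_wd_subset h))]
        simp]
    refine (le_abs_self _).trans ?_
    rw [← Real.norm_eq_abs]
    refine norm_setIntegral_le_of_norm_le_const hfin.lt_top fun x _ => ?_
    rw [Real.norm_of_nonneg (by positivity)]
    refine le_trans ?_ (hsM x)
    gcongr
    nlinarith [sq_nonneg ‖x‖]
  have hsub : Metric.closedBall p (r / 2) ⊆ Metric.closedBall 0 R :=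
    (Metric.closedBall_subset_closedBall (by linarith)).trans hp
  have hHc : ContinuousOn H (Metric.closedBall p (r / 2)) :=
    hH.continuousOn.mono (Metric.closedBall_subset_ball (by linarith))
  have hHi : IntegrableOn (fun x => ‖H x‖ ^ 2) (Metric.closedBall p (r / 2)) :=
    (hHc.norm.pow 2).integrableOn_compact (isCompact_closedBall _ _)
  have hGi := (hFi.const_mul (A * Real.exp (R ^ 2))).integrableOn
    (s := Metric.closedBall p (r / 2))
  have hEi : IntegrableOn (fun _ : Cn n => E) (Metric.closedBall p (r / 2)) :=
    continuousOn_const.integrableOn_compact (isCompact_closedBall _ _)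
  have h1 : ∫ x in Metric.closedBall p (r / 2), ‖H x‖ ^ 2 ≤
      ∫ x in Metric.closedBall p (r / 2), (A * Real.exp (R ^ 2) *
        (‖F x - s x‖ ^ 2 * Real.exp (-(k * Ψ x + ‖x‖ ^ 2))) + E) := by
    refine setIntegral_mono_on hHi (hGi.add hEi) Metric.isClosed_closedBall.measurableSet
      fun x hx => (hHb x hx).trans ?_
    have hxR : ‖x‖ ^ 2 ≤ R ^ 2 := by
      have := mem_closedBall_zero_iff.1 (hsub hx)
      gcongr
    have h2 : Real.exp (-(k * Ψ x)) ≤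
        Real.exp (R ^ 2) * Real.exp (-(k * Ψ x + ‖x‖ ^ 2)) := by
      rw [← Real.exp_add]
      exact Real.exp_le_exp.2 (by linarith)
    have h3 := mul_le_mul_of_nonneg_left h2 (mul_nonneg hA (sq_nonneg ‖F x - s x‖))
    linarith
  have h2 : ∫ x in Metric.closedBall p (r / 2), (A * Real.exp (R ^ 2) *
        (‖F x - s x‖ ^ 2 * Real.exp (-(k * Ψ x + ‖x‖ ^ 2))) + E) ≤
      A * Real.exp (R ^ 2) * (M * v) + E * v := by
    rw [integral_add hGi hEi, integral_const_mul]
    refine add_le_add (mul_le_mul_of_nonneg_left ?_ (by positivity)) ?_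
    · refine (setIntegral_le_integral hFi (Filter.Eventually.of_forall fun x => by
        positivity)).trans (hFe.trans ?_)
      simpa using hI
    · rw [setIntegral_const, smul_eq_mul, mul_comm]
      exact mul_le_mul_of_nonneg_left (ENNReal.toReal_mono hfin (measure_mono hsub)) hE
  calc ‖H p‖ ^ 2 ≤ C * (A * Real.exp (R ^ 2) * (M * v) + E * v) :=
        (hCe p H hH).trans (mul_le_mul_of_nonneg_left (h1.trans h2) hC)
    _ ≤ C * (Real.exp (R ^ 2) * v + v) * (A * M + E) := by
        have h3 := mul_nonneg hC (mul_nonneg hv0 (mul_nonneg hA hM))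
        have h4 := mul_nonneg hC (mul_nonneg (mul_nonneg (Real.exp_pos (R ^ 2)).le hv0) hE)
        nlinarith

end PointwiseBounds

section Peak

theorem exists_taylor_two_le {E : Type*} [NormedAddCommGroup E] [NormedSpace ℝ E] {f : E → ℝ}
    {a : E} (hf : ContDiffAt ℝ ∞ f a) {η : ℝ} (hη : 0 < η) : ∃ ρ : ℝ, 0 < ρ ∧
    ∀ z ∈ Metric.ball a ρ, |f z - (f a + fderiv ℝ f a (z - a) +
      2⁻¹ * fderiv ℝ (fderiv ℝ f) a (z - a) (z - a))| ≤ η * ‖z - a‖ ^ 2 := by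
  have h1 := (differentiableAt_fderiv hf).hasFDerivAt.isLittleO.def hη
  obtain ⟨ρ, hρ, hb⟩ := Metric.eventually_nhds_iff_ball.1 (h1.and (eventually_differentiableAt hf))
  refine ⟨ρ, hρ, fun z hz => ?_⟩
  set L := fderiv ℝ f a with hL
  set B := fderiv ℝ (fderiv ℝ f) a with hB
  have hT : ∀ y, HasFDerivAt (fun y => f a + L (y - a) + 2⁻¹ * B (y - a) (y - a))
      (L + B (y - a)) y := by
    intro y
    have hd : HasFDerivAt (fun y => y - a) (ContinuousLinearMap.id ℝ E) y :=
      (hasFDerivAt_id y).sub_const a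
    have h2 : HasFDerivAt (fun y => L (y - a)) (L.comp (ContinuousLinearMap.id ℝ E)) y :=
      L.hasFDerivAt.comp y hd
    have h3 := (B.hasFDerivAt.comp y hd).clm_apply hd
    refine ((h2.const_add (f a)).add (h3.const_mul 2⁻¹)).congr_fderiv ?_
    ext w
    have := fderiv_fderiv_symm hf w (y - a)
    rw [← hB] at this
    rw [map_sub B y a, map_sub (B w), sub_apply] at this
    simp
    linarith
  have hsub : Metric.closedBall a ‖z - a‖ ⊆ Metric.ball a ρ :=
    Metric.closedBall_subset_ball (by simpa [dist_eq_norm] using hz)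
  have hm := (convex_closedBall a ‖z - a‖).norm_image_sub_le_of_norm_hasFDerivWithin_le
    (f := fun y => f y - (f a + L (y - a) + 2⁻¹ * B (y - a) (y - a)))
    (f' := fun y => fderiv ℝ f y - (L + B (y - a))) (C := η * ‖z - a‖)
    (fun y hy => ((hb y (hsub hy)).2.hasFDerivAt.sub (hT y)).hasFDerivWithinAt)
    (fun y hy => by
      have h4 := (hb y (hsub hy)).1
      rw [← sub_sub]
      refine h4.trans ?_
      have h5 : ‖y - a‖ ≤ ‖z - a‖ := by simpa [dist_eq_norm] using hy
      gcongr)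
    (x := a) (y := z) (by simp) (by simp [dist_eq_norm])
  simpa [sq, mul_assoc] using hm

theorem smul_eq_re_smul_add (c : ℂ) (v : Cn n) : c • v = c.re • v + c.im • (I • v) := by
  conv_lhs => rw [← re_add_im c, add_smul, mul_smul]
  simp

theorem I_smul_smul_eq (c : ℂ) (v : Cn n) : I • c • v = c.re • (I • v) - c.im • v := by
  rw [smul_comm, smul_eq_re_smul_add, smul_smul I I, I_mul_I, neg_one_smul, smul_neg,
    sub_eq_add_neg]

/-- The complex bilinear form whose real part on the diagonal is the part of `B` of type
`(2,0) + (0,2)`. -/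
noncomputable def bilinExtend (B : Cn n →L[ℝ] Cn n →L[ℝ] ℝ) : Cn n →ₗ[ℂ] Cn n →ₗ[ℂ] ℂ :=
  LinearMap.mk₂ ℂ (fun v w => (B v w : ℂ) - I * B v (I • w) - I * B (I • v) w - B (I • v) (I • w))
    (fun v v' w => by simp only [map_add, smul_add, add_apply, ofReal_add]; ring)
    (fun c v w => by
      rw [I_smul_smul_eq, smul_eq_re_smul_add c v]
      simp only [map_add, map_sub, map_smul, add_apply, sub_apply, smul_apply,
        smul_eq_mul, ofReal_add, ofReal_sub, ofReal_mul]
      conv_rhs => rw [← re_add_im c]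
      ring_nf
      simp only [I_sq]
      ring)
    (fun v w w' => by simp only [map_add, smul_add, ofReal_add]; ring)
    (fun c v w => by
      rw [I_smul_smul_eq, smul_eq_re_smul_add c w]
      simp only [map_add, map_sub, map_smul, smul_eq_mul, ofReal_add, ofReal_sub, ofReal_mul]
      conv_rhs => rw [← re_add_im c]
      ring_nf
      simp only [I_sq]
      ring)

theorem bilinExtend_apply_self_re (B : Cn n →L[ℝ] Cn n →L[ℝ] ℝ) (w : Cn n) :
    (bilinExtend B w w).re = B w w - B (I • w) (I • w) := by
  simp [bilinExtend]

/-- A point where the Levi form is positive has a holomorphic quadratic polynomial as a strict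
local support function. -/
theorem exists_re_add_norm_sq_le {Ψ : Cn n → ℝ} {a : Cn n} (hΨ : ContDiff ℝ ∞ Ψ)
    (hpos : ∀ w, w ≠ 0 → 0 < leviForm Ψ a w) : ∃ P : Cn n → ℂ, Differentiable ℂ P ∧
    (P a).re = Ψ a ∧ ∃ ρ : ℝ, 0 < ρ ∧ ∃ c : ℝ, 0 < c ∧
      ∀ z ∈ Metric.ball a ρ, (P z).re + c * ‖z - a‖ ^ 2 ≤ Ψ z := by
  obtain ⟨b, hb, hbl⟩ := exists_le_leviForm isOpen_univ hΨ.contDiffOn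
    (isCompact_singleton (x := a)) (Set.subset_univ _) (by rintro x rfl; exact hpos)
  obtain ⟨ρ, hρ, hT⟩ := exists_taylor_two_le (hΨ.contDiffAt (x := a))
    (show 0 < b / 8 by positivity)
  set L := fderiv ℝ Ψ a with hL
  set B := fderiv ℝ (fderiv ℝ Ψ) a with hB
  refine ⟨fun z => Ψ a + StrongDual.extendRCLike (𝕜 := ℂ) L (z - a) +
    4⁻¹ * (bilinExtend B).toContinuousBilinearMap (z - a) (z - a), ?_, ?_, ρ, hρ, b / 8,
    by positivity, fun z hz => ?_⟩
  · fun_prop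
  · simp
  · have h1 := (abs_le.1 (hT z hz)).1
    have h2 := hbl a rfl (z - a)
    rw [leviForm_eq, ← hB] at h2
    have h3 : (StrongDual.extendRCLike (𝕜 := ℂ) L (z - a)).re = L (z - a) :=
      StrongDual.re_extendRCLike_apply (𝕜 := ℂ) L (z - a)
    have h4 : ((4⁻¹ : ℂ) * (bilinExtend B).toContinuousBilinearMap (z - a) (z - a)).re =
        4⁻¹ * (B (z - a) (z - a) - B (I • (z - a)) (I • (z - a))) := by
      rw [LinearMap.toContinuousBilinearMap_apply, ← bilinExtend_apply_self_re,
        show (4⁻¹ : ℂ) = ((4⁻¹ : ℝ) : ℂ) by push_cast; rfl, re_ofReal_mul]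
    rw [add_re, add_re, ofReal_re, h3, h4]
    linarith

end Peak

section Weight

theorem ramp_of_one_le {s : ℝ} (hs : 1 ≤ s) : ramp s = s - 1 + ramp 1 := by
  have hd : ∀ t : ℝ, HasDerivAt (fun t => ramp t - t) (Real.smoothTransition t - 1) t := fun t =>
    (hasDerivAt_ramp t).sub (hasDerivAt_id t)
  have h := constant_of_has_deriv_right_zero (f := fun t => ramp t - t) (a := 1) (b := s)
    (contDiff_ramp.continuous.sub continuous_id).continuousOn (fun t ht => by
      have := hd t
      rw [Real.smoothTransition.one_of_one_le ht.1, sub_self] at this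
      exact this.hasDerivWithinAt) s ⟨hs, le_rfl⟩
  linarith

theorem leviForm_ramp_comp_nonneg {φ : Cn n → ℝ} {x : Cn n} {c d : ℝ} (hd : 0 < d)
    (hφ : ContDiffAt ℝ ∞ φ x) {w : Cn n} (hw : 0 ≤ leviForm φ x w) :
    0 ≤ leviForm (fun y => ramp ((φ y - c) / d)) x w := by
  have h1 : ContDiffAt ℝ ∞ (fun y => d⁻¹ * (φ y - c)) x :=
    contDiffAt_const.mul (hφ.sub contDiffAt_const)
  simp only [div_eq_inv_mul]
  rw [leviForm_comp contDiff_ramp.contDiffAt h1, leviForm_const_mul (hφ.sub contDiffAt_const),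
    leviForm_sub hφ contDiffAt_const, leviForm_const, sub_zero]
  have h2 := deriv_deriv_ramp_nonneg (d⁻¹ * (φ x - c))
  rw [congrFun deriv_ramp]
  have h3 := Real.smoothTransition.nonneg (d⁻¹ * (φ x - c))
  positivity

theorem exists_weight {K V : Set (Cn n)} {φ ψ : Cn n → ℝ} {a : Cn n} (hK : IsCompact K)
    (hV : IsOpen V) (hKV : K ⊆ V) (hφ : ContDiffOn ℝ ∞ φ V)
    (hφl : ∀ x ∈ V, ∀ w, w ≠ 0 → 0 < leviForm φ x w) (hKφ : ∀ x ∈ V, x ∈ K ↔ φ x ≤ 0)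
    (hψ : ContDiff ℝ ∞ ψ) (hψl : ∀ x w, w ≠ 0 → 0 < leviForm ψ x w)
    (hl : ∀ x ∈ V, ∀ w, leviForm (fun z => ψ z - φ z) x w = 0) (ha : a ∉ K) :
    ∃ (N L W K₁ : Set (Cn n)) (Ψ : Cn n → ℝ) (δ : ℝ), IsOpen N ∧ IsCompact L ∧ IsOpen W ∧
      IsCompact K₁ ∧ K ⊆ N ∧ N ⊆ L ∧ L ⊆ W ∧ W ⊆ K₁ ∧ K₁ ⊆ V ∧ a ∉ K₁ ∧ ContDiff ℝ ∞ Ψ ∧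
      (∀ x w, 0 ≤ leviForm Ψ x w) ∧ (∀ w, w ≠ 0 → 0 < leviForm Ψ a w) ∧ 0 < δ ∧
      (∀ x ∈ N, Ψ x = ψ x - φ x) ∧ (∀ x ∈ W, ψ x - φ x ≤ Ψ x) ∧
      ∀ x ∈ W, x ∉ L → ψ x - φ x + δ ≤ Ψ x := by
  classical
  obtain ⟨K₁, hK₁, hKK₁, hK₁V⟩ := exists_compact_between hK (hV.sdiff isClosed_singleton (t := {a}))
    fun x hx => ⟨hKV hx, fun h => ha (h ▸ hx)⟩
  have hK₁V' : K₁ ⊆ V := hK₁V.trans Set.sdiff_subset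
  have haK₁ : a ∉ K₁ := fun h => (hK₁V h).2 rfl
  set W := interior K₁ with hWdef
  have hW : IsOpen W := isOpen_interior
  have hWK₁ : W ⊆ K₁ := interior_subset
  have hφc : ContinuousOn φ K₁ := hφ.continuousOn.mono hK₁V'
  obtain ⟨m, hm, hmφ⟩ : ∃ m, 0 < m ∧ ∀ x ∈ K₁ \ W, m ≤ φ x := by
    have hc : IsCompact (K₁ \ W) := hK₁.diff hW
    rcases (K₁ \ W).eq_empty_or_nonempty with h | h
    · exact ⟨1, one_pos, by simp [h]⟩
    · obtain ⟨y, hy, hmin⟩ := hc.exists_isMinOn h (hφc.mono Set.sdiff_subset)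
      exact ⟨φ y, not_le.1 fun h0 => hy.2 (hKK₁ ((hKφ y (hK₁V' hy.1)).2 h0)), hmin⟩
  have hlevel : ∀ t, IsCompact (K₁ ∩ φ ⁻¹' Set.Iic t) := fun t =>
    hK₁.of_isClosed_subset (hφc.preimage_isClosed_of_isClosed hK₁.isClosed isClosed_Iic)
      Set.inter_subset_left
  have hlevelW : ∀ t, t < m → K₁ ∩ φ ⁻¹' Set.Iic t ⊆ W := fun t ht x hx => by
    by_contra hxW
    have h1 := hmφ x ⟨hx.1, hxW⟩
    have h2 : φ x ≤ t := hx.2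
    linarith
  set d := m / 4 with hd
  have hd0 : 0 < d := by positivity
  set τ : ℝ → ℝ := fun t => d * ramp ((t - d) / d) with hτ
  set Ψ : Cn n → ℝ := fun x => if x ∈ W then ψ x - φ x + τ (φ x) else ψ x + (d * ramp 1 - 2 * d)
    with hΨ
  have hΨW : ∀ x ∈ W, Ψ x = ψ x - φ x + τ (φ x) := fun x hx => if_pos hx
  have hΨ2 : ∀ x, x ∉ K₁ ∩ φ ⁻¹' Set.Iic (m / 2) → Ψ x = ψ x + (d * ramp 1 - 2 * d) := by
    intro x hx
    by_cases hxW : x ∈ W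
    · have h1 : m / 2 < φ x := not_le.1 fun h => hx ⟨hWK₁ hxW, h⟩
      have h2 : 1 ≤ (φ x - d) / d := by
        rw [le_div_iff₀ hd0]
        linarith
      rw [hΨW x hxW, hτ]
      simp only
      rw [ramp_of_one_le h2]
      field_simp
      ring
    · exact if_neg hxW
  have hOpen2 : IsOpen (K₁ ∩ φ ⁻¹' Set.Iic (m / 2))ᶜ := (hlevel _).isClosed.isOpen_compl
  have hE2 : ∀ x, x ∉ K₁ ∩ φ ⁻¹' Set.Iic (m / 2) →
      Ψ =ᶠ[nhds x] fun x => ψ x + (d * ramp 1 - 2 * d) := fun x hx => by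
    filter_upwards [hOpen2.mem_nhds hx] with y hy using hΨ2 y hy
  have hEW : ∀ x ∈ W, Ψ =ᶠ[nhds x] fun x => ψ x - φ x + τ (φ x) := fun x hx => by
    filter_upwards [hW.mem_nhds hx] with y hy using hΨW y hy
  have hφx : ∀ x ∈ W, ContDiffAt ℝ ∞ φ x := fun x hx =>
    hφ.contDiffAt (hV.mem_nhds (hK₁V' (hWK₁ hx)))
  have hτφ : ∀ x ∈ W, ContDiffAt ℝ ∞ (fun y => ramp ((φ y - d) / d)) x := fun x hx =>
    contDiff_ramp.contDiffAt.comp x (((hφx x hx).sub contDiffAt_const).div_const d)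
  have hlev2 : ∀ x, x ∉ K₁ ∩ φ ⁻¹' Set.Iic (m / 2) → ∀ w, w ≠ 0 → 0 < leviForm Ψ x w := by
    intro x hx w hw
    rw [leviForm_congr (hE2 x hx), leviForm_add hψ.contDiffAt contDiffAt_const, leviForm_const,
      add_zero]
    exact hψl x w hw
  have hcover : ∀ x, x ∉ W → x ∉ K₁ ∩ φ ⁻¹' Set.Iic (m / 2) := fun x hx h =>
    hx (hlevelW _ (by linarith) h)
  refine ⟨W ∩ φ ⁻¹' Set.Iio d, K₁ ∩ φ ⁻¹' Set.Iic (m / 2), W, K₁, Ψ, d * ramp 1,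
    (hφ.continuousOn.mono (hWK₁.trans hK₁V')).isOpen_inter_preimage hW isOpen_Iio, hlevel _, hW,
    hK₁, fun x hx => ⟨hKK₁ hx, ((hKφ x (hKV hx)).1 hx).trans_lt hd0⟩,
    fun x hx => ⟨hWK₁ hx.1, ?_⟩, hlevelW _ (by linarith), hWK₁, hK₁V', haK₁, ?_, ?_, ?_,
    mul_pos hd0 (ramp_pos one_pos), ?_, ?_, ?_⟩
  · have h1 : φ x < d := hx.2
    exact show φ x ≤ m / 2 by linarith
  · refine contDiff_iff_contDiffAt.2 fun x => ?_
    by_cases hx : x ∈ W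
    · exact ((hψ.contDiffAt.sub (hφx x hx)).add
        (contDiffAt_const.mul (hτφ x hx))).congr_of_eventuallyEq (hEW x hx)
    · exact (hψ.contDiffAt.add contDiffAt_const).congr_of_eventuallyEq (hE2 x (hcover x hx))
  · intro x w
    rcases eq_or_ne w 0 with rfl | hw
    · rw [leviForm_zero]
    by_cases hx : x ∈ W
    · have hxV := hK₁V' (hWK₁ hx)
      rw [leviForm_congr (hEW x hx), leviForm_add (hψ.contDiffAt.sub (hφx x hx))
        (contDiffAt_const.mul (hτφ x hx)), hl x hxV, zero_add, leviForm_const_mul (hτφ x hx)]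
      exact mul_nonneg hd0.le (leviForm_ramp_comp_nonneg hd0 (hφx x hx) (hφl x hxV w hw).le)
    · exact (hlev2 x (hcover x hx) w hw).le
  · exact hlev2 a fun h => haK₁ h.1
  · intro x hx
    have h1 : φ x < d := hx.2
    rw [hΨW x hx.1, hτ]
    simp only
    rw [ramp_of_nonpos (div_nonpos_of_nonpos_of_nonneg (by linarith) hd0.le)]
    ring
  · intro x hx
    rw [hΨW x hx]
    have := mul_nonneg hd0.le (ramp_nonneg ((φ x - d) / d))
    simp only [hτ]
    linarith
  · intro x hx hxL
    have h1 : m / 2 < φ x := not_le.1 fun h => hxL ⟨hWK₁ hx, h⟩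
    rw [hΨW x hx]
    have h2 : 1 ≤ (φ x - d) / d := by
      rw [le_div_iff₀ hd0]
      linarith
    have := mul_le_mul_of_nonneg_left (ramp_monotone h2) hd0.le
    simp only [hτ]
    linarith

end Weight

section PeakSection

theorem exists_sum_wd_le {u : Cn n → ℂ} (hu : ContDiff ℝ ∞ u) (huc : HasCompactSupport u) :
    ∃ S : ℝ, 0 ≤ S ∧ ∀ x, ∑ j, ‖wd I j u x‖ ^ 2 ≤ S := by
  obtain ⟨S, hS⟩ := (show IsCompact (tsupport u) from huc).exists_bound_of_continuousOn
    (f := fun x => ∑ j, ‖wd I j u x‖ ^ 2) (continuous_finsetSum _ fun j _ =>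
      (contDiff_wd hu).continuous.norm.pow 2).continuousOn
  refine ⟨max S 0, le_max_right _ _, fun x => ?_⟩
  by_cases hx : x ∈ tsupport u
  · exact ((le_abs_self _).trans (hS x hx)).trans (le_max_left _ _)
  · rw [Finset.sum_eq_zero fun j _ => ?_]
    · exact le_max_right _ _
    · rw [image_eq_zero_of_notMem_tsupport fun h => hx (tsupport_wd_subset h)]
      simp

/-- Sections of the weights `e^{-2NΨ}` which concentrate at `a` as `N` grows. -/
theorem exists_peak_section {Ψ : Cn n → ℝ} {a : Cn n} {O : Set (Cn n)} (hO : IsOpen O)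
    (ha : a ∈ O) (hΨ : ContDiff ℝ ∞ Ψ) (hpos : ∀ w, w ≠ 0 → 0 < leviForm Ψ a w) :
    ∃ (P : Cn n → ℂ) (c r S : ℝ), Differentiable ℂ P ∧ (P a).re = Ψ a ∧ 0 < c ∧ 0 < r ∧ 0 ≤ S ∧
      Metric.ball a r ⊆ O ∧
      (∀ x ∈ Metric.ball a r, Ψ x - c / 2 ≤ (P x).re ∧ Ψ x ≤ Ψ a + c / 4) ∧
      ∀ N : ℕ, ∃ s : Cn n → ℂ, ContDiff ℝ ∞ s ∧ tsupport s ⊆ O ∧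
        (∀ x ∈ Metric.ball a r, s x = cexp (N * P x)) ∧
        ∀ x, (∑ j, ‖wd I j s x‖ ^ 2) * Real.exp (-(2 * N * Ψ x)) ≤
          S * Real.exp (-(2 * N * c)) := by
  obtain ⟨P, hP, hPa, ρ, hρ, c, hc, hPc⟩ := exists_re_add_norm_sq_le hΨ hpos
  obtain ⟨χ, hχ, hχc, hχO, -, -, M, hM, haM, hχM⟩ := exists_bump (isCompact_singleton (x := a))
    (hO.inter (Metric.isOpen_ball (x := a) (ε := ρ)))
    (Set.singleton_subset_iff.2 ⟨ha, Metric.mem_ball_self hρ⟩)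
  have haM' : a ∈ M := haM rfl
  obtain ⟨ρ₁, hρ₁, hρM⟩ := Metric.isOpen_iff.1 hM a haM'
  have hχs : ContDiff ℝ ∞ fun x => (χ x : ℂ) := ofRealCLM.contDiff.comp hχ
  have hχt : tsupport (fun x => (χ x : ℂ)) = tsupport χ := by
    simp only [tsupport]
    congr 1
    ext x
    simp
  obtain ⟨S, hS, hSχ⟩ := exists_sum_wd_le hχs (by
    rw [HasCompactSupport, hχt]
    exact hχc)
  set c' := c * ρ₁ ^ 2 with hc'
  have hc'0 : 0 < c' := by positivity
  have hPre : Continuous fun x => (P x).re := continuous_re.comp hP.continuous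
  have hev : ∀ᶠ x in nhds a, Ψ x - c' / 2 ≤ (P x).re ∧ Ψ x ≤ Ψ a + c' / 4 := by
    refine Filter.Eventually.and ?_ ?_
    · have h1 : Filter.Tendsto (fun x => (P x).re - Ψ x) (nhds a) (nhds ((P a).re - Ψ a)) :=
        (hPre.sub hΨ.continuous).continuousAt
      filter_upwards [h1.eventually (lt_mem_nhds (show -(c' / 2) < (P a).re - Ψ a by
        rw [hPa]
        linarith))] with x hx
      linarith
    · filter_upwards [hΨ.continuous.continuousAt.eventually (gt_mem_nhds (show Ψ a < Ψ a + c' / 4 by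
        linarith))] with x hx using hx.le
  obtain ⟨r, hr, hrb⟩ := Metric.eventually_nhds_iff_ball.1
    ((hev.and (hM.mem_nhds haM')).and (hO.mem_nhds ha))
  refine ⟨P, c', r, S, hP, hPa, hc'0, hr, hS, fun x hx => (hrb x hx).2,
    fun x hx => (hrb x hx).1.1, fun N => ⟨fun x => χ x * cexp (N * P x), ?_, ?_, ?_, ?_⟩⟩
  · exact hχs.mul ((contDiff_const.mul (contDiff_of_differentiable hP)).cexp)
  · refine (closure_mono fun x hx => ?_).trans (hχO.trans Set.inter_subset_left)
    have h1 := left_ne_zero_of_mul hx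
    simpa using h1
  · intro x hx
    simp [hχM x (hrb x hx).1.2]
  · intro x
    simp only [wd_mul_cexp isOpen_univ hP.differentiableOn hχs (Set.subset_univ _), norm_mul,
      mul_pow, ← Finset.sum_mul]
    by_cases hx : x ∈ tsupport χ ∧ x ∉ M
    · have h1 := hPc x (hχO hx.1).2
      have h2 : ρ₁ ≤ ‖x - a‖ := by
        rw [← dist_eq_norm]
        exact not_lt.1 fun h => hx.2 (hρM h)
      have h3 : c' ≤ c * ‖x - a‖ ^ 2 := by
        rw [hc']
        gcongr
      rw [mul_assoc, norm_exp, ← Real.exp_nat_mul, ← Real.exp_add]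
      refine mul_le_mul (hSχ x) (Real.exp_le_exp.2 ?_) (Real.exp_pos _).le hS
      have h4 : (N * P x).re = N * (P x).re := by simp
      rw [h4]
      push_cast
      have h5 : (0 : ℝ) ≤ N := N.cast_nonneg
      nlinarith
    · have h0 : ∀ j, wd I j (fun x => (χ x : ℂ)) x = 0 := fun j => by
        by_cases hxt : x ∈ tsupport χ
        · have hxM : x ∈ M := not_not.1 fun h => hx ⟨hxt, h⟩
          rw [wd_congr (v := fun _ => 1), wd_const]
          filter_upwards [hM.mem_nhds hxM] with y hy
          simp [hχM y hy]
        · exact image_eq_zero_of_notMem_tsupport fun h => hxt (hχt ▸ tsupport_wd_subset h)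
      simp only [h0, norm_zero]
      simp
      positivity

end PeakSection

section Backward

theorem exists_nat_mul_exp_neg_lt (X : ℝ) {y η : ℝ} (hy : 0 < y) (hη : 0 < η) :
    ∃ N₀ : ℕ, ∀ N : ℕ, N₀ ≤ N → X * Real.exp (-(N * y)) < η := by
  have h1 : Filter.Tendsto (fun N : ℕ => X * Real.exp (-(N * y))) Filter.atTop (nhds (X * 0)) :=
    (Real.tendsto_exp_neg_atTop_nhds_zero.comp
      (tendsto_natCast_atTop_atTop.atTop_mul_const hy)).const_mul X
  rw [mul_zero] at h1
  exact Filter.eventually_atTop.1 (h1.eventually (gt_mem_nhds hη))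

theorem norm_sq_mul_cexp (N : ℕ) (u g : ℂ) :
    ‖u * cexp (-N * g)‖ ^ 2 = ‖u‖ ^ 2 * Real.exp (-(2 * N * g.re)) := by
  rw [norm_mul, mul_pow, norm_exp, ← Real.exp_nat_mul]
  congr 2
  simp
  ring

set_option maxHeartbeats 1000000 in
theorem principalConvex_of_extension {K V : Set (Cn n)} {φ ψ : Cn n → ℝ} (hK : IsCompact K)
    (hV : IsOpen V) (hKV : K ⊆ V) (hφ : ContDiffOn ℝ ∞ φ V)
    (hφl : ∀ x ∈ V, ∀ w, w ≠ 0 → 0 < leviForm φ x w) (hKφ : ∀ x ∈ V, x ∈ K ↔ φ x ≤ 0)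
    (hψ : ContDiff ℝ ∞ ψ) (hψl : ∀ x w, w ≠ 0 → 0 < leviForm ψ x w)
    (hl : ∀ x ∈ V, ∀ w, leviForm (fun z => ψ z - φ z) x w = 0) : PrincipalConvex K := by
  intro a ha
  obtain ⟨N', L, W, K₁, Ψ, δ, hN', hL, hW, hK₁, hKN', hN'L, hLW, hWK₁, hK₁V, haK₁, hΨ, hΨl, hΨa, hδ,
    hΨN, hΨW, hΨδ⟩ := exists_weight hK hV hKV hφ hφl hKφ hψ hψl hl ha
  set h : Cn n → ℝ := fun x => ψ x - φ x with hh
  obtain ⟨χ, hχ, hχc, hχW, hχ0, -, M, hM, hLM, hχM⟩ := exists_bump hL hW hLW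
  have hWV : W ⊆ V := hWK₁.trans hK₁V
  obtain ⟨r₁, hr₁, D, hD, hsec⟩ := exists_section hW (hψ.contDiffOn.sub (hφ.mono hWV))
    (fun x hx => hl x (hWV hx)) hχ hχc hχW hχ0
  have hχs : ContDiff ℝ ∞ fun x => (χ x : ℂ) := ofRealCLM.contDiff.comp hχ
  obtain ⟨S, hS, hSχ⟩ := exists_sum_wd_le hχs (hχc.comp_left (g := ((↑) : ℝ → ℂ)) ofReal_zero)
  obtain ⟨P, c, r₂, S₂, hP, hPa, hc, hr₂, hS₂, hr₂O, hPr, hpeak⟩ := exists_peak_section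
    (hK₁.isClosed.isOpen_compl.inter Metric.isOpen_ball) ⟨haK₁, Metric.mem_ball_self one_pos⟩ hΨ hΨa
  obtain ⟨r₃, hr₃, hr₃N⟩ := hK.exists_thickening_subset_open hN' hKN'
  have hKr₃ : ∀ p ∈ K, Metric.ball p r₃ ⊆ N' := fun p hp =>
    (Metric.ball_subset_thickening hp r₃).trans hr₃N
  obtain ⟨R, hRK, hRa, hRL⟩ : ∃ R : ℝ, K₁ ⊆ Metric.closedBall 0 R ∧
      (Metric.closedBall a 1 ⊆ Metric.closedBall 0 R) ∧
      ∀ p ∈ K, Metric.closedBall p 1 ⊆ Metric.closedBall 0 R := by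
    obtain ⟨R, hR⟩ := ((hK₁.union (isCompact_singleton (x := a))).isBounded.cthickening
      (δ := 1)).subset_closedBall 0
    have h1 : ∀ p ∈ K₁ ∪ {a}, Metric.closedBall p 1 ⊆ Metric.closedBall 0 R := fun p hp =>
      (Metric.closedBall_subset_cthickening hp 1).trans hR
    exact ⟨R, fun p hp => h1 p (Or.inl hp) (Metric.mem_closedBall_self zero_le_one),
      h1 a (Or.inr rfl), fun p hp => h1 p (Or.inl (hWK₁ (hLW (hN'L (hKN' hp)))))⟩
  obtain ⟨r, hr, hr1, hrr₁, hrr₂, hrr₃⟩ : ∃ r : ℝ, 0 < r ∧ r ≤ 1 ∧ r ≤ r₁ ∧ r ≤ r₂ ∧ r ≤ r₃ :=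
    ⟨min (min 1 r₁) (min r₂ r₃), by positivity, by simp, by simp, by simp, by simp⟩
  obtain ⟨C, hC, hCF⟩ := exists_entire_bound n R hr
  obtain ⟨ε, hε, hεC⟩ : ∃ ε : ℝ, 0 < ε ∧ C * (2 * D + 2) * ε ^ 2 ≤ 1 / 16 := by
    refine ⟨(4 * (C * (2 * D + 2) + 1))⁻¹, by positivity, ?_⟩
    have h1 : 0 ≤ C * (2 * D + 2) := by positivity
    rw [inv_pow, ← div_eq_mul_inv, div_le_iff₀ (by positivity)]
    nlinarith
  obtain ⟨N₀, hN₀⟩ := exists_nat_mul_exp_neg_lt (C * (4 * S + S₂)) (lt_min hδ hc)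
    (show (0 : ℝ) < 1 / 32 by norm_num)
  obtain ⟨N, hN, s, hs, hsχ, hsM, hsp⟩ := hsec ε hε N₀
  obtain ⟨t, ht, htO, htP, htM⟩ := hpeak N
  have hNy := hN₀ N hN
  set X := Real.exp (-(N * min δ c)) with hX
  have hX0 : 0 < X := Real.exp_pos _
  have hN0 : (0 : ℝ) ≤ N := N.cast_nonneg
  have hXδ : Real.exp (-(2 * N * δ)) ≤ X := Real.exp_le_exp.2 (by
    nlinarith [mul_le_mul_of_nonneg_left (min_le_left δ c) hN0, mul_nonneg hN0 hδ.le])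
  have hXc : Real.exp (-(N * c)) ≤ X := Real.exp_le_exp.2 (by
    nlinarith [mul_le_mul_of_nonneg_left (min_le_right δ c) hN0])
  have hk : (0 : ℝ) ≤ 2 * N := by positivity
  have hsR : tsupport s ⊆ Metric.closedBall 0 R := hsχ.trans (hχW.trans (hWK₁.trans hRK))
  have htR : tsupport t ⊆ Metric.closedBall 0 R := fun x hx =>
    hRa (Metric.ball_subset_closedBall (htO hx).2)
  obtain ⟨F, hF, hFp⟩ := hCF Ψ hΨ hΨl (2 * N) hk s hs hsR (D * ε ^ 2 + 2 * S * X) (by positivity)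
    (fun x => by
      by_cases hx : x ∈ tsupport χ
      · have h1 := hsM x hx
        have h2 : Real.exp (2 * N * h x) * Real.exp (-(2 * N * Ψ x)) =
            Real.exp (-(2 * N * (Ψ x - h x))) := by
          rw [← Real.exp_add]
          congr 1
          ring
        have h3 : Real.exp (-(2 * N * (Ψ x - h x))) ≤ 1 := Real.exp_le_one_iff.2 (by
          have := hΨW x (hχW hx)
          have : 0 ≤ Ψ x - h x := by simpa [hh] using this
          have := mul_nonneg hk this
          linarith)
        have h4 : Real.exp (-(2 * N * (Ψ x - h x))) * ∑ j, ‖wd I j (fun y => (χ y : ℂ)) x‖ ^ 2 ≤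
            X * S := by
          by_cases hxM : x ∈ M
          · have h0 : ∀ j, wd I j (fun x => (χ x : ℂ)) x = 0 := fun j => by
              rw [wd_congr (v := fun _ => 1), wd_const]
              filter_upwards [hM.mem_nhds hxM] with y hy
              simp [hχM y hy]
            simp only [h0, norm_zero]
            simp
            positivity
          · refine mul_le_mul (le_trans (Real.exp_le_exp.2 ?_) hXδ) (hSχ x) (by positivity) hX0.le
            have h5 := hΨδ x (hχW hx) fun hxL => hxM (hLM hxL)
            have h6 : δ ≤ Ψ x - h x := by
              simp only [hh]
              linarith
            have := mul_le_mul_of_nonneg_left h6 hk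
            linarith
        have h7 := mul_le_mul_of_nonneg_right h1 (Real.exp_pos (-(2 * N * Ψ x))).le
        have h8 := mul_le_mul_of_nonneg_right h3 (by positivity : 0 ≤ D * ε ^ 2)
        rw [mul_right_comm (Real.exp _), h2] at h7
        linarith
      · rw [Finset.sum_eq_zero fun j _ => ?_, zero_mul]
        · positivity
        · rw [image_eq_zero_of_notMem_tsupport fun h => hx (hsχ (tsupport_wd_subset h))]
          simp)
  obtain ⟨G, hG, hGp⟩ := hCF Ψ hΨ hΨl (2 * N) hk t ht htR (S₂ * Real.exp (-(2 * N * c)))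
    (by positivity) htM
  have hCS : C * (4 * S * X) + C * S₂ * X < 1 / 32 := by linarith
  have hCS0 : 0 ≤ C * (4 * S * X) := by positivity
  have hCS₂0 : 0 ≤ C * S₂ * X := by positivity
  have hsub : Metric.closedBall a (r / 2) ⊆ Metric.ball a r₂ :=
    Metric.closedBall_subset_ball (by linarith)
  have har : Metric.closedBall a r ⊆ Metric.closedBall 0 R :=
    (Metric.closedBall_subset_closedBall hr1).trans hRa
  have hEN : Differentiable ℂ fun x => cexp (-N * P x) := (hP.const_mul _).cexp
  have hGa : ‖G a * cexp (-N * P a) - 1‖ ^ 2 ≤ 1 / 32 := by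
    refine (hGp a har (fun x => G x * cexp (-N * P x) - 1)
      ((hG.mul hEN).sub_const 1).differentiableOn (Real.exp (N * c)) 0 (Real.exp_pos _).le le_rfl
      fun x hx => ?_).trans ?_
    · have h1 : t x * cexp (-N * P x) = 1 := by
        rw [htP x (hsub hx), ← Complex.exp_add]
        simp
      rw [← h1, ← sub_mul, norm_sq_mul_cexp, add_zero, mul_left_comm, ← Real.exp_add]
      gcongr
      nlinarith [(hPr x (hsub hx)).1]
    · rw [add_zero, mul_left_comm (Real.exp _), ← Real.exp_add,
        show (N : ℝ) * c + -(2 * N * c) = -(N * c) by ring]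
      linarith [mul_le_mul_of_nonneg_left hXc (mul_nonneg hC hS₂)]
  have hFa : ‖F a * cexp (-N * P a)‖ ^ 2 ≤ Real.exp (N * c / 2) := by
    have h1 := hFp a har F hF.differentiableOn (Real.exp (2 * N * (Ψ a + c / 4))) 0
      (Real.exp_pos _).le le_rfl fun x hx => by
        have hxs : s x = 0 := image_eq_zero_of_notMem_tsupport fun h =>
          (hr₂O (hsub hx)).1 (hWK₁ (hχW (hsχ h)))
        rw [hxs, sub_zero, add_zero, mul_left_comm, ← Real.exp_add]
        refine le_mul_of_one_le_right (by positivity) (Real.one_le_exp ?_)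
        nlinarith [(hPr x (hsub hx)).2]
    rw [norm_sq_mul_cexp, hPa]
    have h2 : Real.exp (2 * N * (Ψ a + c / 4)) * Real.exp (-(2 * N * Ψ a)) =
        Real.exp (N * c / 2) := by
      rw [← Real.exp_add]
      congr 1
      ring
    have h3 : C * (D * ε ^ 2 + 2 * S * X) ≤ 1 := by nlinarith
    calc ‖F a‖ ^ 2 * Real.exp (-(2 * N * Ψ a))
        ≤ C * (Real.exp (2 * N * (Ψ a + c / 4)) * (D * ε ^ 2 + 2 * S * X) + 0) *
          Real.exp (-(2 * N * Ψ a)) := by gcongr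
      _ = C * (D * ε ^ 2 + 2 * S * X) * Real.exp (N * c / 2) := by
          rw [← h2]
          ring
      _ ≤ _ := mul_le_of_le_one_left (Real.exp_pos _).le h3
  have hβ : 1 / 2 ≤ ‖G a * cexp (-N * P a)‖ := by
    have h1 : ‖G a * cexp (-N * P a) - 1‖ ≤ 1 / 2 := by
      refine abs_le_of_sq_le_sq' ?_ (by norm_num) |>.2
      linarith
    have h2 := norm_sub_norm_le (1 : ℂ) (G a * cexp (-N * P a))
    rw [norm_one, norm_sub_rev] at h2
    linarith
  refine ⟨fun z => G a * F z - F a * G z, (hF.const_mul _).sub (hG.const_mul _), by ring,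
    fun p hp hfp => ?_⟩
  have hpχ : p ∈ tsupport χ := subset_tsupport χ (by
    simp [hχM p (hLM (hN'L (hKN' hp)))])
  obtain ⟨hpW, g, hg, hgre, hgs⟩ := hsp p hpχ
  have hpr₁ : Metric.closedBall p (r / 2) ⊆ Metric.ball p r₁ :=
    Metric.closedBall_subset_ball (by linarith)
  have hpN : Metric.closedBall p (r / 2) ⊆ N' :=
    (Metric.closedBall_subset_ball (by linarith)).trans (hKr₃ p hp)
  have hpr : Metric.closedBall p r ⊆ Metric.closedBall 0 R :=
    (Metric.closedBall_subset_closedBall hr1).trans (hRL p hp)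
  have hgE : DifferentiableOn ℂ (fun x => cexp (-N * g x)) (Metric.ball p r) :=
    ((hg.mono (Metric.ball_subset_ball hrr₁)).const_mul _).cexp
  have hgΨ : ∀ x ∈ Metric.closedBall p (r / 2), (g x).re = Ψ x := fun x hx => by
    rw [hgre x (hpr₁ hx), hΨN x (hpN hx)]
  have hFp1 : ‖F p * cexp (-N * g p) - 1‖ ^ 2 ≤ 1 / 8 := by
    refine (hFp p hpr (fun x => F x * cexp (-N * g x) - 1)
      ((hF.differentiableOn.mul hgE).sub_const 1) 2 (2 * ε ^ 2) zero_le_two (by positivity)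
      fun x hx => ?_).trans (by nlinarith)
    have h1 := hgs x (hpr₁ hx)
    rw [hχM x (hLM (hN'L (hpN hx))), mul_one, ofReal_one] at h1
    have h2 := norm_sq_mul_cexp N (F x - s x) (g x)
    rw [hgΨ x hx] at h2
    rw [← h2]
    have h3 : ‖F x * cexp (-N * g x) - 1‖ ≤ ‖(F x - s x) * cexp (-N * g x)‖ + ε := by
      rw [show F x * cexp (-N * g x) - 1 =
        (F x - s x) * cexp (-N * g x) + (s x * cexp (-N * g x) - 1) by ring]
      exact (norm_add_le _ _).trans (by gcongr)
    calc ‖F x * cexp (-N * g x) - 1‖ ^ 2 ≤ (‖(F x - s x) * cexp (-N * g x)‖ + ε) ^ 2 := by gcongr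
      _ ≤ _ := by nlinarith [sq_nonneg (‖(F x - s x) * cexp (-N * g x)‖ - ε)]
  have hα : 1 / 2 ≤ ‖F p * cexp (-N * g p)‖ := by
    have h1 : ‖F p * cexp (-N * g p) - 1‖ ≤ 1 / 2 := by
      refine abs_le_of_sq_le_sq' ?_ (by norm_num) |>.2
      linarith
    have h2 := norm_sub_norm_le (1 : ℂ) (F p * cexp (-N * g p))
    rw [norm_one, norm_sub_rev] at h2
    linarith
  have hγ : ‖G p * cexp (-N * g p)‖ ^ 2 ≤ C * (S₂ * Real.exp (-(2 * N * c))) := by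
    refine (hGp p hpr (fun x => G x * cexp (-N * g x)) (hG.differentiableOn.mul hgE) 1 0
      zero_le_one le_rfl fun x hx => ?_).trans (by simp)
    have hxt : t x = 0 := image_eq_zero_of_notMem_tsupport fun h =>
      (htO h).1 (hWK₁ (hLW (hN'L (hpN hx))))
    rw [norm_sq_mul_cexp, hgΨ x hx, hxt, sub_zero, one_mul, add_zero]
  have hprod : ‖G a * cexp (-N * P a)‖ * ‖F p * cexp (-N * g p)‖ =
      ‖F a * cexp (-N * P a)‖ * ‖G p * cexp (-N * g p)‖ := by
    rw [← norm_mul, ← norm_mul]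
    congr 1
    linear_combination (cexp (-N * P a) * cexp (-N * g p)) * hfp
  have h1 : (1 / 2 : ℝ) * (1 / 2) ≤ ‖F a * cexp (-N * P a)‖ * ‖G p * cexp (-N * g p)‖ := by
    rw [← hprod]
    exact mul_le_mul hβ hα (by norm_num) (norm_nonneg _)
  have h2 : (‖F a * cexp (-N * P a)‖ * ‖G p * cexp (-N * g p)‖) ^ 2 ≤ C * S₂ * X := by
    rw [mul_pow]
    refine (mul_le_mul hFa hγ (sq_nonneg _) (Real.exp_pos _).le).trans ?_
    have h3 : Real.exp (N * c / 2) * Real.exp (-(2 * N * c)) ≤ X := by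
      rw [← Real.exp_add]
      refine le_trans (Real.exp_le_exp.2 ?_) hXc
      nlinarith [mul_nonneg hN0 hc.le]
    linarith [mul_le_mul_of_nonneg_left h3 (mul_nonneg hC hS₂)]
  have h3 := pow_le_pow_left₀ (by norm_num) h1 2
  linarith

end Backward

end Cn

end

/-- for `K = {z ∈ U : φ(z) ≤ 0}` compact, with `φ` smooth strictly
plurisubharmonic on the open set `U`, `K` is convex with respect to principal hypersurfaces
iff there is a global smooth strictly plurisubharmonic `ψ` with `ψ - φ` pluriharmonic
on an open set `V` with `K ⊆ V ⊆ U`. -/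
theorem stmt0 (n : ℕ) (hn : 1 ≤ n) (U : Set (EuclideanSpace ℂ (Fin n))) (hU : IsOpen U)
    (φ : EuclideanSpace ℂ (Fin n) → ℝ) (hφ : ContDiffOn ℝ (⊤ : ℕ∞) φ U)
    (hφspsh : ∀ x ∈ U, ∀ w : EuclideanSpace ℂ (Fin n), w ≠ 0 → 0 < leviForm φ x w)
    (K : Set (EuclideanSpace ℂ (Fin n))) (hK : K = {z | z ∈ U ∧ φ z ≤ 0})
    (hKc : IsCompact K) :
    PrincipalConvex K ↔
      ∃ ψ : EuclideanSpace ℂ (Fin n) → ℝ, ContDiff ℝ (⊤ : ℕ∞) ψ ∧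
        (∀ x : EuclideanSpace ℂ (Fin n), ∀ w : EuclideanSpace ℂ (Fin n), w ≠ 0 →
          0 < leviForm ψ x w) ∧
        ∃ V : Set (EuclideanSpace ℂ (Fin n)), IsOpen V ∧ K ⊆ V ∧ V ⊆ U ∧
          ∀ x ∈ V, ∀ w : EuclideanSpace ℂ (Fin n),
            leviForm (fun z => ψ z - φ z) x w = 0 := by
  subst hK
  have hKU : {z | z ∈ U ∧ φ z ≤ 0} ⊆ U := fun z hz => hz.1
  refine ⟨Cn.exists_extension_of_principalConvex hU hφ hφspsh hKU hKc, ?_⟩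
  rintro ⟨ψ, hψ, hψl, V, hV, hKV, hVU, hl⟩
  exact Cn.principalConvex_of_extension hKc hV hKV (hφ.mono hVU) (fun x hx => hφspsh x (hVU hx))
    (fun x hx => ⟨fun h => h.2, fun h => ⟨hVU hx, h⟩⟩) hψ hψl hl
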